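/- Let n ≥ 1 and let K : ℝ^{n+1} → ℝ be an odd Calderón–Zygmund kernel of homogeneity −n: K(x) = Ω(x)/|x|^n with Ω homogeneous of degree 0, K of class C² on ℝ^{n+1}∖{0} and |∇^j K(x)| ≤ C/|x|^{n+j} for j = 0,1,2 and x ≠ 0. Let E ⊂ ℝ^{n+1} be an n-rectifiable set with locally finite n-dimensional Hausdorff measure, let ν be a finite signed Radon measure on ℝ^{n+1}, fix a ∈ (0,1) and b ∈ (0,a), and let x ↦ N_x be an H^n-measurable choice of unit normals to the approximate tangent n-planes of E. Let f = dν/d(H^n|_E) be the Radon–Nikodym derivative of ν with respect to H^n restricted to E. Then for H^n-a.e. x ∈ E the nontangential limits T^+ν(x) and T^-ν(x) exist and ½(T^+ν(x) − T^-ν(x)) = C_K(N_x) f(x), where C_K(N) = ∫_{L(N)} (Ω(y+N) − Ω(y−N))/(2(|y|² + 1)^{n/2}) dH^n(y) and L(N) is the hyperplane through the origin orthogonal to N. -/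

import Mathlib

open MeasureTheory Metric Filter Set
open scoped ENNReal NNReal Topology RealInnerProductSpace

noncomputable section

/-- Integral of a real function with respect to a (finite) signed measure,
defined via the Jordan decomposition. -/
def sintegral {α : Type*} [MeasurableSpace α]
    (ν : MeasureTheory.SignedMeasure α) (f : α → ℝ) : ℝ :=
  ∫ x, f x ∂ν.toJordanDecomposition.posPart - ∫ x, f x ∂ν.toJordanDecomposition.negPart

/-- The one-sided open cone `X_a(x,u)` with vertex `x`, axis `u` and aperture `a`. -/
def cone {n : ℕ} (a : ℝ) (x u : EuclideanSpace ℝ (Fin (n + 1))) :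
    Set (EuclideanSpace ℝ (Fin (n + 1))) :=
  {y | a * ‖y - x‖ < ⟪y - x, u⟫}

/-- The truncated singular integral `T_ε ν (y) = ∫_{|y-z|>ε} K(y-z) dν(z)`. -/
def Teps {n : ℕ} (K : EuclideanSpace ℝ (Fin (n + 1)) → ℝ)
    (ν : MeasureTheory.SignedMeasure (EuclideanSpace ℝ (Fin (n + 1)))) (ε : ℝ)
    (y : EuclideanSpace ℝ (Fin (n + 1))) : ℝ :=
  sintegral ν (fun z => if ε < dist y z then K (y - z) else 0)

/-- `E ⊆ ℝ^{n+1}` is `n`-rectifiable: up to an `H^n`-null set it is covered by countably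
many Lipschitz images of `ℝ^n`. -/
def Rectifiable (n : ℕ) (E : Set (EuclideanSpace ℝ (Fin (n + 1)))) : Prop :=
  ∃ f : ℕ → EuclideanSpace ℝ (Fin n) → EuclideanSpace ℝ (Fin (n + 1)),
    (∀ k, ∃ L : NNReal, LipschitzWith L (f k)) ∧
    μH[n] (E \ ⋃ k, Set.range (f k)) = 0

/-- `E` has an approximate tangent `n`-plane at `x` with unit normal `u`. -/
def HasApproxTangentNormal (n : ℕ) (E : Set (EuclideanSpace ℝ (Fin (n + 1))))
    (x u : EuclideanSpace ℝ (Fin (n + 1))) : Prop :=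
  ‖u‖ = 1 ∧ ∀ a ∈ Set.Ioo (0 : ℝ) 1,
    Tendsto (fun r : ℝ =>
        μH[n] (E ∩ (cone a x u ∪ cone a x (-u)) ∩ ball x r) / ENNReal.ofReal (r ^ n))
      (𝓝[>] 0) (𝓝 0)

/-- The constant `C_K(N)` appearing in the jump formulas: an integral over the
hyperplane through the origin orthogonal to `N`. -/
def CK (n : ℕ) (Ω : EuclideanSpace ℝ (Fin (n + 1)) → ℝ)
    (N : EuclideanSpace ℝ (Fin (n + 1))) : ℝ :=
  ∫ y in {y : EuclideanSpace ℝ (Fin (n + 1)) | ⟪y, N⟫ = 0},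
    (Ω (y + N) - Ω (y - N)) / (2 * (‖y‖ ^ 2 + 1) ^ ((n : ℝ) / 2)) ∂μH[n]

section my
open ENNReal (ofReal ofReal_add ofReal_coe_nnreal ofReal_div_of_pos ofReal_inv_of_pos ofReal_le_iff_le_toReal ofReal_le_ofReal ofReal_le_ofReal_iff ofReal_lt_top ofReal_mul ofReal_mul' ofReal_ne_top ofReal_of_nonpos ofReal_pos ofReal_pow ofReal_toReal ofReal_toReal_le ofReal_zero)
open Real (norm_of_nonneg norm_eq_abs)
abbrev EV (n : ℕ) := EuclideanSpace ℝ (Fin n)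

abbrev EW (n : ℕ) := EV (n + 1)
abbrev hM (n : ℕ) : Measure (EW n) := μH[n]


structure CZK {W : Type*} [NormedAddCommGroup W] [InnerProductSpace ℝ W] [MeasurableSpace W]
    (n : ℕ) (K : W → ℝ) (C : ℝ) : Prop where
  one_le : 1 ≤ C
  one_le_n : 1 ≤ n
  odd : ∀ x, K (-x) = -K x
  hom : ∀ x (t : ℝ), 0 < t → K (t • x) = K x / t ^ n
  cont : ContinuousOn K {(0 : W)}ᶜ
  meas : Measurable K
  bd : ∀ x, |K x| ≤ C / ‖x‖ ^ n
  lip : ∀ x y, ‖x - y‖ ≤ ‖x‖ / 2 → |K x - K y| ≤ C * ‖x - y‖ / ‖x‖ ^ (n + 1)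
  interp : ∀ (e p q : W) (t : ℝ), 1 ≤ ‖e‖ → ‖p - e‖ ≤ 1 / 2 → ‖q - e‖ ≤ 1 / 2 → 0 ≤ t → t ≤ 1 →
    |K ((1 - t) • p + t • q) - ((1 - t) * K p + t * K q)| ≤ C * (t * (1 - t)) * ‖p - q‖ ^ 2

lemma CZK.zero {W : Type*} [NormedAddCommGroup W] [InnerProductSpace ℝ W] [MeasurableSpace W]
    {n : ℕ} {K : W → ℝ} {C : ℝ} (h : CZK n K C) : K 0 = 0 := by
  have := h.odd 0
  simp at this
  linarith

lemma interp_aux (φ φ' : ℝ → ℝ) (M : ℝ) (_hM : 0 ≤ M)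
    (hd : ∀ t ∈ Icc (0 : ℝ) 1, HasDerivAt φ (φ' t) t)
    (hl : ∀ s ∈ Icc (0 : ℝ) 1, ∀ t ∈ Icc (0 : ℝ) 1, |φ' s - φ' t| ≤ M * |s - t|)
    (t : ℝ) (ht : t ∈ Icc (0 : ℝ) 1) :
    φ t ≤ (1 - t) * φ 0 + t * φ 1 + M / 2 * (t * (1 - t)) := by
  have hconv : ConvexOn ℝ (Icc (0 : ℝ) 1) (fun t => φ t + M / 2 * t ^ 2) := by
    have hd2 : ∀ t ∈ Icc (0 : ℝ) 1, HasDerivAt (fun t => φ t + M / 2 * t ^ 2) (φ' t + M * t) t := by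
      intro t ht
      have := (hd t ht).add (((hasDerivAt_id t).pow 2).const_mul (M / 2))
      refine this.congr_deriv ?_
      simp; ring
    apply MonotoneOn.convexOn_of_deriv (convex_Icc 0 1)
    · intro t ht
      exact (hd2 t ht).continuousAt.continuousWithinAt
    · intro t ht
      exact (hd2 t (interior_subset ht)).differentiableAt.differentiableWithinAt
    · intro s hs t ht hst
      have hs' := interior_subset hs
      have ht' := interior_subset ht
      rw [(hd2 s hs').deriv, (hd2 t ht').deriv]
      have := hl s hs' t ht'
      rw [abs_sub_comm s t, abs_of_nonneg (sub_nonneg.2 hst)] at this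
      have := (abs_le.1 this).2
      linarith
  have := hconv.2 (left_mem_Icc.2 zero_le_one) (right_mem_Icc.2 zero_le_one)
    (sub_nonneg.2 ht.2) ht.1 (by ring)
  simp only [smul_eq_mul, mul_zero, mul_one, zero_add] at this
  nlinarith

theorem CZK.mk' {W : Type*} [NormedAddCommGroup W] [InnerProductSpace ℝ W] [MeasurableSpace W]
    [BorelSpace W] (n : ℕ) (hn : 1 ≤ n)
    (K Ω : W → ℝ) (C : ℝ)
    (hΩhom : ∀ x : W, x ≠ 0 → ∀ t : ℝ, 0 < t → Ω (t • x) = Ω x)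
    (hKform : ∀ x : W, x ≠ 0 → K x = Ω x / ‖x‖ ^ n)
    (hKodd : ∀ x : W, K (-x) = -K x)
    (hKsmooth : ContDiffOn ℝ 2 K {(0 : W)}ᶜ)
    (hKbound : ∀ j ≤ 2, ∀ x : W, x ≠ 0 →
      ‖iteratedFDerivWithin ℝ j K {(0 : W)}ᶜ x‖ ≤ C / ‖x‖ ^ (n + j)) :
    CZK n K (1 + |C| * 2 ^ (n + 2)) := by
  have hK0 : K 0 = 0 := by
    have := hKodd 0
    simp at this; linarith
  have hopen : IsOpen ({(0 : W)}ᶜ) := isOpen_compl_singleton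
  have hU : UniqueDiffOn ℝ ({(0 : W)}ᶜ) := hopen.uniqueDiffOn
  have hcont := hKsmooth.continuousOn
  have hCle : |C| ≤ 1 + |C| * 2 ^ (n + 2) := by
    have h1 : (1 : ℝ) ≤ 2 ^ (n + 2) := one_le_pow₀ (by norm_num)
    nlinarith [abs_nonneg C]
  have hdiff : ∀ x : W, x ≠ 0 → DifferentiableAt ℝ K x := fun x hx =>
    (hKsmooth.differentiableOn (by norm_num)).differentiableAt (hopen.mem_nhds hx)
  have hfd : ∀ x : W, x ≠ 0 → fderivWithin ℝ K {(0 : W)}ᶜ x = fderiv ℝ K x := fun x hx =>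
    fderivWithin_of_isOpen hopen hx
  have hgrad : ∀ x : W, x ≠ 0 → ‖fderiv ℝ K x‖ ≤ |C| / ‖x‖ ^ (n + 1) := by
    intro x hx
    have := hKbound 1 (by norm_num) x hx
    rw [← norm_iteratedFDerivWithin_fderivWithin hU hx, norm_iteratedFDerivWithin_zero,
      hfd x hx] at this
    exact this.trans (by gcongr; exact le_abs_self C)
  have hc1 : ContDiffOn ℝ 1 (fderiv ℝ K) {(0 : W)}ᶜ :=
    hKsmooth.fderiv_of_isOpen hopen (by norm_num)
  have hd1 : ∀ x : W, x ≠ 0 → DifferentiableAt ℝ (fderiv ℝ K) x := fun x hx =>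
    (hc1.differentiableOn (by norm_num)).differentiableAt (hopen.mem_nhds hx)
  have hhess : ∀ x : W, x ≠ 0 → ‖fderiv ℝ (fderiv ℝ K) x‖ ≤ |C| / ‖x‖ ^ (n + 2) := by
    intro x hx
    have := hKbound 2 le_rfl x hx
    have h2 : fderivWithin ℝ (fderivWithin ℝ K {0}ᶜ) {0}ᶜ x = fderivWithin ℝ (fderiv ℝ K) {0}ᶜ x :=
      fderivWithin_congr (s := {(0 : W)}ᶜ) (fun y hy => hfd y hy) (hfd x hx)
    rw [← norm_iteratedFDerivWithin_fderivWithin hU hx,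
      ← norm_iteratedFDerivWithin_fderivWithin hU hx, norm_iteratedFDerivWithin_zero,
      h2, fderivWithin_of_isOpen hopen hx] at this
    exact this.trans (by gcongr; exact le_abs_self C)
  refine ⟨by linarith [show 0 ≤ |C| * 2 ^ (n + 2) by positivity], hn, hKodd, ?_, hcont, ?_, ?_, ?_, ?_⟩
  · intro x t ht
    by_cases hx : x = 0
    · simp [hx, hK0]
    · rw [hKform _ (smul_ne_zero ht.ne' hx), hKform x hx, hΩhom x hx t ht, norm_smul,
        norm_of_nonneg ht.le, mul_pow]
      have : ‖x‖ ≠ 0 := norm_ne_zero_iff.2 hx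
      field_simp
  · exact measurable_of_continuousOn_compl_singleton 0 hcont
  · intro x
    by_cases hx : x = 0
    · subst hx; rw [hK0, abs_zero]; positivity
    · have := hKbound 0 (by norm_num) x hx
      rw [norm_iteratedFDerivWithin_zero, add_zero] at this
      refine (this : |K x| ≤ _).trans ?_
      gcongr
      exact (le_abs_self C).trans hCle
  · intro x y hxy
    by_cases hx : x = 0
    · subst hx
      have : y = 0 := by simpa using hxy
      subst this; simp
    have hx' : 0 < ‖x‖ := norm_pos_iff.2 hx
    have hz : ∀ z ∈ closedBall x (‖x‖ / 2), ‖x‖ / 2 ≤ ‖z‖ := by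
      intro z hz
      rw [mem_closedBall, dist_eq_norm] at hz
      have := norm_sub_norm_le x z
      rw [norm_sub_rev] at this
      linarith
    have hz0 : ∀ z ∈ closedBall x (‖x‖ / 2), z ≠ 0 := by
      intro z h h0
      have := hz z h
      rw [h0, norm_zero] at this; linarith
    have key := Convex.norm_image_sub_le_of_norm_fderiv_le (𝕜 := ℝ) (f := K)
      (C := |C| * 2 ^ (n + 1) / ‖x‖ ^ (n + 1)) (s := closedBall x (‖x‖ / 2)) (x := y) (y := x)
      (fun z h => hdiff z (hz0 z h)) (fun z h => ?_) (convex_closedBall _ _) ?_ ?_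
    · refine (key : |K x - K y| ≤ _).trans ?_
      rw [mul_div_right_comm (1 + _)]
      gcongr
      have : |C| * 2 ^ (n + 2) = 2 * (|C| * 2 ^ (n + 1)) := by ring
      rw [this]
      have : 0 ≤ |C| * 2 ^ (n + 1) := by positivity
      linarith
    · refine (hgrad z (hz0 z h)).trans ?_
      rw [div_le_div_iff₀ (by have := hz0 z h; positivity) (by positivity), mul_assoc, ← mul_pow]
      gcongr
      have := hz z h; linarith
    · rw [mem_closedBall, dist_eq_norm, norm_sub_rev]; exact hxy
    · exact mem_closedBall_self (by positivity)
  · intro e p q t he hp hq ht0 ht1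
    have hz : ∀ z ∈ closedBall e (1 / 2), 1 / 2 ≤ ‖z‖ := by
      intro z hz
      rw [mem_closedBall, dist_eq_norm] at hz
      have := norm_sub_norm_le e z
      rw [norm_sub_rev] at this
      linarith
    have hz0 : ∀ z ∈ closedBall e (1 / 2), z ≠ 0 := by
      intro z h h0
      have := hz z h
      rw [h0, norm_zero] at this; linarith
    have hconv : Convex ℝ (closedBall e (1 / 2)) := convex_closedBall _ _
    have hpm : p ∈ closedBall e (1 / 2) := by rw [mem_closedBall, dist_eq_norm]; exact hp
    have hqm : q ∈ closedBall e (1 / 2) := by rw [mem_closedBall, dist_eq_norm]; exact hq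
    have hseg : ∀ s ∈ Icc (0 : ℝ) 1, p + s • (q - p) ∈ closedBall e (1 / 2) := by
      intro s hs
      exact hconv.add_smul_sub_mem hpm hqm hs
    have hlipg : ∀ z ∈ closedBall e (1 / 2), ∀ z' ∈ closedBall e (1 / 2),
        ‖fderiv ℝ K z' - fderiv ℝ K z‖ ≤ (|C| * 2 ^ (n + 2)) * ‖z' - z‖ := by
      intro z h z' h'
      refine Convex.norm_image_sub_le_of_norm_fderiv_le (𝕜 := ℝ) (f := fderiv ℝ K)
        (fun z h => hd1 z (hz0 z h)) (fun z h => ?_) hconv h h'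
      refine (hhess z (hz0 z h)).trans ?_
      rw [div_le_iff₀ (by have := hz0 z h; positivity), mul_assoc, ← mul_pow]
      have h1 : (1 : ℝ) ≤ (2 * ‖z‖) ^ (n + 2) := one_le_pow₀ (by have := hz z h; linarith)
      nlinarith [abs_nonneg C]
    have hder : ∀ s ∈ Icc (0 : ℝ) 1, HasDerivAt (fun s : ℝ => K (p + s • (q - p)))
        (fderiv ℝ K (p + s • (q - p)) (q - p)) s := by
      intro s hs
      have h1 : HasDerivAt (fun s : ℝ => p + s • (q - p)) (q - p) s := by
        simpa using ((hasDerivAt_id s).smul_const (q - p)).const_add p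
      exact (hdiff _ (hz0 _ (hseg s hs))).hasFDerivAt.comp_hasDerivAt s h1
    have hlip : ∀ s ∈ Icc (0 : ℝ) 1, ∀ s' ∈ Icc (0 : ℝ) 1,
        |fderiv ℝ K (p + s • (q - p)) (q - p) - fderiv ℝ K (p + s' • (q - p)) (q - p)| ≤
          (|C| * 2 ^ (n + 2) * ‖p - q‖ ^ 2) * |s - s'| := by
      intro s hs s' hs'
      have h1 := hlipg _ (hseg s' hs') _ (hseg s hs)
      have h2 := (fderiv ℝ K (p + s • (q - p)) - fderiv ℝ K (p + s' • (q - p))).le_opNorm (q - p)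
      rw [sub_apply, norm_eq_abs] at h2
      refine h2.trans ((mul_le_mul_of_nonneg_right h1 (norm_nonneg _)).trans (le_of_eq ?_))
      have : p + s • (q - p) - (p + s' • (q - p)) = (s - s') • (q - p) := by
        rw [sub_smul]; abel
      rw [this, norm_smul, norm_eq_abs, norm_sub_rev p q]
      ring
    have hM : 0 ≤ |C| * 2 ^ (n + 2) * ‖p - q‖ ^ 2 := by positivity
    have u1 := interp_aux _ _ _ hM hder hlip t ⟨ht0, ht1⟩
    have u2 := interp_aux (fun s => - K (p + s • (q - p)))
      (fun s => - fderiv ℝ K (p + s • (q - p)) (q - p)) _ hM (fun s hs => (hder s hs).neg)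
      (fun s hs s' hs' => by
        rw [neg_sub_neg, abs_sub_comm]; exact hlip s hs s' hs') t ⟨ht0, ht1⟩
    have e1 : (1 - t) • p + t • q = p + t • (q - p) := by
      rw [sub_smul, smul_sub, one_smul]; abel
    simp only [zero_smul, add_zero, one_smul, add_sub_cancel] at u1 u2
    rw [e1, abs_le]
    have ht' : 0 ≤ t * (1 - t) := mul_nonneg ht0 (by linarith)
    have h3 : 0 ≤ t * (1 - t) * ‖p - q‖ ^ 2 := by positivity
    have h4 : 0 ≤ |C| * 2 ^ (n + 2) * (t * (1 - t) * ‖p - q‖ ^ 2) := by positivity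
    constructor <;> nlinarith


def sl {n m : ℕ} (h : EV n → EV m) (w s : EV n) (u : ℝ) : EV m := u⁻¹ • (h (s + u • w) - h s)

def slE {n m : ℕ} (h : EV n → EV m) (w : EV n) (u : ℝ) : ℝ := ∫ s, ‖sl h w s u‖ ^ 2

section sq
variable {n m : ℕ} {h : EV n → EV m} {L : ℝ≥0} {c w : EV n} {R : ℝ}

lemma sl_cs (hs : ∀ s ∉ closedBall c R, h s = 0) (u : ℝ) :
    HasCompactSupport (fun s => sl h w s u) := by
  refine HasCompactSupport.intro (isCompact_closedBall c (R + ‖u • w‖)) fun s hs' => ?_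
  rw [mem_closedBall, dist_eq_norm, not_le] at hs'
  have h1 : s ∉ closedBall c R := by
    rw [mem_closedBall, dist_eq_norm]; linarith [norm_nonneg (u • w)]
  have h2 : s + u • w ∉ closedBall c R := by
    rw [mem_closedBall, dist_eq_norm]
    have := norm_sub_norm_le (s - c) (-(u • w))
    rw [norm_neg, sub_neg_eq_add, sub_add_eq_add_sub] at this
    linarith
  simp [sl, hs _ h1, hs _ h2]

lemma sl_int (hL : LipschitzWith L h) (hs : ∀ s ∉ closedBall c R, h s = 0) (u : ℝ) :
    Integrable (fun s => ‖sl h w s u‖ ^ 2) := by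
  have hc := hL.continuous
  refine Continuous.integrable_of_hasCompactSupport (by unfold sl; fun_prop) ?_
  exact (sl_cs hs u).comp_left (g := fun x => ‖x‖ ^ 2) (by simp)

lemma slE_nonneg (u : ℝ) : 0 ≤ slE h w u := integral_nonneg fun _ => by positivity

lemma slE_le (hL : LipschitzWith L h) (hs : ∀ s ∉ closedBall c R, h s = 0) (u : ℝ) :
    slE h w u ≤ 2 * (L * ‖w‖) ^ 2 * volume.real (closedBall c R) := by
  set B := closedBall c R
  have hB : MeasurableSet B := measurableSet_closedBall
  have hBf : volume B ≠ ⊤ := measure_closedBall_lt_top.ne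
  have hi : Integrable (B.indicator fun _ => (1 : ℝ)) (volume : Measure (EV n)) :=
    (integrable_indicator_iff hB).2 (integrableOn_const hBf)
  have key : ∀ s, ‖sl h w s u‖ ^ 2 ≤ (L * ‖w‖) ^ 2 *
      (B.indicator (fun _ => (1 : ℝ)) s + B.indicator (fun _ => (1 : ℝ)) (s + u • w)) := by
    intro s
    by_cases h1 : s ∈ B ∨ s + u • w ∈ B
    · have h2 : (1 : ℝ) ≤ B.indicator (fun _ => (1 : ℝ)) s + B.indicator (fun _ => (1 : ℝ)) (s + u • w) := by
        have e1 : (0 : ℝ) ≤ B.indicator (fun _ => (1 : ℝ)) s := indicator_nonneg (fun _ _ => zero_le_one) _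
        have e2 : (0 : ℝ) ≤ B.indicator (fun _ => (1 : ℝ)) (s + u • w) :=
          indicator_nonneg (fun _ _ => zero_le_one) _
        rcases h1 with h1 | h1 <;> simp only [indicator_of_mem h1] at * <;> linarith
      have h3 : ‖sl h w s u‖ ≤ L * ‖w‖ := by
        by_cases hu : u = 0
        · simp [sl, hu]; positivity
        have := hL.dist_le_mul (s + u • w) s
        rw [dist_eq_norm, dist_eq_norm, add_sub_cancel_left, norm_smul] at this
        rw [sl, norm_smul, norm_inv]
        have hu' : 0 < ‖u‖ := norm_pos_iff.2 hu
        rw [inv_mul_le_iff₀ hu']; linarith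
      calc ‖sl h w s u‖ ^ 2 ≤ (L * ‖w‖) ^ 2 * 1 := by rw [mul_one]; gcongr
        _ ≤ _ := by gcongr
    · push Not at h1
      simp [sl, hs _ h1.1, hs _ h1.2, h1.1, h1.2]
  refine (integral_mono (sl_int hL hs u) ((hi.add (hi.comp_add_right (u • w))).const_mul _) key).trans ?_
  rw [integral_const_mul]
  simp only [Pi.add_apply]
  rw [integral_add hi (hi.comp_add_right (u • w)),
    integral_add_right_eq_self (fun s => B.indicator (fun _ => (1 : ℝ)) s) (u • w),
    integral_indicator hB, setIntegral_const, smul_eq_mul, mul_one]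
  exact le_of_eq (by ring)

lemma slE_meas (hL : LipschitzWith L h) : StronglyMeasurable (slE h w) := by
  refine StronglyMeasurable.integral_prod_right (f := fun u s => ‖sl h w s u‖ ^ 2) ?_
  have hc := hL.continuous
  refine Measurable.stronglyMeasurable ?_
  unfold Function.uncurry sl
  have : Measurable fun a : ℝ × EV n => h (a.2 + a.1 • w) - h a.2 := by
    have : Continuous fun a : ℝ × EV n => h (a.2 + a.1 • w) - h a.2 := by fun_prop
    exact this.measurable
  exact ((measurable_fst.inv.smul this).norm).pow_const 2

lemma sl_ident (hL : LipschitzWith L h) (hs : ∀ s ∉ closedBall c R, h s = 0) {t r : ℝ}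
    (ht : 0 < t) (ht1 : t < 1) (hr : 0 < r) :
    ∫ s, ‖sl h w s (t * r) - sl h w (s + (t * r) • w) (r - t * r)‖ ^ 2 =
      (t * slE h w (t * r) + (1 - t) * slE h w ((1 - t) * r) - slE h w r) / (t * (1 - t)) := by
  have ht1' : 0 < 1 - t := by linarith
  have e0 : r - t * r = (1 - t) * r := by ring
  have pt : ∀ s, ‖sl h w s (t * r) - sl h w (s + (t * r) • w) ((1 - t) * r)‖ ^ 2 =
      (t * (1 - t))⁻¹ * (t * ‖sl h w s (t * r)‖ ^ 2 + (1 - t) * ‖sl h w (s + (t * r) • w) ((1 - t) * r)‖ ^ 2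
        - ‖sl h w s r‖ ^ 2) := by
    intro s
    have h1 : sl h w s r = t • sl h w s (t * r) + (1 - t) • sl h w (s + (t * r) • w) ((1 - t) * r) := by
      unfold sl
      have : s + (t * r) • w + ((1 - t) * r) • w = s + r • w := by
        rw [add_assoc, ← add_smul]; congr 2; ring
      rw [this, smul_smul, smul_smul]
      have h2 : t * (t * r)⁻¹ = r⁻¹ := by field_simp
      have h3 : (1 - t) * ((1 - t) * r)⁻¹ = r⁻¹ := by field_simp
      rw [h2, h3, ← smul_add]; congr 1; abel
    rw [h1, @norm_sub_sq_real, @norm_add_sq_real, norm_smul, norm_smul, norm_of_nonneg ht.le,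
      norm_of_nonneg ht1'.le, real_inner_smul_left, real_inner_smul_right]
    field_simp; ring
  rw [e0]
  simp only [pt]
  have i1 := sl_int (w := w) hL hs (t * r)
  have i2 := (sl_int (w := w) hL hs ((1 - t) * r)).comp_add_right ((t * r) • w)
  have i12 : Integrable (fun s => t * ‖sl h w s (t * r)‖ ^ 2 +
      (1 - t) * ‖sl h w (s + (t * r) • w) ((1 - t) * r)‖ ^ 2) := (i1.const_mul _).add (i2.const_mul _)
  rw [integral_const_mul, integral_sub i12 (sl_int hL hs r),
    integral_add (i1.const_mul _) (i2.const_mul _), integral_const_mul, integral_const_mul,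
    integral_add_right_eq_self (fun s => ‖sl h w s ((1 - t) * r)‖ ^ 2)]
  unfold slE
  rw [div_eq_inv_mul]

lemma frul {e : ℝ → ℝ} {M : ℝ} (he : StronglyMeasurable e) (h0 : ∀ u, 0 ≤ e u) (hM : ∀ u, e u ≤ M)
    {t ρ R : ℝ} (ht : 0 < t) (ht1 : t < 1) (hρ : 0 < ρ) (hR : ρ < R) :
    IntervalIntegrable (fun r => e (t * r) / r) volume ρ R ∧
    IntervalIntegrable (fun r => e r / r) volume ρ R ∧
    (∫ r in ρ..R, e (t * r) / r) - ∫ r in ρ..R, e r / r ≤ M * (-Real.log t) := by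
  have ii : ∀ a b : ℝ, 0 < a → 0 < b → ∀ t, IntervalIntegrable (fun r => e (t * r) / r) volume a b := by
    intro a b ha hb t
    have h1 : IntervalIntegrable (fun r : ℝ => M * (1 / r)) volume a b := by
      apply IntervalIntegrable.const_mul
      apply intervalIntegral.intervalIntegrable_one_div
      · intro x hx h; rw [h] at hx
        have := (mem_uIcc.1 hx); rcases this with h | h <;> linarith
      · exact continuousOn_id
    refine h1.mono_fun ?_ (ae_of_all _ fun r => ?_)
    · exact ((he.measurable.comp (measurable_const_mul t)).div measurable_id).aestronglyMeasurable
    · beta_reduce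
      rw [norm_div, norm_mul, norm_of_nonneg (h0 _), norm_div, norm_one,
        norm_of_nonneg ((h0 0).trans (hM 0)), div_eq_mul_one_div]
      gcongr; exact hM _
  have ii1 : ∀ a b : ℝ, 0 < a → 0 < b → IntervalIntegrable (fun r => e r / r) volume a b := by
    intro a b ha hb; simpa using ii a b ha hb 1
  have hR0 := hρ.trans hR
  refine ⟨ii _ _ hρ hR0 t, ii1 _ _ hρ hR0, ?_⟩
  have h1 : ∫ r in ρ..R, e (t * r) / r = ∫ r in (t * ρ)..(t * R), e r / r := by
    have := intervalIntegral.integral_comp_mul_left (a := ρ) (b := R) (fun r => e r / r) ht.ne'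
    rw [← inv_smul_eq_iff₀ (inv_ne_zero ht.ne'), inv_inv] at this
    rw [← this, ← intervalIntegral.integral_smul]
    congr 1; ext r; rw [smul_eq_mul]; field_simp
  have tρ := mul_pos ht hρ
  have tR := mul_pos ht hR0
  rw [h1, ← intervalIntegral.integral_add_adjacent_intervals (ii1 _ _ tρ hρ) (ii1 _ _ hρ tR),
    ← intervalIntegral.integral_add_adjacent_intervals (ii1 _ _ hρ tR) (ii1 _ _ tR hR0)]
  have h2 : 0 ≤ ∫ r in (t * R)..R, e r / r := by
    refine intervalIntegral.integral_nonneg (by nlinarith) fun u hu => div_nonneg (h0 _) (tR.le.trans hu.1)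
  have h3 : ∫ r in (t * ρ)..ρ, e r / r ≤ ∫ r in (t * ρ)..ρ, M * (1 / r) := by
    refine intervalIntegral.integral_mono_on (by nlinarith) (ii1 _ _ tρ hρ) ?_ ?_
    · simpa [div_eq_mul_inv] using (intervalIntegral.intervalIntegrable_one_div (μ := volume) (f := fun x => x) (fun x hx h => by
        rw [h] at hx; rcases (mem_uIcc.1 hx) with h | h <;> linarith) continuousOn_id).const_mul M
    · intro u hu
      rw [div_eq_mul_one_div]
      have : 0 < u := tρ.trans_le hu.1
      gcongr; exact hM _
  rw [intervalIntegral.integral_const_mul, integral_one_div (fun hx => by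
    rcases (mem_uIcc.1 hx) with h | h <;> linarith)] at h3
  have : Real.log (ρ / (t * ρ)) = - Real.log t := by
    rw [← Real.log_inv]; congr 1; field_simp
  rw [this] at h3
  linarith

lemma log_bd {t : ℝ} (ht : 0 < t) (ht1 : t < 1) : -Real.log t / (1 - t) ≤ 2 * t ^ (-(1 / 2) : ℝ) := by
  have hs : 0 < t ^ (-(1 / 2) : ℝ) := Real.rpow_pos_of_pos ht _
  have h1 := Real.log_le_sub_one_of_pos hs
  rw [Real.log_rpow ht] at h1
  rw [div_le_iff₀ (by linarith)]
  have h3 : t ^ (-(1 / 2) : ℝ) * t ^ (1 / 2 : ℝ) = 1 := by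
    rw [← Real.rpow_add ht]; norm_num
  have h2 : t = t ^ (1 / 2 : ℝ) * t ^ (1 / 2 : ℝ) := by rw [← Real.rpow_add ht]; norm_num
  have h4 : t ^ (1 / 2 : ℝ) ≤ 1 := Real.rpow_le_one ht.le ht1.le (by norm_num)
  have : t ^ (-(1 / 2) : ℝ) * t = t ^ (1 / 2 : ℝ) := by rw [← Real.rpow_add_one ht.ne']; norm_num
  nlinarith

lemma sq_t (hL : LipschitzWith L h) (hs : ∀ s ∉ closedBall c R, h s = 0) {t ρ R' : ℝ}
    (ht : 0 < t) (ht1 : t < 1) (hρ : 0 < ρ) (hR : ρ < R') :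
    ∫⁻ r in Ioc ρ R', ∫⁻ s, ofReal
      (‖sl h w s (t * r) - sl h w (s + (t * r) • w) (r - t * r)‖ ^ 2 / r) ≤
    ofReal (4 * (L * ‖w‖) ^ 2 * volume.real (closedBall c R) *
      (t ^ (-(1 / 2) : ℝ) + (1 - t) ^ (-(1 / 2) : ℝ))) := by
  have ht' : 0 < 1 - t := by linarith
  set M := 2 * (L * ‖w‖) ^ 2 * volume.real (closedBall c R) with hM
  have hM0 : 0 ≤ M := by positivity
  have f1 := frul (slE_meas (w := w) hL) slE_nonneg (fun u => slE_le (w := w) hL hs u) ht ht1 hρ hR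
  have f2 := frul (slE_meas (w := w) hL) slE_nonneg (fun u => slE_le (w := w) hL hs u)
    ht' (by linarith) hρ hR
  have step : ∀ r ∈ Ioc ρ R', ∫⁻ s, ofReal
      (‖sl h w s (t * r) - sl h w (s + (t * r) • w) (r - t * r)‖ ^ 2 / r) =
      ofReal ((1 - t)⁻¹ * (slE h w (t * r) / r - slE h w r / r) +
        t⁻¹ * (slE h w ((1 - t) * r) / r - slE h w r / r)) := by
    intro r hr
    have hr0 : 0 < r := hρ.trans hr.1
    rw [← ofReal_integral_eq_lintegral_ofReal, integral_div, sl_ident hL hs ht ht1 hr0]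
    · congr 1; field_simp; ring
    · refine Integrable.div_const ?_ r
      have hc := hL.continuous
      refine Continuous.integrable_of_hasCompactSupport (by unfold sl; fun_prop) ?_
      have c1 := sl_cs (w := w) hs (t * r)
      have c2 := (sl_cs (w := w) hs (r - t * r)).comp_homeomorph (Homeomorph.addRight ((t * r) • w))
      exact (c1.sub c2).comp_left (g := fun x => ‖x‖ ^ 2) (by simp)
    · exact ae_of_all _ fun s => by positivity
  rw [setLIntegral_congr_fun measurableSet_Ioc step]
  have nn : ∀ r ∈ Ioc ρ R', 0 ≤ (1 - t)⁻¹ * (slE h w (t * r) / r - slE h w r / r) +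
        t⁻¹ * (slE h w ((1 - t) * r) / r - slE h w r / r) := by
    intro r hr
    have hr0 : 0 < r := hρ.trans hr.1
    have h1 := sl_ident (w := w) hL hs ht ht1 hr0
    have h2 : 0 ≤ ∫ s, ‖sl h w s (t * r) - sl h w (s + (t * r) • w) (r - t * r)‖ ^ 2 :=
      integral_nonneg fun _ => by positivity
    rw [h1] at h2
    have : (1 - t)⁻¹ * (slE h w (t * r) / r - slE h w r / r) +
        t⁻¹ * (slE h w ((1 - t) * r) / r - slE h w r / r) = (t * slE h w (t * r) + (1 - t) * slE h w ((1 - t) * r) - slE h w r) / (t * (1 - t)) / r := by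
      field_simp; ring
    rw [this]; positivity
  have I1 := (f1.1.sub f1.2.1).const_mul (1 - t)⁻¹
  have I2 := (f2.1.sub f2.2.1).const_mul t⁻¹
  have I3 := I1.add I2
  rw [intervalIntegrable_iff_integrableOn_Ioc_of_le hR.le] at I3
  rw [← ofReal_integral_eq_lintegral_ofReal I3
    ((ae_restrict_iff' measurableSet_Ioc).2 (ae_of_all _ nn))]
  apply ofReal_le_ofReal
  rw [← intervalIntegral.integral_of_le hR.le, intervalIntegral.integral_add I1 I2,
    intervalIntegral.integral_const_mul, intervalIntegral.integral_const_mul,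
    intervalIntegral.integral_sub f1.1 f1.2.1, intervalIntegral.integral_sub f2.1 f2.2.1]
  have l1 := log_bd ht ht1
  have l2 := log_bd ht' (by linarith)
  rw [sub_sub_cancel] at l2
  have a1 := mul_le_mul_of_nonneg_left f1.2.2 (inv_nonneg.2 ht'.le)
  have a2 := mul_le_mul_of_nonneg_left f2.2.2 (inv_nonneg.2 ht.le)
  have b1 := mul_le_mul_of_nonneg_left l1 hM0
  have b2 := mul_le_mul_of_nonneg_left l2 hM0
  have c1 : (1 - t)⁻¹ * (M * -Real.log t) = M * (-Real.log t / (1 - t)) := by rw [div_eq_mul_inv]; ring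
  have c2 : t⁻¹ * (M * -Real.log (1 - t)) = M * (-Real.log (1 - t) / t) := by rw [div_eq_mul_inv]; ring
  calc _ ≤ M * (2 * t ^ (-(1 / 2) : ℝ)) + M * (2 * (1 - t) ^ (-(1 / 2) : ℝ)) := by linarith
    _ = _ := by rw [hM]; ring

lemma lint_half : ∫⁻ t in Ioo (0 : ℝ) 1, ofReal (t ^ (-(1 / 2) : ℝ) + (1 - t) ^ (-(1 / 2) : ℝ)) ≤
    ofReal 4 := by
  have i1 : IntervalIntegrable (fun t : ℝ => t ^ (-(1 / 2) : ℝ)) volume 0 1 :=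
    intervalIntegral.intervalIntegrable_rpow' (by norm_num)
  have i2 : IntervalIntegrable (fun t : ℝ => (1 - t) ^ (-(1 / 2) : ℝ)) volume 0 1 := by
    simpa using (i1.comp_sub_left 1).symm
  have i3 := i1.add i2
  have i4 := (intervalIntegrable_iff_integrableOn_Ioo_of_le zero_le_one).1 i3
  rw [← ofReal_integral_eq_lintegral_ofReal i4
    ((ae_restrict_iff' measurableSet_Ioo).2 (ae_of_all _ fun t ht => ?_))]
  · apply ofReal_le_ofReal
    rw [← integral_Ioc_eq_integral_Ioo, ← intervalIntegral.integral_of_le zero_le_one,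
      intervalIntegral.integral_add i1 i2,
      intervalIntegral.integral_comp_sub_left (fun t : ℝ => t ^ (-(1 / 2) : ℝ)) 1]
    norm_num [integral_rpow]
  · have h1 : 0 < t := ht.1
    have h2 : 0 < 1 - t := by linarith [ht.2]
    simp only [Pi.zero_apply]; positivity

lemma lint_scale (f : ℝ → ℝ≥0∞) (r : ℝ) (hr : 0 < r) :
    ∫⁻ x in Ioo 0 r, f x = ofReal r * ∫⁻ t in Ioo (0 : ℝ) 1, f (t * r) := by
  have := lintegral_image_eq_lintegral_abs_deriv_mul (s := Ioo (0 : ℝ) 1) (f := fun t => t * r)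
    (f' := fun _ => r) measurableSet_Ioo (fun x _ => (hasDerivAt_mul_const r).hasDerivWithinAt)
    (fun x _ y _ hxy => mul_right_cancel₀ hr.ne' hxy) f
  rw [image_mul_right_Ioo _ _ hr, zero_mul, one_mul] at this
  rw [this, abs_of_pos hr, lintegral_const_mul' _ _ ofReal_ne_top]

lemma sqfun (hL : LipschitzWith L h) (hs : ∀ s ∉ closedBall c R, h s = 0) {ρ R' : ℝ}
    (hρ : 0 < ρ) (hR : ρ < R') :
    ∫⁻ r in Ioc ρ R', ∫⁻ r1 in Ioo 0 r, ∫⁻ s, ofReal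
      (‖sl h w s r1 - sl h w (s + r1 • w) (r - r1)‖ ^ 2 / r ^ 2) ≤
    ofReal (16 * (L * ‖w‖) ^ 2 * volume.real (closedBall c R)) := by
  have h1 : ∀ r ∈ Ioc ρ R', ∫⁻ r1 in Ioo 0 r, ∫⁻ s, ofReal
      (‖sl h w s r1 - sl h w (s + r1 • w) (r - r1)‖ ^ 2 / r ^ 2) =
      ∫⁻ t in Ioo (0 : ℝ) 1, ∫⁻ s, ofReal
      (‖sl h w s (t * r) - sl h w (s + (t * r) • w) (r - t * r)‖ ^ 2 / r) := by
    intro r hr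
    have hr0 : 0 < r := hρ.trans hr.1
    rw [lint_scale _ r hr0, ← lintegral_const_mul' _ _ ofReal_ne_top]
    congr 1; ext t
    rw [← lintegral_const_mul' _ _ ofReal_ne_top]
    congr 1; ext s
    rw [← ofReal_mul hr0.le]; congr 1; field_simp
  have hc := hL.continuous
  have hmeas : Measurable (fun a : ℝ × ℝ => ∫⁻ s, ofReal
      (‖sl h w s (a.2 * a.1) - sl h w (s + (a.2 * a.1) • w) (a.1 - a.2 * a.1)‖ ^ 2 / a.1)) := by
    refine Measurable.lintegral_prod_right' (f := fun b : (ℝ × ℝ) × EV n => ofReal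
      (‖sl h w b.2 (b.1.2 * b.1.1) - sl h w (b.2 + (b.1.2 * b.1.1) • w) (b.1.1 - b.1.2 * b.1.1)‖ ^ 2 / b.1.1)) ?_
    have hm := hc.measurable
    unfold sl
    fun_prop
  rw [setLIntegral_congr_fun measurableSet_Ioc h1, lintegral_lintegral_swap hmeas.aemeasurable]
  have h2 : ∀ t ∈ Ioo (0 : ℝ) 1, (∫⁻ r in Ioc ρ R', ∫⁻ s, ofReal
      (‖sl h w s (t * r) - sl h w (s + (t * r) • w) (r - t * r)‖ ^ 2 / r)) ≤
      ofReal (4 * (L * ‖w‖) ^ 2 * volume.real (closedBall c R)) *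
       ofReal (t ^ (-(1 / 2) : ℝ) + (1 - t) ^ (-(1 / 2) : ℝ)) := by
    intro t ht
    rw [← ofReal_mul (by positivity)]
    exact sq_t hL hs ht.1 ht.2 hρ hR
  refine (setLIntegral_mono' measurableSet_Ioo h2).trans ?_
  rw [lintegral_const_mul' _ _ ofReal_ne_top]
  refine (mul_le_mul_right lint_half _).trans ?_
  rw [← ofReal_mul (by positivity)]
  exact ofReal_le_ofReal (le_of_eq (by ring))

end sq


structure NearIso {n : ℕ} (γ : EV n → EW n) (ι : EV n →ₗᵢ[ℝ] EW n) (η : ℝ) : Prop where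
  le : η ≤ 1 / 16
  near : ∀ s t, ‖γ s - γ t - ι (s - t)‖ ≤ η * ‖s - t‖

section testing
variable {n : ℕ} {γ : EV n → EW n} {ι : EV n →ₗᵢ[ℝ] EW n} {η : ℝ}
  {K : EW n → ℝ} {C : ℝ} {w c : EV n} {R δ : ℝ}

lemma NearIso.near' (h : NearIso γ ι η) (s t : EV n) : ‖γ s - γ t - ι (s - t)‖ ≤ ‖s - t‖ / 16 :=
  (h.near s t).trans (by nlinarith [h.le, norm_nonneg (s - t)])

lemma NearIso.up (h : NearIso γ ι η) (s t : EV n) : ‖γ s - γ t‖ ≤ 2 * ‖s - t‖ := by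
  have h1 := h.near' s t
  have h2 := norm_sub_norm_le (γ s - γ t) (ι (s - t))
  rw [ι.norm_map] at h2
  linarith [norm_nonneg (s - t)]

lemma NearIso.low (h : NearIso γ ι η) (s t : EV n) : ‖s - t‖ ≤ 2 * ‖γ s - γ t‖ := by
  have h1 := h.near' s t
  have h2 := norm_sub_norm_le (ι (s - t)) (γ s - γ t)
  rw [ι.norm_map, norm_sub_rev (ι (s - t))] at h2
  linarith [norm_nonneg (s - t)]

lemma NearIso.lip (h : NearIso γ ι η) : LipschitzWith 2 γ :=
  LipschitzWith.of_dist_le_mul fun s t => by simpa [dist_eq_norm] using h.up s t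

lemma NearIso.cont (h : NearIso γ ι η) : Continuous γ := h.lip.continuous

lemma sl_neg (h : EV n → EW n) (w s : EV n) (r : ℝ) : sl h w (s + r • w) (-r) = sl h w s r := by
  unfold sl
  rw [neg_smul, add_neg_cancel_right, inv_neg, neg_smul, ← smul_neg, neg_sub]

lemma NearIso.sl_near (h : NearIso γ ι η) (hw2 : ‖w‖ ≤ 2) (s : EV n) {r : ℝ} (hr : r ≠ 0) :
    ‖sl γ w s r - ι w‖ ≤ 1 / 8 := by
  have h1 := h.near' (s + r • w) s
  have : sl γ w s r - ι w = r⁻¹ • (γ (s + r • w) - γ s - ι (s + r • w - s)) := by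
    rw [add_sub_cancel_left, map_smul, smul_sub, smul_smul, inv_mul_cancel₀ hr, one_smul, sl]
  rw [this, norm_smul, norm_inv, inv_mul_le_iff₀ (norm_pos_iff.2 hr)]
  rw [add_sub_cancel_left] at h1 ⊢
  rw [norm_smul r w] at h1
  nlinarith [norm_nonneg r]

lemma CZK.sl_bd (hK : CZK n K C) (h : NearIso γ ι η) (hw1 : 1 ≤ ‖w‖) (hw2 : ‖w‖ ≤ 2) (s : EV n) {r : ℝ}
    (hr : r ≠ 0) : |K (sl γ w s r)| ≤ C * 2 ^ n := by
  have h1 := h.sl_near hw2 s hr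
  have h2 := norm_sub_norm_le (ι w) (sl γ w s r)
  rw [ι.norm_map, norm_sub_rev] at h2
  have h3 : 1 / 2 ≤ ‖sl γ w s r‖ := by linarith
  refine (hK.bd _).trans ?_
  rw [div_le_iff₀ (by positivity), mul_assoc, ← mul_pow]
  have : (1 : ℝ) ≤ (2 * ‖sl γ w s r‖) ^ n := one_le_pow₀ (by linarith)
  nlinarith [hK.one_le]

lemma p_alg (F1 F2 F0 e u v : ℝ) (hu : 0 < u) (hv : 0 < v)
    (he : F0 = (u / (u + v)) * F1 + (v / (u + v)) * F2 + e) :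
    F1 / u * (F0 / (u + v)) - F1 / u * (F2 / v) + F0 / (u + v) * (F2 / v) =
      (F1 - F2) ^ 2 / (u + v) ^ 2 + e * (v * F1 + u * F2) / (u * v * (u + v)) := by
  subst he; field_simp; ring

lemma p_bd (hK : CZK n K C) (h : NearIso γ ι η) (hw1 : 1 ≤ ‖w‖) (hw2 : ‖w‖ ≤ 2) (s : EV n) {u v : ℝ}
    (hu : 0 < u) (hv : 0 < v) :
    |K (sl γ w s u) / u * (K (sl γ w s (u + v)) / (u + v))
      - K (sl γ w s u) / u * (K (sl γ w (s + u • w) v) / v)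
      + K (sl γ w s (u + v)) / (u + v) * (K (sl γ w (s + u • w) v) / v)| ≤
    2 * C ^ 2 * 4 ^ (n + 1) * (‖sl γ w s u - sl γ w (s + u • w) v‖ ^ 2 / (u + v) ^ 2) := by
  set q1 := sl γ w s u with hq1
  set q2 := sl γ w (s + u • w) v with hq2
  have huv : 0 < u + v := by linarith
  have n1 := h.sl_near hw2 s hu.ne'
  have n2 := h.sl_near hw2 (s + u • w) hv.ne'
  rw [← hq1] at n1; rw [← hq2] at n2
  have q0 : sl γ w s (u + v) = (1 - v / (u + v)) • q1 + (v / (u + v)) • q2 := by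
    rw [hq1, hq2]; unfold sl
    rw [smul_smul, smul_smul, add_assoc s, ← add_smul]
    have e1 : (1 - v / (u + v)) * u⁻¹ = (u + v)⁻¹ := by field_simp; ring
    have e2 : v / (u + v) * v⁻¹ = (u + v)⁻¹ := by field_simp
    rw [e1, e2, ← smul_add]; congr 1; abel
  have C1 := hK.one_le
  have ew : 1 ≤ ‖ι w‖ := by rwa [ι.norm_map]
  have hI := hK.interp (ι w) q1 q2 (v / (u + v)) ew (by linarith) (by linarith) (by positivity)
    (by rw [div_le_one huv]; linarith)
  rw [← q0] at hI
  set X := ‖q1 - q2‖ ^ 2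
  have hX : 0 ≤ X := by positivity
  have b1 := hK.sl_bd h hw1 hw2 s hu.ne'
  have b2 := hK.sl_bd h hw1 hw2 (s + u • w) hv.ne'
  rw [← hq1] at b1; rw [← hq2] at b2
  have h12 : (K q1 - K q2) ^ 2 ≤ C ^ 2 * 4 ^ (n + 1) * X := by
    have h2 := norm_sub_norm_le (ι w) q1
    rw [norm_sub_rev] at h2
    have h3 : 1 / 2 ≤ ‖q1‖ := by linarith
    have h4 : ‖q1 - q2‖ ≤ ‖q1‖ / 2 := by
      have := norm_sub_le (q1 - ι w) (q2 - ι w)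
      rw [sub_sub_sub_cancel_right] at this
      linarith
    have h5 := hK.lip q1 q2 h4
    have h6 : C * ‖q1 - q2‖ / ‖q1‖ ^ (n + 1) ≤ C * 2 ^ (n + 1) * ‖q1 - q2‖ := by
      rw [div_le_iff₀ (by positivity)]
      have : (1 : ℝ) ≤ (2 * ‖q1‖) ^ (n + 1) := one_le_pow₀ (by linarith)
      rw [mul_pow] at this
      have h0 : 0 ≤ C * ‖q1 - q2‖ := by positivity
      nlinarith
    have h7 := pow_le_pow_left₀ (abs_nonneg _) (h5.trans h6) 2
    rw [sq_abs] at h7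
    refine h7.trans (le_of_eq ?_)
    rw [mul_pow, mul_pow, ← pow_mul, mul_comm (n + 1) 2, pow_mul]; norm_num [X]
  set e := K (sl γ w s (u + v)) - ((1 - v / (u + v)) * K q1 + v / (u + v) * K q2) with he
  rw [p_alg (K q1) (K q2) (K (sl γ w s (u + v))) e u v hu hv (by
    rw [he]; have : 1 - v / (u + v) = u / (u + v) := by field_simp; ring
    rw [this]; ring)]
  have hE : |e * (v * K q1 + u * K q2) / (u * v * (u + v))| ≤ C ^ 2 * 4 ^ (n + 1) * X / (u + v) ^ 2 := by
    rw [abs_div, abs_mul, abs_of_pos (show 0 < u * v * (u + v) by positivity),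
      div_le_div_iff₀ (by positivity) (by positivity)]
    have h8 : |v * K q1 + u * K q2| ≤ (u + v) * (C * 2 ^ n) := by
      refine (abs_add_le _ _).trans ?_
      rw [abs_mul, abs_mul, abs_of_pos hu, abs_of_pos hv]
      nlinarith
    have h9 : |e| * (u + v) ^ 2 ≤ C * X * (u * v) := by
      refine (mul_le_mul_of_nonneg_right hI (by positivity)).trans (le_of_eq ?_)
      field_simp; ring
    have h10 : (2 : ℝ) ^ n ≤ 4 ^ (n + 1) := by
      rw [pow_succ]
      have : (2 : ℝ) ^ n ≤ 4 ^ n := by gcongr; norm_num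
      have : (0 : ℝ) < 4 ^ n := by positivity
      linarith
    calc |e| * |v * K q1 + u * K q2| * (u + v) ^ 2 = (|e| * (u + v) ^ 2) * |v * K q1 + u * K q2| := by ring
      _ ≤ (C * X * (u * v)) * ((u + v) * (C * 2 ^ n)) := by gcongr
      _ = C ^ 2 * 2 ^ n * X * (u * v * (u + v)) := by ring
      _ ≤ _ := by gcongr
  calc _ ≤ |(K q1 - K q2) ^ 2 / (u + v) ^ 2| + _ := abs_add_le _ _
    _ ≤ C ^ 2 * 4 ^ (n + 1) * X / (u + v) ^ 2 + C ^ 2 * 4 ^ (n + 1) * X / (u + v) ^ 2 := by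
      refine add_le_add ?_ hE
      rw [abs_of_nonneg (by positivity)]; gcongr
    _ = _ := by ring

def kd (K : EW n → ℝ) (γ : EV n → EW n) (w : EV n) (δ : ℝ) (s : EV n) (r : ℝ) : ℝ :=
  if δ < |r| then K (sl γ w s r) / r else 0

lemma kd_neg (s : EV n) (r : ℝ) : kd K γ w δ (s + r • w) (-r) = -kd K γ w δ s r := by
  unfold kd; rw [sl_neg, abs_neg]; split_ifs <;> simp [div_neg]

lemma kd_bd (hK : CZK n K C) (h : NearIso γ ι η) (hw1 : 1 ≤ ‖w‖) (hw2 : ‖w‖ ≤ 2) (hδ : 0 < δ) (s : EV n)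
    (r : ℝ) : |kd K γ w δ s r| ≤ C * 2 ^ n * (if δ < |r| then |r|⁻¹ else 0) := by
  unfold kd
  split_ifs with hr
  · have hr0 : r ≠ 0 := by rintro rfl; simp at hr; linarith
    rw [abs_div, div_eq_mul_inv]
    gcongr; exact hK.sl_bd h hw1 hw2 s hr0
  · simp

lemma sl_meas (hc : Measurable γ) : Measurable fun a : EV n × EV n × ℝ => sl γ a.1 a.2.1 a.2.2 := by
  unfold sl; fun_prop

lemma kd_meas (hK : CZK n K C) (hc : Measurable γ) :
    Measurable fun a : EV n × EV n × ℝ => kd K γ a.1 δ a.2.1 a.2.2 := by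
  unfold kd
  refine Measurable.ite ?_ ((hK.meas.comp (sl_meas hc)).div (by fun_prop)) measurable_const
  exact measurableSet_lt measurable_const (by fun_prop)

end testing


section testing2
variable {n : ℕ} {γ : EV n → EW n} {ι : EV n →ₗᵢ[ℝ] EW n} {η : ℝ}
  {K : EW n → ℝ} {C : ℝ} {w c : EV n} {R δ : ℝ}

lemma NearIso.cut (h : NearIso γ ι η) (c : EV n) (hR : 0 ≤ R) : ∃ g : EV n → EW n,
    LipschitzWith (lipschitzExtensionConstant (EW n) * 2) g ∧
    (∀ s ∈ closedBall c R, g s = γ s - γ c) ∧ ∀ s ∉ closedBall c (2 * R), g s = 0 := by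
  classical
  set f0 : EV n → EW n := fun s => if s ∈ closedBall c R then γ s - γ c else 0 with hf0
  have key : ∀ s ∈ closedBall c R, ∀ t ∉ closedBall c (2 * R), ‖γ s - γ c‖ ≤ 2 * ‖s - t‖ := by
    intro s hs t ht
    rw [mem_closedBall, dist_eq_norm] at hs ht
    have := h.up s c
    have h2 := norm_sub_norm_le (t - c) (s - c)
    rw [sub_sub_sub_cancel_right, norm_sub_rev t s] at h2
    linarith
  have sub : ∀ t ∉ closedBall c (2 * R), t ∉ closedBall c R := fun t ht ht' =>
    ht (closedBall_subset_closedBall (by linarith) ht')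
  have hl : LipschitzOnWith 2 f0 (closedBall c R ∪ (closedBall c (2 * R))ᶜ) := by
    refine LipschitzOnWith.of_dist_le_mul fun s hs t ht => ?_
    simp only [dist_eq_norm, NNReal.coe_ofNat]
    rcases hs with hs | hs <;> rcases ht with ht | ht
    · rw [hf0]; simp only [hs, ht, if_true, sub_sub_sub_cancel_right]; exact h.up s t
    · rw [hf0]; simp only [hs, sub t ht, if_true, if_false, sub_zero]; exact key s hs t ht
    · rw [hf0]; simp only [ht, sub s hs, if_true, if_false, zero_sub, norm_neg]
      rw [norm_sub_rev s]; exact key t ht s hs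
    · rw [hf0]; simp only [sub t ht, sub s hs, if_false, sub_zero, norm_zero]; positivity
  obtain ⟨g, hg, he⟩ := hl.extend_finite_dimension
  refine ⟨g, hg, fun s hs => ?_, fun s hs => ?_⟩
  · rw [← he (Or.inl hs), hf0]; simp only [hs, if_true]
  · rw [← he (Or.inr hs), hf0]; simp only [sub s hs, if_false]

def GG (K : EW n → ℝ) (γ : EV n → EW n) (w : EV n) (δ : ℝ) (m : EV n → ℝ)
    (r : ℝ × ℝ) (s : EV n) : ℝ :=
  m s * m (s + r.1 • w) * m (s + r.2 • w) * (kd K γ w δ s r.1 * kd K γ w δ s r.2)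

lemma int_split {J : ℝ × ℝ → ℝ} (hJ : Integrable J) (hδ : 0 < δ) (hsw : ∀ r, J r.swap = J r)
    (h0 : ∀ r : ℝ × ℝ, (|r.1| ≤ δ ∨ |r.2| ≤ δ) → J r = 0) :
    ∫ r, J r = (∫ r in {r : ℝ × ℝ | |r.1 - r.2| ≤ δ}, J r) +
      2 * ∫ r in {r : ℝ × ℝ | δ < r.1 ∧ δ < r.2 - r.1},
        (J r + J (-r.1, r.2 - r.1) + J (-r.2, r.1 - r.2)) := by
  set N := {r : ℝ × ℝ | |r.1 - r.2| ≤ δ}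
  set O := {r : ℝ × ℝ | δ < r.1 ∧ δ < r.2 - r.1}
  set S := {r : ℝ × ℝ | δ < r.2 - r.1}
  set S2 := {r : ℝ × ℝ | r.1 < -δ ∧ δ < r.2}
  set S3 := {r : ℝ × ℝ | r.2 < -δ ∧ δ < r.2 - r.1}
  have mN : MeasurableSet N := measurableSet_le (by fun_prop) measurable_const
  have mS : MeasurableSet S := measurableSet_lt measurable_const (by fun_prop)
  have mO : MeasurableSet O := by measurability
  have mS2 : MeasurableSet S2 := by measurability
  have mS3 : MeasurableSet S3 := by measurability
  have psw : MeasurePreserving (Prod.swap : ℝ × ℝ → ℝ × ℝ) volume volume := Measure.measurePreserving_swap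
  have pr2 : MeasurePreserving (fun r : ℝ × ℝ => (-r.1, r.2 - r.1)) volume volume := by
    have := ((Measure.measurePreserving_neg (volume : Measure ℝ)).prod
      (MeasurePreserving.id (volume : Measure ℝ))).comp (measurePreserving_prod_neg_add volume volume)
    have e : (fun r : ℝ × ℝ => (-r.1, r.2 - r.1)) =
        Prod.map (fun x : ℝ => -x) id ∘ fun z : ℝ × ℝ => (z.1, -z.1 + z.2) := by
      funext r; simp [Function.comp, Prod.map]; ring
    rw [e]; exact this
  have pr3 : MeasurePreserving (fun r : ℝ × ℝ => (-r.2, r.1 - r.2)) volume volume := pr2.comp psw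
  have tr : ∀ (ρ : ℝ × ℝ → ℝ × ℝ) (hρ : MeasurePreserving ρ volume volume) (A : Set (ℝ × ℝ)),
      MeasurableSet A → ∫ r in A, J r = ∫ r in ρ ⁻¹' A, J (ρ r) := by
    intro ρ hρ A hA
    have := setIntegral_map (μ := volume) (g := ρ) (f := J) hA (by rw [hρ.map_eq]; exact hJ.1)
      hρ.measurable.aemeasurable
    rwa [hρ.map_eq] at this
  have e2 : ∫ r in S2, J r = ∫ r in O, J (-r.1, r.2 - r.1) := by
    rw [tr _ pr2 S2 mS2]; congr 2; ext r; simp [S2, O]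
  have e3 : ∫ r in S3, J r = ∫ r in O, J (-r.2, r.1 - r.2) := by
    rw [tr _ pr3 S3 mS3]; congr 2; ext r
    simp only [S3, O, mem_preimage, mem_ofPred_eq]
    constructor <;> rintro ⟨h1, h2⟩ <;> constructor <;> linarith
  have i2 : IntegrableOn (fun r : ℝ × ℝ => J (-r.1, r.2 - r.1)) O := (pr2.integrable_comp_of_integrable hJ).integrableOn
  have i3 : IntegrableOn (fun r : ℝ × ℝ => J (-r.2, r.1 - r.2)) O := (pr3.integrable_comp_of_integrable hJ).integrableOn
  have eS : ∫ r in S, J r = ∫ r in O, (J r + J (-r.1, r.2 - r.1) + J (-r.2, r.1 - r.2)) := by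
    rw [integral_add (f := fun r : ℝ × ℝ => J r + J (-r.1, r.2 - r.1)) (hJ.integrableOn.add i2) i3,
      integral_add hJ.integrableOn i2, ← e2, ← e3,
      ← setIntegral_union _ mS2 hJ.integrableOn hJ.integrableOn,
      ← setIntegral_union _ mS3 hJ.integrableOn hJ.integrableOn]
    · refine setIntegral_eq_of_subset_of_forall_sdiff_eq_zero mS ?_ ?_
      · rintro r ((⟨h1, h2⟩ | ⟨h1, h2⟩) | ⟨h1, h2⟩) <;> simp only [S, mem_ofPred_eq] <;> linarith
      · rintro r ⟨h1, h2⟩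
        apply h0
        by_contra! h3
        apply h2
        simp only [S, mem_ofPred_eq, lt_abs] at *
        rcases h3 with ⟨h3 | h3, h4 | h4⟩
        · exact Or.inl (Or.inl ⟨h3, h1⟩)
        · linarith
        · exact Or.inl (Or.inr ⟨by linarith, h4⟩)
        · exact Or.inr ⟨by linarith, h1⟩
    · rw [Set.disjoint_left]
      rintro r (⟨h1, h2⟩ | ⟨h1, h2⟩) ⟨h3, h4⟩ <;> linarith
    · rw [Set.disjoint_left]
      rintro r ⟨h1, h2⟩ ⟨h3, h4⟩; linarith
  have eS' : ∫ r in (Prod.swap ⁻¹' S), J r = ∫ r in S, J r := by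
    rw [tr _ psw S mS]; simp only [hsw]
  have mS' : MeasurableSet (Prod.swap ⁻¹' S) := mS.preimage psw.measurable
  rw [← eS, two_mul]
  nth_rewrite 2 [← eS']
  rw [← setIntegral_union _ mS' hJ.integrableOn hJ.integrableOn,
    ← setIntegral_union _ (mS.union mS') hJ.integrableOn hJ.integrableOn]
  · have : N ∪ (S ∪ Prod.swap ⁻¹' S) = univ := by
      ext r
      simp only [N, S, mem_union, mem_ofPred_eq, mem_preimage, Prod.fst_swap, Prod.snd_swap, mem_univ, iff_true]
      rw [abs_le]
      by_contra! h; have h1 := h.1; have := h1 (by linarith); linarith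
    rw [this, setIntegral_univ]
  · rw [Set.disjoint_left]
    rintro r h1 h2
    simp only [N, S, mem_union, mem_ofPred_eq, mem_preimage, Prod.fst_swap, Prod.snd_swap, abs_le] at h1 h2
    rcases h2 with h2 | h2 <;> linarith
  · rw [Set.disjoint_left]
    rintro r h1 h2
    simp only [S, mem_ofPred_eq, mem_preimage, Prod.fst_swap, Prod.snd_swap] at h1 h2
    linarith

lemma lint_near (hδ : 0 < δ) : ∫⁻ r : ℝ × ℝ, {r : ℝ × ℝ | |r.1 - r.2| ≤ δ}.indicator (fun r =>
    ofReal ((if δ < |r.1| then |r.1|⁻¹ else 0) * (if δ < |r.2| then |r.2|⁻¹ else 0))) r ≤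
    ofReal 8 := by
  have hb : ∀ r : ℝ × ℝ, {r : ℝ × ℝ | |r.1 - r.2| ≤ δ}.indicator (fun r =>
    ofReal ((if δ < |r.1| then |r.1|⁻¹ else 0) * (if δ < |r.2| then |r.2|⁻¹ else 0))) r ≤
    (Icc (r.1 - δ) (r.1 + δ)).indicator (fun _ => ofReal ((if δ < |r.1| then 2 * (r.1 ^ 2)⁻¹ else 0))) r.2 := by
    intro r
    by_cases h1 : |r.1 - r.2| ≤ δ
    · have h2 := abs_le.1 h1
      rw [indicator_of_mem (show r ∈ {r : ℝ × ℝ | |r.1 - r.2| ≤ δ} from h1),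
        indicator_of_mem (mem_Icc.2 ⟨by linarith, by linarith⟩ : r.2 ∈ Icc (r.1 - δ) (r.1 + δ))]
      apply ofReal_le_ofReal
      split_ifs with h3 h4
      · have h5 : |r.1| ≤ 2 * |r.2| := by
          have := abs_sub_abs_le_abs_sub r.1 r.2; linarith
        have h6 : 0 < |r.1| := by linarith
        have h7 : 0 < |r.2| := by linarith
        rw [← sq_abs r.1, sq, mul_inv, mul_comm (2 : ℝ), mul_assoc]
        gcongr
        rw [inv_le_iff_one_le_mul₀ h7]
        field_simp; linarith
      · simp; positivity
      · simp
      · simp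
    · rw [indicator_of_notMem (show r ∉ {r : ℝ × ℝ | |r.1 - r.2| ≤ δ} from h1)]; exact zero_le
  refine (lintegral_mono hb).trans ?_
  rw [Measure.volume_eq_prod, lintegral_prod]
  · have h1 : ∀ x : ℝ, ∫⁻ y, (Icc (x - δ) (x + δ)).indicator
        (fun _ => ofReal ((if δ < |x| then 2 * (x ^ 2)⁻¹ else 0))) y =
        {x : ℝ | δ < |x|}.indicator (fun x => ofReal (4 * δ * x ^ (-2 : ℝ))) |x| := by
      intro x
      rw [lintegral_indicator measurableSet_Icc, lintegral_const, Measure.restrict_apply_univ, Real.volume_Icc,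
        ← ofReal_mul (by split_ifs <;> positivity)]
      by_cases hx : δ < |x|
      · rw [indicator_of_mem (by simpa using hx), if_pos hx]
        congr 1
        rw [Real.rpow_neg (abs_nonneg x)]
        norm_num; ring
      · rw [indicator_of_notMem (by simpa using hx), if_neg hx]; simp
    simp only [h1]
    set f : ℝ → ℝ≥0∞ := {x : ℝ | δ < |x|}.indicator (fun x => ofReal (4 * δ * x ^ (-2 : ℝ)))
    have hI : ∫⁻ x in Ioi 0, f x ≤ ofReal 4 := by
      calc ∫⁻ x in Ioi 0, f x ≤ ∫⁻ x in Ioi δ, ofReal (4 * δ * x ^ (-2 : ℝ)) := by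
            rw [← lintegral_indicator measurableSet_Ioi, ← lintegral_indicator measurableSet_Ioi]
            refine lintegral_mono fun x => ?_
            by_cases hx : 0 < x
            · rw [indicator_of_mem (show x ∈ Ioi 0 from hx)]
              simp only [f]
              by_cases hx' : δ < x
              · rw [indicator_of_mem (show x ∈ Ioi δ from hx')]
                exact indicator_le_self _ _ _
              · rw [indicator_of_notMem (by simpa [abs_of_pos hx] using hx')]; exact zero_le
            · rw [indicator_of_notMem (show x ∉ Ioi 0 from hx)]; exact zero_le
        _ = ofReal (4 * δ * (-δ ^ (-2 + 1 : ℝ) / (-2 + 1))) := by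
            rw [← integral_Ioi_rpow_of_lt (by norm_num) hδ, ← integral_const_mul,
              ofReal_integral_eq_lintegral_ofReal]
            · exact (integrableOn_Ioi_rpow_of_lt (by norm_num) hδ).const_mul _
            · refine (ae_restrict_iff' measurableSet_Ioi).2 (ae_of_all _ fun x hx => ?_)
              have : 0 < x := hδ.trans hx
              simp only [Pi.zero_apply]; positivity
        _ = ofReal 4 := by
            congr 1
            norm_num [Real.rpow_neg_one]; field_simp
    have h2 : ∫⁻ x : ℝ, f |x| ≤ (∫⁻ x in Ioi 0, f x) + ∫⁻ x in Ioi 0, f x := by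
      have hu : (univ : Set ℝ) = (Iio 0 ∪ Ioi 0) ∪ {0} := by
        ext x; simp; exact em _
      rw [← setLIntegral_univ, hu]
      refine (lintegral_union_le _ _ _).trans ?_
      rw [Measure.restrict_singleton]
      simp only [Real.volume_singleton, zero_smul, lintegral_zero_measure, add_zero]
      refine (lintegral_union_le _ _ _).trans (add_le_add (le_of_eq ?_) (le_of_eq ?_))
      · have := (Measure.measurePreserving_neg (volume : Measure ℝ)).setLIntegral_comp_preimage_emb
          (Homeomorph.neg ℝ).measurableEmbedding f (Ioi 0)
        rw [← this]
        have e : (fun x : ℝ => -x) ⁻¹' Ioi 0 = Iio 0 := by ext x; simp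
        rw [show (Neg.neg : ℝ → ℝ) ⁻¹' Ioi 0 = Iio 0 from e]
        exact setLIntegral_congr_fun measurableSet_Iio fun x hx => by
          show f |x| = f (-x)
          rw [abs_of_neg hx]
      · exact setLIntegral_congr_fun measurableSet_Ioi fun x hx => by
          show f |x| = f x
          rw [abs_of_pos hx]
    refine h2.trans ((add_le_add hI hI).trans (le_of_eq ?_))
    rw [← ofReal_add] <;> norm_num
  · have e : (fun r : ℝ × ℝ => (Icc (r.1 - δ) (r.1 + δ)).indicator
        (fun _ => ofReal ((if δ < |r.1| then 2 * (r.1 ^ 2)⁻¹ else 0))) r.2) =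
        {r : ℝ × ℝ | |r.1 - r.2| ≤ δ}.indicator
          (fun r => ofReal ((if δ < |r.1| then 2 * (r.1 ^ 2)⁻¹ else 0))) := by
      funext r
      have : r.2 ∈ Icc (r.1 - δ) (r.1 + δ) ↔ r ∈ {r : ℝ × ℝ | |r.1 - r.2| ≤ δ} := by
        simp only [mem_Icc, mem_ofPred_eq, abs_le]
        constructor <;> rintro ⟨h1, h2⟩ <;> constructor <;> linarith
      simp only [indicator, this]
    rw [e]
    refine (Measurable.indicator ?_ (measurableSet_le (by fun_prop) measurable_const)).aemeasurable
    refine ENNReal.measurable_ofReal.comp (Measurable.ite ?_ (by fun_prop) measurable_const)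
    exact measurableSet_lt measurable_const (by fun_prop)

lemma abs_le_of_enorm_le {x y : ℝ} (hy : 0 ≤ y) (h : ‖x‖ₑ ≤ ofReal y) : |x| ≤ y := by
  rw [← ofReal_norm, ofReal_le_ofReal_iff hy] at h
  exact h

def qd (δ r : ℝ) : ℝ := if δ < |r| then |r|⁻¹ else 0

lemma qd_nonneg (δ r : ℝ) : 0 ≤ qd δ r := by unfold qd; split_ifs <;> positivity

lemma qd_le (hδ : 0 < δ) (r : ℝ) : qd δ r ≤ δ⁻¹ := by
  unfold qd; split_ifs with h
  · gcongr
  · positivity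

lemma mem_ball_r {s : EV n} {r : ℝ} (hw1 : 1 ≤ ‖w‖) (h1 : s ∈ closedBall c R)
    (h2 : s + r • w ∈ closedBall c R) : |r| ≤ 2 * R := by
  rw [mem_closedBall, dist_eq_norm] at *
  have : ‖r • w‖ ≤ 2 * R := by
    have := norm_sub_le (s + r • w - c) (s - c)
    rw [sub_sub_sub_cancel_right, add_sub_cancel_left] at this
    linarith
  rw [norm_smul, norm_eq_abs] at this
  nlinarith [abs_nonneg r]

lemma GG_meas (hK : CZK n K C) (hc : Measurable γ) {m : EV n → ℝ} (hm : Measurable m) :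
    Measurable fun p : (ℝ × ℝ) × EV n => GG K γ w δ m p.1 p.2 := by
  unfold GG
  have h1 : Measurable fun p : (ℝ × ℝ) × EV n => kd K γ w δ p.2 p.1.1 :=
    (kd_meas (δ := δ) hK hc).comp (by fun_prop : Measurable fun p : (ℝ × ℝ) × EV n => (w, p.2, p.1.1))
  have h2 : Measurable fun p : (ℝ × ℝ) × EV n => kd K γ w δ p.2 p.1.2 :=
    (kd_meas (δ := δ) hK hc).comp (by fun_prop : Measurable fun p : (ℝ × ℝ) × EV n => (w, p.2, p.1.2))
  fun_prop

lemma GG_bd (hK : CZK n K C) (h : NearIso γ ι η) (hw1 : 1 ≤ ‖w‖) (hw2 : ‖w‖ ≤ 2) (hδ : 0 < δ)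
    {m : EV n → ℝ} (h0 : ∀ s, 0 ≤ m s) (h2 : ∀ s, m s ≤ 2) (r : ℝ × ℝ) (s : EV n) :
    |GG K γ w δ m r s| ≤ 8 * (C * 2 ^ n) ^ 2 * (qd δ r.1 * qd δ r.2) := by
  unfold GG
  have hC := hK.one_le
  have a1 := kd_bd hK h hw1 hw2 hδ s r.1
  have a2 := kd_bd hK h hw1 hw2 hδ s r.2
  rw [abs_mul, abs_mul, abs_mul, abs_mul, abs_of_nonneg (h0 _), abs_of_nonneg (h0 _), abs_of_nonneg (h0 _)]
  have q1 := qd_nonneg δ r.1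
  have q2 := qd_nonneg δ r.2
  calc m s * m (s + r.1 • w) * m (s + r.2 • w) * (|kd K γ w δ s r.1| * |kd K γ w δ s r.2|)
      ≤ 2 * 2 * 2 * ((C * 2 ^ n * qd δ r.1) * (C * 2 ^ n * qd δ r.2)) := by
        gcongr
        all_goals first | exact h0 _ | exact h2 _ | exact mul_nonneg (h0 _) (h0 _) | exact a1 | exact a2
    _ = _ := by ring

lemma GG_supp (hw1 : 1 ≤ ‖w‖) {m : EV n → ℝ} (hs : ∀ s ∉ closedBall c R, m s = 0)
    {r : ℝ × ℝ} {s : EV n} (h : ¬(s ∈ closedBall c R ∧ |r.1| ≤ 2 * R ∧ |r.2| ≤ 2 * R)) :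
    GG K γ w δ m r s = 0 := by
  unfold GG
  by_cases h1 : s ∈ closedBall c R
  · by_cases h2 : s + r.1 • w ∈ closedBall c R
    · by_cases h3 : s + r.2 • w ∈ closedBall c R
      · exact absurd ⟨h1, mem_ball_r hw1 h1 h2, mem_ball_r hw1 h1 h3⟩ h
      · simp [hs _ h3]
    · simp [hs _ h2]
  · simp [hs _ h1]

lemma GG_int (hK : CZK n K C) (h : NearIso γ ι η) (hw1 : 1 ≤ ‖w‖) (hw2 : ‖w‖ ≤ 2) (hδ : 0 < δ)
    {m : EV n → ℝ} (hm : Measurable m) (h0 : ∀ s, 0 ≤ m s) (h2 : ∀ s, m s ≤ 2)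
    (hs : ∀ s ∉ closedBall c R, m s = 0) :
    Integrable (fun p : (ℝ × ℝ) × EV n => GG K γ w δ m p.1 p.2) (volume.prod volume) := by
  set S : Set ((ℝ × ℝ) × EV n) := ((Icc (-(2 * R)) (2 * R)) ×ˢ (Icc (-(2 * R)) (2 * R))) ×ˢ closedBall c R
  have hS : MeasurableSet S := (measurableSet_Icc.prod measurableSet_Icc).prod measurableSet_closedBall
  have hfin : (volume.prod volume) S ≠ ⊤ := by
    have : IsCompact S := (isCompact_Icc.prod isCompact_Icc).prod (isCompact_closedBall c R)
    exact this.measure_lt_top.ne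
  have hd := hδ.le
  have hC := hK.one_le
  refine Integrable.mono' (g := S.indicator fun _ => 8 * (C * 2 ^ n) ^ 2 * (δ⁻¹ * δ⁻¹))
    ((integrable_indicator_iff hS).2 (integrableOn_const hfin))
    (GG_meas hK h.cont.measurable hm).aestronglyMeasurable (ae_of_all _ fun p => ?_)
  by_cases hp : p ∈ S
  · rw [indicator_of_mem hp]
    refine (GG_bd hK h hw1 hw2 hδ h0 h2 _ _).trans ?_
    gcongr
    · exact qd_nonneg _ _
    · exact qd_le hδ _
    · exact qd_le hδ _
  · rw [indicator_of_notMem hp, GG_supp hw1 hs, norm_zero]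
    intro hh
    exact hp ⟨⟨abs_le.1 hh.2.1, abs_le.1 hh.2.2⟩, hh.1⟩

lemma GG_int' (hK : CZK n K C) (h : NearIso γ ι η) (hw1 : 1 ≤ ‖w‖) (hw2 : ‖w‖ ≤ 2) (hδ : 0 < δ)
    {m : EV n → ℝ} (hm : Measurable m) (h0 : ∀ s, 0 ≤ m s) (h2 : ∀ s, m s ≤ 2)
    (hs : ∀ s ∉ closedBall c R, m s = 0) (r : ℝ × ℝ) :
    Integrable (fun s => GG K γ w δ m r s) := by
  refine Integrable.mono' (g := (closedBall c R).indicator fun _ => 8 * (C * 2 ^ n) ^ 2 * (qd δ r.1 * qd δ r.2))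
    ((integrable_indicator_iff measurableSet_closedBall).2 (integrableOn_const measure_closedBall_lt_top.ne))
    ((GG_meas hK h.cont.measurable hm).comp (by fun_prop : Measurable fun s : EV n => (r, s))).aestronglyMeasurable (ae_of_all _ fun p => ?_)
  by_cases hp : p ∈ closedBall c R
  · rw [indicator_of_mem hp]
    exact GG_bd hK h hw1 hw2 hδ h0 h2 _ _
  · rw [indicator_of_notMem hp, GG_supp hw1 hs (fun hh => hp hh.1), norm_zero]

lemma GG_J (hK : CZK n K C) (h : NearIso γ ι η) (hw1 : 1 ≤ ‖w‖) (hw2 : ‖w‖ ≤ 2) (hδ : 0 < δ)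
    {m : EV n → ℝ} (h0 : ∀ s, 0 ≤ m s) (h2 : ∀ s, m s ≤ 2)
    (hs : ∀ s ∉ closedBall c R, m s = 0) (r : ℝ × ℝ) :
    |∫ s, GG K γ w δ m r s| ≤ 8 * (C * 2 ^ n) ^ 2 * (qd δ r.1 * qd δ r.2) * volume.real (closedBall c R) := by
  rw [← setIntegral_eq_integral_of_forall_compl_eq_zero (s := closedBall c R)
    (fun s hh => GG_supp hw1 hs (fun hh' => hh hh'.1))]
  rw [← norm_eq_abs]
  refine norm_setIntegral_le_of_norm_le_const measure_closedBall_lt_top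
    (fun s _ => ?_)
  exact GG_bd hK h hw1 hw2 hδ h0 h2 _ _

def PP (K : EW n → ℝ) (γ : EV n → EW n) (w : EV n) (m : EV n → ℝ)
    (u v : ℝ) (s : EV n) : ℝ :=
  m s * m (s + u • w) * m (s + (u + v) • w) * (K (sl γ w s u) / u * (K (sl γ w s (u + v)) / (u + v))
      - K (sl γ w s u) / u * (K (sl γ w (s + u • w) v) / v)
      + K (sl γ w s (u + v)) / (u + v) * (K (sl γ w (s + u • w) v) / v))

lemma GG_sum (hK : CZK n K C) (h : NearIso γ ι η) (hw1 : 1 ≤ ‖w‖) (hw2 : ‖w‖ ≤ 2) (hδ : 0 < δ)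
    {m : EV n → ℝ} (hm : Measurable m) (h0 : ∀ s, 0 ≤ m s) (h2 : ∀ s, m s ≤ 2)
    (hs : ∀ s ∉ closedBall c R, m s = 0) {u v : ℝ} (hu : δ < u) (hv : δ < v) :
    (∫ s, GG K γ w δ m (u, u + v) s) + (∫ s, GG K γ w δ m (-u, u + v - u) s) +
      ∫ s, GG K γ w δ m (-(u + v), u - (u + v)) s = ∫ s, PP K γ w m u v s := by
  have hi := GG_int' hK h hw1 hw2 hδ hm h0 h2 hs
  rw [← integral_add_right_eq_self (fun s => GG K γ w δ m (-u, u + v - u) s) (u • w),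
    ← integral_add_right_eq_self (fun s => GG K γ w δ m (-(u + v), u - (u + v)) s) ((u + v) • w),
    ← integral_add (hi _) ((hi _).comp_add_right _), 
    ← integral_add (f := fun a => GG K γ w δ m (u, u + v) a + GG K γ w δ m (-u, u + v - u) (a + u • w))
      ((hi _).add ((hi _).comp_add_right _)) ((hi _).comp_add_right _)]
  congr 1
  funext s
  have e1 : kd K γ w δ (s + u • w) (-u) = -kd K γ w δ s u := kd_neg s u
  have e2 : kd K γ w δ (s + (u + v) • w) (-(u + v)) = -kd K γ w δ s (u + v) := kd_neg s _
  have e3 : kd K γ w δ (s + (u + v) • w) (-v) = -kd K γ w δ (s + u • w) v := by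
    rw [add_smul, ← add_assoc]; exact kd_neg _ v
  have k1 : ∀ s, kd K γ w δ s u = K (sl γ w s u) / u := fun s => by
    unfold kd; rw [if_pos (by rwa [abs_of_pos (by linarith)])]
  have k2 : ∀ s, kd K γ w δ s v = K (sl γ w s v) / v := fun s => by
    unfold kd; rw [if_pos (by rwa [abs_of_pos (by linarith)])]
  have k3 : ∀ s, kd K γ w δ s (u + v) = K (sl γ w s (u + v)) / (u + v) := fun s => by
    unfold kd; rw [if_pos (by rw [abs_of_pos (by linarith)]; linarith)]
  have f1 : s + u • w + -u • w = s := by module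
  have f2 : s + u • w + v • w = s + (u + v) • w := by module
  have f3 : s + (u + v) • w + -(u + v) • w = s := by module
  have f4 : s + (u + v) • w + -v • w = s + u • w := by module
  have g1 : u + v - u = v := by ring
  have g2 : u - (u + v) = -v := by ring
  simp only [GG, PP, g1, g2, f1, f2, f3, f4, e1, e2, e3, k1, k2, k3]
  ring

end testing2

section testing2b
variable {n : ℕ} {γ : EV n → EW n} {ι : EV n →ₗᵢ[ℝ] EW n} {η : ℝ}
  {K : EW n → ℝ} {C : ℝ} {w c : EV n} {R δ : ℝ}

lemma PP_bd (hK : CZK n K C) (h : NearIso γ ι η) (hw1 : 1 ≤ ‖w‖) (hw2 : ‖w‖ ≤ 2)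
    {m : EV n → ℝ} (h0 : ∀ s, 0 ≤ m s) (h2 : ∀ s, m s ≤ 2)
    (hs : ∀ s ∉ closedBall c R, m s = 0) {g : EV n → EW n}
    (hg : ∀ s ∈ closedBall c R, g s = γ s - γ c) {u v : ℝ} (hu : 0 < u) (hv : 0 < v) (s : EV n) :
    |PP K γ w m u v s| ≤ if u + v ≤ 2 * R then
      16 * C ^ 2 * 4 ^ (n + 1) * (‖sl g w s u - sl g w (s + u • w) v‖ ^ 2 / (u + v) ^ 2) else 0 := by
  by_cases h1 : s ∈ closedBall c R ∧ s + u • w ∈ closedBall c R ∧ s + (u + v) • w ∈ closedBall c R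
  · have h5 := mem_ball_r hw1 h1.1 h1.2.2
    rw [abs_of_pos (by positivity)] at h5
    rw [if_pos h5]
    have e1 : sl g w s u = sl γ w s u := by
      unfold sl; rw [hg _ h1.1, hg _ h1.2.1, sub_sub_sub_cancel_right]
    have f2 : s + u • w + v • w = s + (u + v) • w := by module
    have e2 : sl g w (s + u • w) v = sl γ w (s + u • w) v := by
      unfold sl; rw [f2, hg _ h1.2.2, hg _ h1.2.1, sub_sub_sub_cancel_right]
    rw [e1, e2]
    have := p_bd hK h hw1 hw2 s hu hv
    unfold PP
    rw [abs_mul, abs_mul, abs_mul, abs_of_nonneg (h0 _), abs_of_nonneg (h0 _), abs_of_nonneg (h0 _)]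
    calc _ ≤ 2 * 2 * 2 * (2 * C ^ 2 * 4 ^ (n + 1) * (‖sl γ w s u - sl γ w (s + u • w) v‖ ^ 2 / (u + v) ^ 2)) := by
          gcongr
          all_goals first | exact h0 _ | exact h2 _ | exact mul_nonneg (h0 _) (h0 _)
      _ = _ := by ring
  · have : PP K γ w m u v s = 0 := by
      unfold PP
      by_cases a1 : s ∈ closedBall c R
      · by_cases a2 : s + u • w ∈ closedBall c R
        · by_cases a3 : s + (u + v) • w ∈ closedBall c R
          · exact absurd ⟨a1, a2, a3⟩ h1
          · simp [hs _ a3]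
        · simp [hs _ a2]
      · simp [hs _ a1]
    rw [this, abs_zero]; split_ifs <;> positivity

lemma O_bd (hK : CZK n K C) (h : NearIso γ ι η) (hw1 : 1 ≤ ‖w‖) (hw2 : ‖w‖ ≤ 2) (hδ : 0 < δ) (hR : 0 ≤ R)
    {m : EV n → ℝ} (hm : Measurable m) (h0 : ∀ s, 0 ≤ m s) (h2 : ∀ s, m s ≤ 2)
    (hs : ∀ s ∉ closedBall c R, m s = 0) :
    ∫⁻ r in {r : ℝ × ℝ | δ < r.1 ∧ δ < r.2 - r.1}, ‖(∫ s, GG K γ w δ m r s) +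
      (∫ s, GG K γ w δ m (-r.1, r.2 - r.1) s) + ∫ s, GG K γ w δ m (-r.2, r.1 - r.2) s‖ₑ ≤
    ofReal (16 * C ^ 2 * 4 ^ (n + 1) * (16 * ((lipschitzExtensionConstant (EW n) * 2 : ℝ≥0) * 2) ^ 2 *
      (2 ^ n * volume.real (closedBall c R)))) := by
  obtain ⟨g, hgl, hg, hg0⟩ := h.cut c hR
  set c0 : ℝ := 16 * C ^ 2 * 4 ^ (n + 1)
  have hc0 : 0 ≤ c0 := by positivity
  set Q : ℝ × ℝ → ℝ≥0∞ := fun r => ∫⁻ s, ofReal (‖sl g w s r.1 - sl g w (s + r.1 • w) (r.2 - r.1)‖ ^ 2 / r.2 ^ 2) with hQ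
  have gm : Measurable g := hgl.continuous.measurable
  have Qm : Measurable Q := by
    refine Measurable.lintegral_prod_right' (f := fun p : (ℝ × ℝ) × EV n => ofReal (‖sl g w p.2 p.1.1 - sl g w (p.2 + p.1.1 • w) (p.1.2 - p.1.1)‖ ^ 2 / p.1.2 ^ 2)) ?_
    unfold sl; fun_prop
  have mO : MeasurableSet {r : ℝ × ℝ | δ < r.1 ∧ δ < r.2 - r.1} := by measurability
  set T : Set (ℝ × ℝ) := {r | r.2 ∈ Ioc δ (δ + 1 + 2 * R) ∧ r.1 ∈ Ioo 0 r.2}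
  have mT : MeasurableSet T := by
    simp only [T, mem_Ioc, mem_Ioo]; measurability
  calc _ ≤ ∫⁻ r, T.indicator (fun r => ofReal c0 * Q r) r := by
        rw [← lintegral_indicator mO]
        refine lintegral_mono fun r => ?_
        by_cases hr : r ∈ {r : ℝ × ℝ | δ < r.1 ∧ δ < r.2 - r.1}
        · rw [indicator_of_mem hr]
          obtain ⟨u, v'⟩ := r
          obtain ⟨v, rfl⟩ : ∃ v, v' = u + v := ⟨v' - u, by ring⟩
          have hu : δ < u := hr.1
          have hv : δ < v := by have := hr.2; simpa using this
          have hu0 := hδ.trans hu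
          have hv0 := hδ.trans hv
          simp only
          rw [GG_sum hK h hw1 hw2 hδ hm h0 h2 hs hu hv]
          have hb := PP_bd hK h hw1 hw2 h0 h2 hs hg hu0 hv0
          by_cases h5 : u + v ≤ 2 * R
          · rw [indicator_of_mem (show (u, u + v) ∈ T from ⟨⟨by simp only; linarith, by simp only; linarith⟩, hu0, by simp only; linarith⟩)]
            refine (enorm_integral_le_lintegral_enorm _).trans ?_
            rw [hQ]
            simp only [add_sub_cancel_left]
            rw [← lintegral_const_mul _ (by unfold sl; fun_prop)]
            refine lintegral_mono fun s => ?_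
            rw [← ofReal_mul hc0, ← ofReal_norm]
            apply ofReal_le_ofReal
            have := hb s
            rwa [if_pos h5] at this
          · have : ∀ s, PP K γ w m u v s = 0 := fun s => by
              have := hb s
              rw [if_neg h5] at this
              exact abs_nonpos_iff.1 this
            simp [this]
        · rw [indicator_of_notMem hr]; exact zero_le
    _ = ∫⁻ v, ∫⁻ u, T.indicator (fun r => ofReal c0 * Q r) (u, v) := by
        rw [Measure.volume_eq_prod, lintegral_prod_symm]
        exact ((Qm.const_mul _).indicator mT).aemeasurable
    _ = ∫⁻ v in Ioc δ (δ + 1 + 2 * R), ∫⁻ u in Ioo 0 v, ofReal c0 * Q (u, v) := by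
        rw [← lintegral_indicator measurableSet_Ioc]
        congr 1; funext v
        by_cases hv : v ∈ Ioc δ (δ + 1 + 2 * R)
        · rw [indicator_of_mem hv, ← lintegral_indicator measurableSet_Ioo]
          congr 1; funext u
          by_cases hu : u ∈ Ioo 0 v
          · rw [indicator_of_mem hu, indicator_of_mem (show (u, v) ∈ T from ⟨hv, hu⟩)]
          · rw [indicator_of_notMem hu, indicator_of_notMem (show (u, v) ∉ T from fun hh => hu hh.2)]
        · rw [indicator_of_notMem hv]
          have : ∀ u, (u, v) ∉ T := fun u hh => hv hh.1
          simp [this]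
    _ = ofReal c0 * ∫⁻ v in Ioc δ (δ + 1 + 2 * R), ∫⁻ u in Ioo 0 v, Q (u, v) := by
        rw [← lintegral_const_mul' _ _ ofReal_ne_top]
        congr 1; funext v
        rw [← lintegral_const_mul' _ _ ofReal_ne_top]
    _ ≤ ofReal c0 * ofReal (16 * ((lipschitzExtensionConstant (EW n) * 2 : ℝ≥0) * ‖w‖) ^ 2 * volume.real (closedBall c (2 * R))) := by
        gcongr
        exact sqfun hgl hg0 hδ (by linarith)
    _ ≤ _ := by
        rw [← ofReal_mul hc0]
        apply ofReal_le_ofReal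
        rw [Measure.addHaar_real_closedBall _ _ hR, Measure.addHaar_real_closedBall _ _ (by linarith),
          finrank_euclideanSpace_fin, mul_pow 2 R n, mul_assoc (2 ^ n)]
        gcongr

theorem H_test (hK : CZK n K C) : ∃ A : ℝ, 0 ≤ A ∧ ∀ (γ : EV n → EW n) (ι : EV n →ₗᵢ[ℝ] EW n) (η : ℝ)
    (_ : NearIso γ ι η) (w : EV n) (_ : 1 ≤ ‖w‖) (_ : ‖w‖ ≤ 2) (δ : ℝ) (_ : 0 < δ) (c : EV n) (R : ℝ) (_ : 0 ≤ R)
    (m : EV n → ℝ) (_ : Measurable m) (_ : ∀ s, 0 ≤ m s) (_ : ∀ s, m s ≤ 2) (_ : ∀ s ∉ closedBall c R, m s = 0),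
    Integrable (fun s => m s * (∫ r, kd K γ w δ s r * m (s + r • w)) ^ 2) ∧
    ∫ s, m s * (∫ r, kd K γ w δ s r * m (s + r • w)) ^ 2 ≤ A * volume.real (closedBall c R) := by
  set A1 : ℝ := 16 * C ^ 2 * 4 ^ (n + 1) * (16 * ((lipschitzExtensionConstant (EW n) * 2 : ℝ≥0) * 2) ^ 2 * 2 ^ n)
  have hA1 : 0 ≤ A1 := by positivity
  refine ⟨8 * (8 * (C * 2 ^ n) ^ 2) + 2 * A1, by positivity, ?_⟩
  intro γ ι η h w hw1 hw2 δ hδ c R hR m hm h0 h2 hs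
  set V := volume.real (closedBall c R)
  have hV : 0 ≤ V := measureReal_nonneg
  set J : ℝ × ℝ → ℝ := fun r => ∫ s, GG K γ w δ m r s with hJ
  have hGi := GG_int hK h hw1 hw2 hδ hm h0 h2 hs
  have hJi : Integrable J := hGi.integral_prod_left
  have e0 : (fun s => m s * (∫ r, kd K γ w δ s r * m (s + r • w)) ^ 2) = fun s => ∫ r, GG K γ w δ m r s := by
    funext s
    rw [sq, ← integral_prod_mul, ← integral_const_mul, Measure.volume_eq_prod]
    congr 1; funext r
    unfold GG; ring
  have e1 : ∫ s, m s * (∫ r, kd K γ w δ s r * m (s + r • w)) ^ 2 = ∫ r, J r := by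
    rw [hJ, integral_integral_swap (f := fun r s => GG K γ w δ m r s) hGi, e0]
  refine ⟨by rw [e0]; exact hGi.integral_prod_right, ?_⟩
  have mN : MeasurableSet {r : ℝ × ℝ | |r.1 - r.2| ≤ δ} := measurableSet_le (by fun_prop) measurable_const
  have b1 : |∫ r in {r : ℝ × ℝ | |r.1 - r.2| ≤ δ}, J r| ≤ 8 * (C * 2 ^ n) ^ 2 * V * 8 := by
    apply abs_le_of_enorm_le (by positivity)
    refine (enorm_integral_le_lintegral_enorm _).trans ?_
    rw [ofReal_mul (by positivity)]
    refine le_trans ?_ (mul_le_mul_right (lint_near hδ) _)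
    rw [← lintegral_const_mul' _ _ ofReal_ne_top, ← lintegral_indicator mN]
    refine lintegral_mono fun r => ?_
    by_cases hr : r ∈ {r : ℝ × ℝ | |r.1 - r.2| ≤ δ}
    · rw [indicator_of_mem hr, indicator_of_mem hr, ← ofReal_mul (by positivity), ← ofReal_norm]
      apply ofReal_le_ofReal
      refine (GG_J hK h hw1 hw2 hδ h0 h2 hs r).trans (le_of_eq ?_)
      unfold qd; ring
    · rw [indicator_of_notMem hr]; exact zero_le
  have b2 : |∫ r in {r : ℝ × ℝ | δ < r.1 ∧ δ < r.2 - r.1},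
        (J r + J (-r.1, r.2 - r.1) + J (-r.2, r.1 - r.2))| ≤ A1 * V := by
    apply abs_le_of_enorm_le (by positivity)
    refine (enorm_integral_le_lintegral_enorm _).trans ?_
    refine (O_bd hK h hw1 hw2 hδ hR hm h0 h2 hs).trans (le_of_eq ?_)
    congr 1; simp only [A1, V]; ring
  rw [e1, int_split hJi hδ]
  · have := (abs_le.1 b1).2
    have := (abs_le.1 b2).2
    linarith
  · intro r; simp only [hJ]; congr 1; funext s; unfold GG; simp only [Prod.fst_swap, Prod.snd_swap]; ring
  · intro r hr
    have : ∀ s, GG K γ w δ m r s = 0 := fun s => by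
      unfold GG
      rcases hr with hr | hr
      · have : kd K γ w δ s r.1 = 0 := by unfold kd; rw [if_neg (not_lt.2 hr)]
        rw [this]; ring
      · have : kd K γ w δ s r.2 = 0 := by unfold kd; rw [if_neg (not_lt.2 hr)]
        rw [this]; ring
    simp [hJ, this]

end testing2b

section testing3
variable {n : ℕ} {γ : EV n → EW n} {ι : EV n →ₗᵢ[ℝ] EW n} {η : ℝ}
  {K : EW n → ℝ} {C : ℝ} {w c : EV n} {R δ : ℝ}

def th (δ ρ : ℝ) : ℝ := if δ < ρ then 2 * Real.log (ρ / max δ (ρ / 2)) else 0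

lemma th_meas : Measurable (th δ) := by
  unfold th
  exact Measurable.ite measurableSet_Ioi (by fun_prop) measurable_const

lemma th_nonneg (hδ : 0 < δ) (ρ : ℝ) : 0 ≤ th δ ρ := by
  unfold th; split_ifs with h
  · have : 0 ≤ Real.log (ρ / max δ (ρ / 2)) := by
      apply Real.log_nonneg
      rw [one_le_div (lt_max_of_lt_left hδ)]
      exact max_le h.le (by linarith)
    linarith
  · exact le_rfl

lemma th_le (hδ : 0 < δ) (ρ : ℝ) : th δ ρ ≤ 2 * Real.log 2 := by
  unfold th; split_ifs with h
  · have : 0 < ρ := hδ.trans h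
    gcongr
    rw [div_le_iff₀ (lt_max_of_lt_left hδ)]
    have := le_max_right δ (ρ / 2)
    linarith
  · have := Real.log_pos (one_lt_two); positivity

lemma th_eq (hδ : 0 < δ) {ρ : ℝ} (h : 2 * δ ≤ ρ) : th δ ρ = 2 * Real.log 2 := by
  unfold th
  rw [if_pos (by linarith), max_eq_right (by linarith)]
  have : ρ ≠ 0 := by linarith
  congr 2; field_simp

lemma th_zero {ρ : ℝ} (h : ρ ≤ δ) : th δ ρ = 0 := by
  unfold th; rw [if_neg (not_lt.2 h)]

lemma th_integral (hδ : 0 < δ) (ρ : ℝ) :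
    ∫ r : ℝ, (if δ < |r| ∧ |r| ≤ ρ ∧ ρ < 2 * |r| then |r|⁻¹ else 0) = th δ ρ := by
  rw [integral_comp_abs (f := fun r => if δ < r ∧ r ≤ ρ ∧ ρ < 2 * r then r⁻¹ else 0)]
  have e : (fun r : ℝ => if δ < r ∧ r ≤ ρ ∧ ρ < 2 * r then r⁻¹ else 0) =
      (Ioc (max δ (ρ / 2)) ρ).indicator fun r => r⁻¹ := by
    funext r
    simp only [indicator, mem_Ioc, max_lt_iff]
    have : (δ < r ∧ r ≤ ρ ∧ ρ < 2 * r) ↔ ((δ < r ∧ ρ / 2 < r) ∧ r ≤ ρ) := by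
      constructor
      · rintro ⟨h1, h2, h3⟩; exact ⟨⟨h1, by linarith⟩, h2⟩
      · rintro ⟨⟨h1, h2⟩, h3⟩; exact ⟨h1, h3, by linarith⟩
    simp only [this]
  have hm : 0 < max δ (ρ / 2) := lt_max_of_lt_left hδ
  rw [e, setIntegral_indicator measurableSet_Ioc]
  have : Ioi 0 ∩ Ioc (max δ (ρ / 2)) ρ = Ioc (max δ (ρ / 2)) ρ :=
    inter_eq_right.2 fun r hr => hm.trans hr.1
  rw [this]
  unfold th
  split_ifs with h
  · have h1 : max δ (ρ / 2) ≤ ρ := max_le h.le (by linarith)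
    rw [← intervalIntegral.integral_of_le h1, integral_inv_of_pos hm (by linarith)]
  · rw [Ioc_eq_empty]
    · simp
    · intro h1; exact h ((le_max_left _ _).trans_lt h1)

def Ann (n : ℕ) : Set (EV n) := {w | 1 ≤ ‖w‖ ∧ ‖w‖ < 2}

lemma Ann_meas : MeasurableSet (Ann n) := by unfold Ann; measurability

lemma Ann_fin : volume (Ann n) < ⊤ :=
  (measure_mono (fun w hw => by simpa using hw.2.le : Ann n ⊆ closedBall 0 2)).trans_lt measure_closedBall_lt_top

lemma polar (hδ : 0 < δ) (hn : 1 ≤ n) {F : EV n → ℝ} (hF : Measurable F) {M R : ℝ} (hM : ∀ u, |F u| ≤ M) (hR : 0 ≤ R)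
    (hs : ∀ u ∉ closedBall (0 : EV n) R, F u = 0) :
    ∫ w in Ann n, ∫ r : ℝ, (if δ < |r| then |r| ^ (n - 1) * F (r • w) else 0) = ∫ u, F u * th δ ‖u‖ := by
  have hM0 : 0 ≤ M := (abs_nonneg _).trans (hM 0)
  have i1 : Integrable (fun p : EV n × ℝ => (Ann n).indicator (fun w => if δ < |p.2| then |p.2| ^ (n - 1) * F (p.2 • w) else 0) p.1)
      (volume.prod volume) := by
    set S : Set (EV n × ℝ) := closedBall 0 2 ×ˢ Icc (-R) R
    have hS : MeasurableSet S := measurableSet_closedBall.prod measurableSet_Icc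
    have hfin : (volume.prod volume) S ≠ ⊤ :=
      ((isCompact_closedBall 0 2).prod isCompact_Icc).measure_lt_top.ne
    have hm : Measurable (fun p : EV n × ℝ => (Ann n).indicator (fun w => if δ < |p.2| then |p.2| ^ (n - 1) * F (p.2 • w) else 0) p.1) := by
      simp only [indicator]
      refine Measurable.ite (Ann_meas.preimage measurable_fst) (Measurable.ite (measurableSet_lt measurable_const (by fun_prop)) ?_ measurable_const) measurable_const
      have := hF.comp (by fun_prop : Measurable fun p : EV n × ℝ => p.2 • p.1)
      fun_prop
    refine Integrable.mono' (g := S.indicator fun _ => R ^ (n - 1) * M)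
      ((integrable_indicator_iff hS).2 (integrableOn_const hfin)) hm.aestronglyMeasurable (ae_of_all _ fun p => ?_)
    by_cases hp : p.1 ∈ Ann n
    · rw [indicator_of_mem hp]
      have hp1 := hp.1
      by_cases hp2 : p ∈ S
      · rw [indicator_of_mem hp2]
        have : |p.2| ≤ R := abs_le.2 hp2.2
        split_ifs with h
        · rw [norm_mul, norm_pow, norm_eq_abs, abs_abs]
          gcongr; exact hM _
        · simp; positivity
      · have : F (p.2 • p.1) = 0 := by
          apply hs; intro h; apply hp2
          refine ⟨by simpa using hp.2.le, ?_⟩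
          rw [mem_closedBall, dist_zero_right, norm_smul, norm_eq_abs] at h
          exact abs_le.1 (by nlinarith [abs_nonneg p.2])
        rw [indicator_of_notMem hp2, this]; simp
    · rw [indicator_of_notMem hp, norm_zero]
      exact indicator_nonneg (fun _ _ => by positivity) _
  have i2 : Integrable (fun p : ℝ × EV n => (if δ < |p.1| ∧ |p.1| ≤ ‖p.2‖ ∧ ‖p.2‖ < 2 * |p.1| then |p.1|⁻¹ else 0) * F p.2)
      (volume.prod volume) := by
    set S : Set (ℝ × EV n) := Icc (-R) R ×ˢ closedBall 0 R
    have hS : MeasurableSet S := measurableSet_Icc.prod measurableSet_closedBall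
    have hfin : (volume.prod volume) S ≠ ⊤ :=
      (isCompact_Icc.prod (isCompact_closedBall 0 R)).measure_lt_top.ne
    refine Integrable.mono' (g := S.indicator fun _ => δ⁻¹ * M)
      ((integrable_indicator_iff hS).2 (integrableOn_const hfin)) ?_ (ae_of_all _ fun p => ?_)
    · refine Measurable.aestronglyMeasurable ?_
      refine Measurable.mul (Measurable.ite ?_ (by fun_prop) measurable_const) (by fun_prop)
      measurability
    · by_cases hp2 : p ∈ S
      · rw [indicator_of_mem hp2, norm_mul]
        gcongr
        · split_ifs with h
          · rw [norm_inv, norm_eq_abs, abs_abs]; gcongr; exact h.1.le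
          · simp; positivity
        · exact hM _
      · rw [indicator_of_notMem hp2]
        by_cases h : |p.1| ≤ ‖p.2‖
        · have : F p.2 = 0 := hs _ fun h' => hp2 ⟨abs_le.1 (by simp at h'; linarith), h'⟩
          simp [this]
        · simp [h]
  rw [← integral_indicator Ann_meas]
  have e1 : ∀ w, (Ann n).indicator (fun w => ∫ r : ℝ, (if δ < |r| then |r| ^ (n - 1) * F (r • w) else 0)) w =
      ∫ r : ℝ, (Ann n).indicator (fun w => if δ < |r| then |r| ^ (n - 1) * F (r • w) else 0) w := by
    intro w
    by_cases hw : w ∈ Ann n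
    · simp only [indicator_of_mem hw]
    · simp only [indicator_of_notMem hw, integral_zero]
  simp only [e1]
  rw [integral_integral_swap i1]
  have e2 : ∀ r : ℝ, ∫ w, (Ann n).indicator (fun w => if δ < |r| then |r| ^ (n - 1) * F (r • w) else 0) w =
      ∫ u, (if δ < |r| ∧ |r| ≤ ‖u‖ ∧ ‖u‖ < 2 * |r| then |r|⁻¹ else 0) * F u := by
    intro r
    by_cases hr : δ < |r|
    · have hr0 : 0 < |r| := hδ.trans hr
      have := Measure.integral_comp_smul (volume : Measure (EV n)) (fun u => |r| ^ n * ((if |r| ≤ ‖u‖ ∧ ‖u‖ < 2 * |r| then |r|⁻¹ else 0) * F u)) r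
      rw [finrank_euclideanSpace_fin, integral_const_mul (|r| ^ n) (fun u : EV n => (if |r| ≤ ‖u‖ ∧ ‖u‖ < 2 * |r| then |r|⁻¹ else 0) * F u), abs_inv, abs_pow, smul_eq_mul, ← mul_assoc,
        inv_mul_cancel₀ (by positivity), one_mul] at this
      simp only [hr, true_and, if_true]
      rw [← this]
      congr 1; funext w
      have a1 : |r| ≤ ‖r • w‖ ∧ ‖r • w‖ < 2 * |r| ↔ w ∈ Ann n := by
        simp only [Ann, mem_ofPred_eq, norm_smul, norm_eq_abs]
        constructor
        · rintro ⟨h1, h2⟩; constructor <;> nlinarith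
        · rintro ⟨h1, h2⟩; constructor <;> nlinarith
      by_cases hw : w ∈ Ann n
      · rw [indicator_of_mem hw, if_pos (a1.2 hw), ← mul_assoc]; congr 1
        obtain ⟨k, rfl⟩ : ∃ k, n = k + 1 := ⟨n - 1, by omega⟩
        rw [pow_succ, mul_assoc, mul_inv_cancel₀ hr0.ne']; simp
      · rw [indicator_of_notMem hw, if_neg (fun h => hw (a1.1 h))]; simp
    · simp [hr]
  simp only [e2]
  rw [integral_integral_swap i2]
  congr 1; funext u
  rw [integral_mul_const, th_integral hδ, mul_comm]

lemma lint_cs {α : Type*} [MeasurableSpace α] {μ : Measure α} {f g : α → ℝ≥0∞} (hf : AEMeasurable f μ)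
    (hg : AEMeasurable g μ) : (∫⁻ x, f x * g x ∂μ) ^ 2 ≤ (∫⁻ x, f x ^ 2 ∂μ) * ∫⁻ x, g x ^ 2 ∂μ := by
  have h := ENNReal.lintegral_mul_le_Lp_mul_Lq μ Real.HolderConjugate.two_two hf hg
  have h2 := pow_le_pow_left₀ (zero_le) h 2
  rw [mul_pow] at h2
  refine h2.trans (le_of_eq ?_)
  simp only [← ENNReal.rpow_natCast, ← ENNReal.rpow_mul]
  norm_num

lemma lint_cs1 {α : Type*} [MeasurableSpace α] {μ : Measure α} {f : α → ℝ≥0∞} (hf : AEMeasurable f μ) :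
    (∫⁻ x, f x ∂μ) ^ 2 ≤ μ univ * ∫⁻ x, f x ^ 2 ∂μ := by
  have := lint_cs (aemeasurable_const (b := (1 : ℝ≥0∞)) (μ := μ)) hf
  simpa using this

def Hd (K : EW n → ℝ) (γ : EV n → EW n) (δ : ℝ) (g : EV n → ℝ) (w s : EV n) : ℝ :=
  ∫ r, kd K γ w δ s r * g (s + r • w)

def kt (K : EW n → ℝ) (γ : EV n → EW n) (δ : ℝ) (s t : EV n) : ℝ :=
  K (γ t - γ s) * th δ ‖t - s‖

def Td (K : EW n → ℝ) (γ : EV n → EW n) (δ : ℝ) (g : EV n → ℝ) (s : EV n) : ℝ :=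
  ∫ t, kt K γ δ s t * g t

lemma kd_eq (hK : CZK n K C) (hδ : 0 < δ) (s : EV n) (r : ℝ) :
    kd K γ w δ s r = if δ < |r| then |r| ^ (n - 1) * K (γ (s + r • w) - γ s) else 0 := by
  unfold kd sl
  split_ifs with h
  · have hr0 : r ≠ 0 := by rintro rfl; simp at h; linarith
    have hn := hK.one_le_n
    obtain ⟨k, rfl⟩ : ∃ k, n = k + 1 := ⟨n - 1, by omega⟩
    rcases lt_or_gt_of_ne hr0 with hr | hr
    · have h1 := hK.hom (γ (s + r • w) - γ s) (-r)⁻¹ (inv_pos.2 (by linarith))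
      have h2 := hK.odd ((-r)⁻¹ • (γ (s + r • w) - γ s))
      rw [inv_neg, neg_smul, neg_neg] at h2
      rw [inv_neg, neg_smul] at h1
      rw [h2, h1, abs_of_neg hr, ← inv_neg, inv_pow, div_inv_eq_mul]
      simp only [Nat.add_sub_cancel, pow_succ]
      field_simp
    · rw [hK.hom _ _ (inv_pos.2 hr), abs_of_pos hr, inv_pow, div_inv_eq_mul]
      simp only [Nat.add_sub_cancel, pow_succ]
      field_simp
  · rfl

lemma K_bd' (hK : CZK n K C) (h : NearIso γ ι η) (s t : EV n) :
    |K (γ t - γ s)| ≤ C * 2 ^ n / ‖t - s‖ ^ n := by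
  by_cases hst : t = s
  · subst hst; simp [hK.zero]; have := hK.one_le; positivity
  refine (hK.bd _).trans ?_
  have h1 := h.low t s
  have h0 : 0 < ‖t - s‖ := norm_pos_iff.2 (sub_ne_zero.2 hst)
  have hC := hK.one_le
  have h2 : ‖t - s‖ / 2 ≤ ‖γ t - γ s‖ := by linarith
  calc C / ‖γ t - γ s‖ ^ n ≤ C / (‖t - s‖ / 2) ^ n := by gcongr
    _ = _ := by rw [div_pow]; field_simp

lemma Td_eq (hK : CZK n K C) (h : NearIso γ ι η) (hδ : 0 < δ) {g : EV n → ℝ} (hg : Measurable g) {M : ℝ}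
    (hM : ∀ t, |g t| ≤ M) (hs : ∀ t ∉ closedBall c R, g t = 0) (hR : 0 ≤ R) (s : EV n) :
    Td K γ δ g s = ∫ w in Ann n, Hd K γ δ g w s := by
  have hC := hK.one_le
  have hM0 : 0 ≤ M := (abs_nonneg _).trans (hM 0)
  set F : EV n → ℝ := fun u => if δ < ‖u‖ then K (γ (s + u) - γ s) * g (s + u) else 0 with hF
  have hFm : Measurable F := by
    have := h.cont.measurable
    have := hK.meas
    refine Measurable.ite (measurableSet_lt measurable_const (by fun_prop)) (by fun_prop) measurable_const
  have hFb : ∀ u, |F u| ≤ C * 2 ^ n / δ ^ n * M := by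
    intro u
    simp only [hF]
    split_ifs with hu
    · rw [abs_mul]
      gcongr
      · refine (K_bd' hK h s (s + u)).trans ?_
        rw [add_sub_cancel_left]; gcongr
      · exact hM _
    · simp; positivity
  have hFs : ∀ u ∉ closedBall (0 : EV n) (R + ‖s - c‖), F u = 0 := by
    intro u hu
    have : g (s + u) = 0 := hs _ fun h' => hu (by
      rw [mem_closedBall, dist_eq_norm] at *
      have := norm_sub_le (s + u - c) (s - c)
      rw [sub_sub_sub_cancel_right, add_sub_cancel_left] at this
      rw [sub_zero]; linarith)
    simp [hF, this]
  have := polar hδ hK.one_le_n hFm hFb (by positivity) hFs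
  have e1 : Td K γ δ g s = ∫ u, F u * th δ ‖u‖ := by
    unfold Td
    rw [← integral_add_left_eq_self _ s]
    congr 1; funext u
    simp only [hF, kt, add_sub_cancel_left]
    split_ifs with hu
    · ring
    · rw [th_zero (not_lt.1 hu)]; ring
  rw [e1, ← this]
  refine setIntegral_congr_fun Ann_meas fun w hw => ?_
  unfold Hd
  congr 1; funext r
  rw [kd_eq hK hδ]
  split_ifs with hr
  · have : δ < ‖r • w‖ := by
      rw [norm_smul, norm_eq_abs]; nlinarith [hw.1]
    simp only [hF, this, if_true]; ring
  · simp

lemma Hd_meas (hK : CZK n K C) (hc : Measurable γ) {g : EV n → ℝ} (hg : Measurable g) :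
    Measurable fun p : EV n × EV n => Hd K γ δ g p.1 p.2 := by
  unfold Hd
  refine (StronglyMeasurable.integral_prod_right (f := fun (p : EV n × EV n) (r : ℝ) => kd K γ p.1 δ p.2 r * g (p.2 + r • p.1)) ?_).measurable
  refine Measurable.stronglyMeasurable ?_
  have h1 : Measurable fun p : (EV n × EV n) × ℝ => kd K γ p.1.1 δ p.1.2 p.2 :=
    (kd_meas (δ := δ) hK hc).comp (by fun_prop : Measurable fun p : (EV n × EV n) × ℝ => (p.1.1, p.1.2, p.2))
  simp only [Function.uncurry_def]
  fun_prop

lemma Hd_meas' (hK : CZK n K C) (hc : Measurable γ) {g : EV n → ℝ} (hg : Measurable g) :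
    Measurable fun p : EV n × EV n => Hd K γ δ g p.2 p.1 := by
  have h1 := Hd_meas (δ := δ) hK hc hg
  have h2 := h1.comp (measurable_snd.prodMk measurable_fst : Measurable fun p : EV n × EV n => (p.2, p.1))
  simp only [Function.comp_def] at h2
  exact h2

lemma Hd_meas1 (hK : CZK n K C) (hc : Measurable γ) {g : EV n → ℝ} (hg : Measurable g) (s : EV n) :
    Measurable fun w : EV n => Hd K γ δ g w s := by
  have h1 := Hd_meas (δ := δ) hK hc hg
  have h2 := h1.comp (measurable_id.prodMk measurable_const : Measurable fun w : EV n => (w, s))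
  simp only [Function.comp_def] at h2
  exact h2

lemma Hd_int (hK : CZK n K C) (h : NearIso γ ι η) (hw1 : 1 ≤ ‖w‖) (hw2 : ‖w‖ ≤ 2) (hδ : 0 < δ) {g : EV n → ℝ} (hg : Measurable g) {M : ℝ}
    (hM : ∀ t, |g t| ≤ M) (hs : ∀ t ∉ closedBall c R, g t = 0) {s : EV n} (hsB : s ∈ closedBall c R) :
    Integrable fun r => kd K γ w δ s r * g (s + r • w) := by
  have hm := (kd_meas (δ := δ) hK h.cont.measurable).comp (by fun_prop : Measurable fun r : ℝ => (w, s, r))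
  have hC := hK.one_le
  refine Integrable.mono' (g := (Icc (-(2 * R)) (2 * R)).indicator fun _ => C * 2 ^ n * δ⁻¹ * M)
    ((integrable_indicator_iff measurableSet_Icc).2 (integrableOn_const isCompact_Icc.measure_lt_top.ne))
    (hm.mul (by fun_prop)).aestronglyMeasurable (ae_of_all _ fun r => ?_)
  by_cases hr : r ∈ Icc (-(2 * R)) (2 * R)
  · rw [indicator_of_mem hr, norm_mul]
    have := kd_bd hK h hw1 hw2 hδ s r
    have := qd_le hδ r
    gcongr
    · exact (kd_bd hK h hw1 hw2 hδ s r).trans (by gcongr; exact qd_le hδ r)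
    · exact hM _
  · rw [indicator_of_notMem hr, hs, mul_zero, norm_zero]
    intro h'; exact hr (abs_le.1 (mem_ball_r hw1 hsB h'))

lemma H_test2 (hK : CZK n K C) : ∃ A : ℝ, 0 ≤ A ∧ ∀ (γ : EV n → EW n) (ι : EV n →ₗᵢ[ℝ] EW n) (η : ℝ)
    (_ : NearIso γ ι η) (w : EV n) (_ : 1 ≤ ‖w‖) (_ : ‖w‖ ≤ 2) (δ : ℝ) (_ : 0 < δ) (c : EV n) (R : ℝ) (_ : 0 ≤ R)
    (g : EV n → ℝ) (_ : Measurable g) (_ : ∀ s, |g s| ≤ 1) (_ : ∀ s ∉ closedBall c R, g s = 0),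
    ∫⁻ s in closedBall c R, ofReal (Hd K γ δ g w s ^ 2) ≤ ofReal (A * volume.real (closedBall c R)) := by
  obtain ⟨A, hA, H⟩ := H_test hK
  refine ⟨24 * A, by positivity, ?_⟩
  intro γ ι η h w hw1 hw2 δ hδ c R hR g hg hg1 hgs
  set B := closedBall c R with hB
  have mB : MeasurableSet B := measurableSet_closedBall
  set V := volume.real B
  set m : EV n → ℝ := B.indicator fun s => 1 + g s / 2
  set o : EV n → ℝ := B.indicator fun _ => 1
  have mm : Measurable m := Measurable.indicator (by fun_prop) mB
  have mo : Measurable o := Measurable.indicator (by fun_prop) mB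
  have gb := fun s => abs_le.1 (hg1 s)
  have hm0 : ∀ s, 0 ≤ m s := fun s => indicator_nonneg (fun s _ => by linarith [(gb s).1]) s
  have ho0 : ∀ s, 0 ≤ o s := fun s => indicator_nonneg (fun s _ => by linarith [(gb s).1]) s
  have hm2 : ∀ s, m s ≤ 2 := fun s => by
    simp only [m, indicator]; split_ifs <;> linarith [(gb s).2]
  have ho2 : ∀ s, o s ≤ 2 := fun s => by simp only [o, indicator]; split_ifs <;> norm_num
  have hms : ∀ s ∉ B, m s = 0 := fun s hs => indicator_of_notMem hs _
  have hos : ∀ s ∉ B, o s = 0 := fun s hs => indicator_of_notMem hs _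
  obtain ⟨im, bm⟩ := H γ ι η h w hw1 hw2 δ hδ c R hR m mm hm0 hm2 hms
  obtain ⟨io, bo⟩ := H γ ι η h w hw1 hw2 δ hδ c R hR o mo ho0 ho2 hos
  change Integrable (fun s => m s * Hd K γ δ m w s ^ 2) at im
  change Integrable (fun s => o s * Hd K γ δ o w s ^ 2) at io
  have key : ∀ s ∈ B, Hd K γ δ g w s ^ 2 ≤ 16 * (m s * Hd K γ δ m w s ^ 2) + 8 * (o s * Hd K γ δ o w s ^ 2) := by
    intro s hs
    have e : Hd K γ δ g w s = 2 * (Hd K γ δ m w s - Hd K γ δ o w s) := by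
      unfold Hd
      rw [← integral_sub (Hd_int hK h hw1 hw2 hδ mm (fun t => by rw [abs_of_nonneg (hm0 t)]; exact hm2 t) hms hs)
        (Hd_int hK h hw1 hw2 hδ mo (fun t => by rw [abs_of_nonneg (ho0 t)]; exact ho2 t) hos hs), ← integral_const_mul]
      congr 1; funext r
      by_cases ht : s + r • w ∈ B
      · simp only [m, o, indicator_of_mem ht]; ring
      · simp only [m, o, indicator_of_notMem ht, hgs _ ht]; ring
    have h1 : 1 / 2 ≤ m s := by
      simp only [m, indicator_of_mem hs]; linarith [(gb s).1]
    have h2 : o s = 1 := indicator_of_mem hs _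
    rw [e, h2]
    have := mul_le_mul_of_nonneg_right h1 (sq_nonneg (Hd K γ δ m w s))
    nlinarith [sq_nonneg (Hd K γ δ m w s + Hd K γ δ o w s)]
  calc _ ≤ ∫⁻ s in B, ofReal (16 * (m s * Hd K γ δ m w s ^ 2) + 8 * (o s * Hd K γ δ o w s ^ 2)) :=
        setLIntegral_mono' mB fun s hs => ofReal_le_ofReal (key s hs)
    _ ≤ ∫⁻ s, ofReal (16 * (m s * Hd K γ δ m w s ^ 2) + 8 * (o s * Hd K γ δ o w s ^ 2)) :=
        setLIntegral_le_lintegral _ _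
    _ = ofReal (16 * (∫ s, m s * Hd K γ δ m w s ^ 2) + 8 * (∫ s, o s * Hd K γ δ o w s ^ 2)) := by
        rw [← integral_const_mul, ← integral_const_mul, ← integral_add (im.const_mul _) (io.const_mul _),
          ofReal_integral_eq_lintegral_ofReal (f := fun s => 16 * (m s * Hd K γ δ m w s ^ 2) + 8 * (o s * Hd K γ δ o w s ^ 2))
            ((im.const_mul _).add (io.const_mul _))]
        · refine ae_of_all _ fun s => ?_
          have := hm0 s
          have := ho0 s
          simp only [Pi.zero_apply]; positivity
    _ ≤ _ := by
        apply ofReal_le_ofReal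
        unfold Hd
        linarith

theorem T_test (hK : CZK n K C) : ∃ A : ℝ, 0 ≤ A ∧ ∀ (γ : EV n → EW n) (ι : EV n →ₗᵢ[ℝ] EW n) (η : ℝ)
    (_ : NearIso γ ι η) (δ : ℝ) (_ : 0 < δ) (c : EV n) (R : ℝ) (_ : 0 ≤ R)
    (g : EV n → ℝ) (_ : Measurable g) (_ : ∀ s, |g s| ≤ 1) (_ : ∀ s ∉ closedBall c R, g s = 0),
    ∫⁻ s in closedBall c R, ‖Td K γ δ g s‖ₑ ^ 2 ≤ ofReal (A * volume.real (closedBall c R)) := by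
  obtain ⟨A, hA, H⟩ := H_test2 hK
  refine ⟨volume.real (Ann n) * (A * volume.real (Ann n)), by positivity, ?_⟩
  intro γ ι η h δ hδ c R hR g hg hg1 hgs
  set V := volume.real (closedBall c R)
  have e : ∀ x : ℝ, ‖x‖ₑ ^ 2 = ofReal (x ^ 2) := fun x => by
    rw [← ofReal_norm, ← ofReal_pow (norm_nonneg _), norm_eq_abs, sq_abs]
  calc ∫⁻ s in closedBall c R, ‖Td K γ δ g s‖ₑ ^ 2
      ≤ ∫⁻ s in closedBall c R, volume (Ann n) * ∫⁻ w in Ann n, ofReal (Hd K γ δ g w s ^ 2) := by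
        refine lintegral_mono fun s => ?_
        rw [Td_eq hK h hδ hg hg1 hgs hR]
        refine (pow_le_pow_left₀ zero_le (enorm_integral_le_lintegral_enorm _) 2).trans ?_
        refine (lint_cs1 ?_).trans ?_
        · have : Measurable fun w => Hd K γ δ g w s := Hd_meas1 hK h.cont.measurable hg s
          exact Measurable.aemeasurable (Measurable.enorm this)
        · simp only [e, Measure.restrict_apply_univ, le_refl]
    _ = volume (Ann n) * ∫⁻ w in Ann n, ∫⁻ s in closedBall c R, ofReal (Hd K γ δ g w s ^ 2) := by
        have h0 : Measurable fun p : EV n × EV n => Hd K γ δ g p.2 p.1 := Hd_meas' hK h.cont.measurable hg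
        have h1 : Measurable (Function.uncurry fun s w => ofReal (Hd K γ δ g w s ^ 2)) :=
          (h0.pow_const 2).ennreal_ofReal
        rw [lintegral_const_mul' _ _ Ann_fin.ne]
        congr 1
        exact lintegral_lintegral_swap h1.aemeasurable
    _ ≤ volume (Ann n) * ∫⁻ w in Ann n, ofReal (A * V) := by
        refine mul_le_mul_right (setLIntegral_mono' Ann_meas fun w hw => ?_) _
        exact H γ ι η h w hw.1 hw.2.le δ hδ c R hR g hg hg1 hgs
    _ = _ := by
        rw [lintegral_const, Measure.restrict_apply_univ, ← ofReal_measureReal Ann_fin.ne,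
          ← ofReal_mul (by positivity), ← ofReal_mul (by positivity)]
        congr 1; ring

end testing3

section tail
def pk (n : ℕ) (r d : ℝ) : ℝ := r / (r + d) ^ (n + 1)

lemma pk_nonneg {n : ℕ} {r d : ℝ} (hr : 0 ≤ r) (hd : 0 ≤ d) : 0 ≤ pk n r d := by unfold pk; positivity

lemma pk_scale {n : ℕ} {r d : ℝ} (hr : 0 < r) : pk n r (r * d) = pk n 1 d / r ^ n := by
  unfold pk
  rw [show r + r * d = r * (1 + d) by ring, mul_pow, pow_succ r, div_div, mul_comm ((1 + d) ^ (n + 1)),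
    mul_comm (r ^ n) r, mul_assoc, div_mul_eq_div_div, div_self hr.ne']

lemma pk_meas {n : ℕ} : Measurable fun p : ℝ × ℝ => pk n p.1 p.2 := by unfold pk; fun_prop

lemma int_Ioi_pw (n : ℕ) {a : ℝ} (ha : 0 ≤ a) :
    IntegrableOn (fun t : ℝ => (n + 1) * ((1 + t) ^ (n + 2))⁻¹) (Ioi a) ∧
    ∫ t in Ioi a, (n + 1) * ((1 + t) ^ (n + 2))⁻¹ = ((1 + a) ^ (n + 1))⁻¹ := by
  have hd : ∀ x ∈ Ici a, HasDerivAt (fun t : ℝ => -((1 + t) ^ (n + 1))⁻¹) ((n + 1) * ((1 + x) ^ (n + 2))⁻¹) x := by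
    intro x hx
    have hx' : 0 < 1 + x := by have : a ≤ x := hx; linarith
    have h1 : HasDerivAt (fun t : ℝ => (1 + t) ^ (n + 1)) ((n + 1 : ℕ) * (1 + x) ^ n * 1) x := by
      exact ((hasDerivAt_id' x).const_add 1).fun_pow (n + 1)
    have := (h1.fun_inv (by positivity)).fun_neg
    refine this.congr_deriv ?_
    push_cast
    field_simp
    ring
  have hn : ∀ x ∈ Ioi a, 0 ≤ (n + 1 : ℝ) * ((1 + x) ^ (n + 2))⁻¹ := by
    intro x hx
    have hx' : 0 < 1 + x := by have : a < x := hx; linarith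
    positivity
  have ht : Tendsto (fun t : ℝ => -((1 + t) ^ (n + 1))⁻¹) atTop (𝓝 0) := by
    rw [← neg_zero]
    refine Tendsto.neg (tendsto_inv_atTop_zero.comp ?_)
    exact (tendsto_pow_atTop (by omega)).comp (tendsto_atTop_add_const_left _ _ tendsto_id)
  refine ⟨integrableOn_Ioi_deriv_of_nonneg' hd hn ht, ?_⟩
  rw [integral_Ioi_of_hasDerivAt_of_nonneg' hd hn ht]; ring

lemma pk_eq_lint (n : ℕ) {r d : ℝ} (hr : 0 < r) (hd : 0 ≤ d) :
    ofReal (pk n r d) = ∫⁻ t in Ioi (0 : ℝ), (ofReal ((n + 1) * ((1 + t) ^ (n + 2))⁻¹) / ofReal (r ^ n)) *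
      (if d < r * t then 1 else 0) := by
  have h0 : 0 ≤ d / r := by positivity
  have h1 := int_Ioi_pw n h0
  have h2 : ∀ t : ℝ, (if d < r * t then (1 : ℝ≥0∞) else 0) = (Ioi (d / r)).indicator 1 t := by
    intro t
    simp only [indicator, mem_Ioi, div_lt_iff₀' hr, Pi.one_apply]
  simp_rw [h2]
  have h3 : ∀ t : ℝ, (ofReal ((n + 1) * ((1 + t) ^ (n + 2))⁻¹) / ofReal (r ^ n)) * (Ioi (d / r)).indicator 1 t
      = (Ioi (d / r)).indicator (fun t => ofReal ((n + 1) * ((1 + t) ^ (n + 2))⁻¹) * (ofReal (r ^ n))⁻¹) t := by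
    intro t; by_cases h : t ∈ Ioi (d / r) 
    · rw [indicator_of_mem h, indicator_of_mem h, div_eq_mul_inv, Pi.one_apply, mul_one]
    · rw [indicator_of_notMem h, indicator_of_notMem h, mul_zero]
  simp_rw [h3]
  rw [lintegral_indicator measurableSet_Ioi, Measure.restrict_restrict measurableSet_Ioi,
    inter_eq_left.2 (Ioi_subset_Ioi h0), lintegral_mul_const' _ _ (by simp; positivity),
    ← ofReal_integral_eq_lintegral_ofReal (f := fun t : ℝ => (n + 1) * ((1 + t) ^ (n + 2))⁻¹) h1.1, h1.2, ← div_eq_mul_inv,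
    ← ofReal_div_of_pos (by positivity)]
  · congr 1
    have := pk_scale (n := n) (d := d / r) hr
    rw [mul_div_cancel₀ _ hr.ne'] at this
    rw [this]; simp [pk]
  · refine (ae_restrict_mem measurableSet_Ioi).mono fun t ht => ?_
    have : 0 < 1 + t := by have : d / r < t := ht; linarith
    simp only [Pi.zero_apply]; positivity

theorem tail_lemma {X : Type*} [PseudoMetricSpace X] [MeasurableSpace X] [OpensMeasurableSpace X]
    (ρ : Measure X) [SFinite ρ] (x : X) (n : ℕ) (M : ℝ) (hM0 : 0 ≤ M)
    (hM : ∀ r > 0, ρ (closedBall x r) ≤ ofReal (M * r ^ n))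
    (h0 : Tendsto (fun r => ρ (closedBall x r) / ofReal (r ^ n)) (𝓝[>] 0) (𝓝 0)) :
    Tendsto (fun r => ∫⁻ z, ofReal (pk n r (dist z x)) ∂ρ) (𝓝[>] 0) (𝓝 0) := by
  have hbd : ∀ r > 0, ∫⁻ z, ofReal (pk n r (dist z x)) ∂ρ ≤
      ∫⁻ t in Ioi (0 : ℝ), ofReal ((n + 1) * ((1 + t) ^ (n + 2))⁻¹) * (ρ (closedBall x (r * t)) / ofReal (r ^ n)) := by
    intro r hr
    simp_rw [pk_eq_lint n hr dist_nonneg]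
    rw [lintegral_lintegral_swap]
    · refine lintegral_mono fun t => ?_
      rw [lintegral_const_mul' _ _ (ENNReal.div_ne_top ofReal_ne_top (by simp; positivity))]
      have : ∫⁻ z, (if dist z x < r * t then (1 : ℝ≥0∞) else 0) ∂ρ ≤ ρ (closedBall x (r * t)) := by
        rw [← lintegral_indicator_one measurableSet_closedBall]
        refine lintegral_mono fun z => ?_
        simp only [indicator, mem_closedBall, Pi.one_apply]
        split_ifs with h1 h2 <;> simp
        exact h2 h1.le
      refine (mul_le_mul_right this _).trans (le_of_eq ?_)
      rw [div_eq_mul_inv, div_eq_mul_inv, mul_assoc]; congr 1; rw [mul_comm]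
    · refine Measurable.aemeasurable ?_
      have : Measurable fun p : X × ℝ => (if dist p.1 x < r * p.2 then (1 : ℝ≥0∞) else 0) :=
        Measurable.ite (measurableSet_lt (by fun_prop) (by fun_prop)) measurable_const measurable_const
      unfold Function.uncurry
      fun_prop
  have hint : ∫⁻ t in Ioi (0 : ℝ), ofReal ((n + 1) * ((1 + t) ^ (n + 2))⁻¹ ) * ofReal (M * t ^ n) ≠ ∞ := by
    have : ∫⁻ t in Ioi (0 : ℝ), ofReal ((n + 1) * ((1 + t) ^ (n + 2))⁻¹ ) * ofReal (M * t ^ n)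
      ≤ ∫⁻ t in Ioi (0 : ℝ), ofReal ((n + 1) * M) * ofReal (((0 : ℕ) + 1 : ℝ) * ((1 + t) ^ (0 + 2))⁻¹) := by
      refine setLIntegral_mono' measurableSet_Ioi fun t ht => ?_
      have ht' : 0 < t := ht
      rw [← ofReal_mul (by positivity), ← ofReal_mul (by positivity)]
      refine ofReal_le_ofReal ?_
      have : t ^ n ≤ (1 + t) ^ n := by gcongr; linarith
      calc (n + 1) * ((1 + t) ^ (n + 2))⁻¹ * (M * t ^ n) ≤ (n + 1) * ((1 + t) ^ (n + 2))⁻¹ * (M * (1 + t) ^ n) := by gcongr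
        _ = _ := by
          rw [pow_add]; field_simp; push_cast; ring
    refine ne_top_of_le_ne_top ?_ this
    rw [lintegral_const_mul' _ _ ofReal_ne_top]
    refine ENNReal.mul_ne_top ofReal_ne_top ?_
    have := (int_Ioi_pw 0 le_rfl).1
    exact (hasFiniteIntegral_iff_ofReal ((ae_restrict_mem measurableSet_Ioi).mono fun t (ht : 0 < t) => by
      simp only [Pi.zero_apply]; positivity)).1 this.2 |>.ne
  refine tendsto_of_tendsto_of_tendsto_of_le_of_le' tendsto_const_nhds ?_ (Eventually.of_forall fun _ => zero_le)
    (eventually_nhdsWithin_of_forall hbd)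
  rw [← lintegral_zero (μ := volume.restrict (Ioi (0 : ℝ)))]
  have hm : ∀ r : ℝ, Measurable fun t : ℝ => ρ (closedBall x (r * t)) := by
    intro r
    have h1 : Measurable fun t : ℝ => ρ (closedBall x t) := by
      refine Monotone.measurable fun s t h => measure_mono (closedBall_subset_closedBall h)
    exact h1.comp (by fun_prop)
  refine tendsto_lintegral_filter_of_dominated_convergence (fun t => ofReal ((n + 1) * ((1 + t) ^ (n + 2))⁻¹ ) * ofReal (M * t ^ n)) ?_ ?_ hint ?_
  · refine Eventually.of_forall fun r => ?_
    exact (Measurable.mul (f := fun t : ℝ => ofReal ((n + 1) * ((1 + t) ^ (n + 2))⁻¹)) (by fun_prop) ((hm r).div_const _))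
  · refine eventually_nhdsWithin_of_forall fun r (hr : 0 < r) => (ae_restrict_mem measurableSet_Ioi).mono fun t (ht : 0 < t) => ?_
    refine mul_le_mul_right ?_ _
    refine ENNReal.div_le_of_le_mul ?_
    refine (hM _ (by positivity)).trans ?_
    rw [← ofReal_mul (by positivity)]
    refine ofReal_le_ofReal (le_of_eq (by ring))
  · refine (ae_restrict_mem measurableSet_Ioi).mono fun t (ht : 0 < t) => ?_
    have h1 : Tendsto (fun r : ℝ => r * t) (𝓝[>] 0) (𝓝[>] 0) := by
      refine tendsto_nhdsWithin_iff.2 ⟨?_, eventually_nhdsWithin_of_forall fun r (hr : 0 < r) => by simp only [mem_Ioi]; positivity⟩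
      have : Tendsto (fun r : ℝ => r * t) (𝓝 0) (𝓝 (0 * t)) := tendsto_id.mul_const t
      rw [zero_mul] at this
      exact this.mono_left nhdsWithin_le_nhds
    have h2 := ENNReal.Tendsto.const_mul (a := ofReal ((n + 1) * ((1 + t) ^ (n + 2))⁻¹) * ofReal (t ^ n)) (h0.comp h1)
      (Or.inr (by finiteness))
    rw [mul_zero] at h2
    refine h2.congr' (eventually_nhdsWithin_of_forall fun r (hr : 0 < r) => ?_)
    simp only [Function.comp]
    rw [mul_assoc]; congr 1
    rw [mul_pow, ofReal_mul (by positivity), div_eq_mul_inv, div_eq_mul_inv,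
      ENNReal.mul_inv (Or.inr ofReal_ne_top) (Or.inl ofReal_ne_top), mul_comm, mul_assoc, mul_assoc,
      ENNReal.inv_mul_cancel (by simp; positivity) ofReal_ne_top, mul_one]
end tail

section ke
variable {n : ℕ} {γ : EV n → EW n} {ι : EV n →ₗᵢ[ℝ] EW n} {η : ℝ}
  {K : EW n → ℝ} {C ε : ℝ}

def chi (ρ : ℝ) : ℝ := max 0 (min 1 (ρ - 1))

lemma chi_nonneg (ρ : ℝ) : 0 ≤ chi ρ := le_max_left _ _
lemma chi_le (ρ : ℝ) : chi ρ ≤ 1 := max_le zero_le_one (min_le_left _ _)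
lemma chi_zero {ρ : ℝ} (h : ρ ≤ 1) : chi ρ = 0 := max_eq_left ((min_le_right _ _).trans (by linarith))
lemma chi_one {ρ : ℝ} (h : 2 ≤ ρ) : chi ρ = 1 := by
  unfold chi; rw [min_eq_left (by linarith), max_eq_right zero_le_one]
lemma chi_lip (ρ ρ' : ℝ) : |chi ρ - chi ρ'| ≤ |ρ - ρ'| := by
  unfold chi
  rw [max_comm 0, max_comm 0]
  refine (abs_max_sub_max_le_abs _ _ _).trans ?_
  rw [min_comm 1, min_comm 1]
  refine (abs_min_sub_min_le_max _ _ _ _).trans ?_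
  simp
lemma chi_cont : Continuous chi := by unfold chi; fun_prop

def Ke (K : EW n → ℝ) (ε : ℝ) (w : EW n) : ℝ := K w * chi (‖w‖ / ε)

lemma Ke_le (w) : |Ke K ε w| ≤ |K w| := by
  unfold Ke; rw [abs_mul, abs_of_nonneg (chi_nonneg _)]
  exact mul_le_of_le_one_right (abs_nonneg _) (chi_le _)

lemma Ke_zero (hε : 0 < ε) {w : EW n} (h : ‖w‖ ≤ ε) : Ke K ε w = 0 := by
  unfold Ke; rw [chi_zero ((div_le_one hε).2 h), mul_zero]

lemma Ke_eq (hε : 0 < ε) {w : EW n} (h : 2 * ε ≤ ‖w‖) : Ke K ε w = K w := by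
  unfold Ke; rw [chi_one ((le_div_iff₀ hε).2 h), mul_one]

lemma Ke_bd (hK : CZK n K C) (w) : |Ke K ε w| ≤ C / ‖w‖ ^ n := (Ke_le w).trans (hK.bd w)

lemma Ke_bd2 (hK : CZK n K C) (hε : 0 < ε) (w) : |Ke K ε w| ≤ C / ε ^ n := by
  have := hK.one_le
  by_cases h : ‖w‖ ≤ ε
  · rw [Ke_zero hε h, abs_zero]; positivity
  · refine (Ke_bd hK w).trans ?_
    have := not_le.1 h
    gcongr

lemma Ke_odd (hK : CZK n K C) (w) : Ke K ε (-w) = -Ke K ε w := by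
  unfold Ke; rw [hK.odd, norm_neg, neg_mul]

lemma Ke_scale (hK : CZK n K C) (hε : 0 < ε) (w) : Ke K ε (ε • w) = Ke K 1 w / ε ^ n := by
  unfold Ke
  rw [hK.hom _ _ hε, norm_smul, norm_of_nonneg hε.le, mul_div_cancel_left₀ _ hε.ne', div_one, div_mul_eq_mul_div]

lemma Ke_meas (hK : CZK n K C) : Measurable (Ke K ε) := by
  have := hK.meas
  have := chi_cont.measurable
  unfold Ke; fun_prop

lemma Ke_lip (hK : CZK n K C) (hε : 0 < ε) (x y) (h : ‖x - y‖ ≤ ‖x‖ / 2) :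
    |Ke K ε x - Ke K ε y| ≤ 5 * C * ‖x - y‖ / ‖x‖ ^ (n + 1) := by
  have hC := hK.one_le
  by_cases hx : x = 0
  · subst hx
    have : y = 0 := by simpa using h
    subst this; simp
  have hx0 : 0 < ‖x‖ := norm_pos_iff.2 hx
  have h1 : |K x * (chi (‖x‖ / ε) - chi (‖y‖ / ε))| ≤ 4 * C * ‖x - y‖ / ‖x‖ ^ (n + 1) := by
    by_cases h2 : 2 * ε ≤ ‖x‖ ∧ 2 * ε ≤ ‖y‖
    · rw [chi_one ((le_div_iff₀ hε).2 h2.1), chi_one ((le_div_iff₀ hε).2 h2.2), sub_self, mul_zero, abs_zero]; positivity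
    · have h3 : ‖x‖ ≤ 4 * ε := by
        have := norm_sub_norm_le x y
        by_contra h4
        exact h2 ⟨by linarith, by linarith⟩
      rw [abs_mul]
      have h5 : |chi (‖x‖ / ε) - chi (‖y‖ / ε)| ≤ 4 * ‖x - y‖ / ‖x‖ := by
        refine (chi_lip _ _).trans ?_
        rw [← sub_div, abs_div, abs_of_pos hε, div_le_div_iff₀ hε hx0]
        have := abs_norm_sub_norm_le x y
        nlinarith [norm_nonneg (x - y), abs_nonneg (‖x‖ - ‖y‖)]
      calc |K x| * |chi (‖x‖ / ε) - chi (‖y‖ / ε)| ≤ (C / ‖x‖ ^ n) * (4 * ‖x - y‖ / ‖x‖) := by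
            gcongr; exact hK.bd x
        _ = _ := by rw [pow_succ]; field_simp
  have h6 : |(K x - K y) * chi (‖y‖ / ε)| ≤ C * ‖x - y‖ / ‖x‖ ^ (n + 1) := by
    rw [abs_mul, abs_of_nonneg (chi_nonneg _)]
    exact (mul_le_of_le_one_right (abs_nonneg _) (chi_le _)).trans (hK.lip x y h)
  have : Ke K ε x - Ke K ε y = K x * (chi (‖x‖ / ε) - chi (‖y‖ / ε)) + (K x - K y) * chi (‖y‖ / ε) := by
    unfold Ke; ring
  rw [this]
  refine (abs_add_le _ _).trans ((add_le_add h1 h6).trans (le_of_eq (by ring)))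

lemma Ke_cont (hK : CZK n K C) {w : EW n} (hw : w ≠ 0) : ContinuousAt (Ke K ε) w := by
  unfold Ke
  refine ContinuousAt.mul (hK.cont.continuousAt (isOpen_compl_singleton.mem_nhds hw)) ?_
  exact chi_cont.continuousAt.comp (by fun_prop)

lemma Ke_tendsto {w : EW n} (hw : w ≠ 0) : ∀ᶠ ε in 𝓝[>] (0 : ℝ), Ke K ε w = K w := by
  have : ∀ᶠ ε in 𝓝[>] (0 : ℝ), ε < ‖w‖ / 2 :=
    (eventually_lt_nhds (by have := norm_pos_iff.2 hw; positivity)).filter_mono nhdsWithin_le_nhds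
  filter_upwards [this, self_mem_nhdsWithin] with ε h1 h2
  exact Ke_eq h2 (by linarith)

def tent0 (u : EV n) : ℝ := max 0 (1 - ‖u‖)
lemma tent0_nonneg (u : EV n) : 0 ≤ tent0 u := le_max_left _ _
lemma tent0_le (u : EV n) : tent0 u ≤ 1 := max_le zero_le_one (by linarith [norm_nonneg u])
lemma tent0_zero {u : EV n} (h : 1 ≤ ‖u‖) : tent0 u = 0 := max_eq_left (by linarith)
lemma tent0_lip (u v : EV n) : |tent0 u - tent0 v| ≤ ‖u - v‖ := by
  unfold tent0
  rw [max_comm 0, max_comm 0]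
  refine (abs_max_sub_max_le_abs _ _ _).trans ?_
  rw [sub_sub_sub_cancel_left, norm_sub_rev]
  exact abs_norm_sub_norm_le _ _
lemma tent0_cont : Continuous (tent0 (n := n)) := by unfold tent0; fun_prop
lemma tent0_supp : HasCompactSupport (tent0 (n := n)) :=
  HasCompactSupport.of_support_subset_isCompact (isCompact_closedBall 0 1) fun u hu => by
    by_contra h
    exact hu (tent0_zero (by simp at h; linarith))
lemma tent0_int : Integrable (tent0 (n := n)) := tent0_cont.integrable_of_hasCompactSupport tent0_supp
lemma tent0_pos : 0 < ∫ u : EV n, tent0 u := by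
  refine tent0_cont.integral_pos_of_hasCompactSupport_nonneg_nonzero tent0_supp tent0_nonneg (x := 0) ?_
  simp [tent0]

def cps (n : ℕ) : ℝ := (∫ u : EV n, tent0 u)⁻¹
lemma cps_pos : 0 < cps n := inv_pos.2 tent0_pos
def tent (u : EV n) : ℝ := cps n * tent0 u
lemma tent_nonneg (u : EV n) : 0 ≤ tent u := mul_nonneg cps_pos.le (tent0_nonneg u)
lemma tent_le (u : EV n) : tent u ≤ cps n := mul_le_of_le_one_right cps_pos.le (tent0_le u)
lemma tent_zero {u : EV n} (h : 1 ≤ ‖u‖) : tent u = 0 := by unfold tent; rw [tent0_zero h, mul_zero]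
lemma tent_neg (u : EV n) : tent (-u) = tent u := by unfold tent tent0; rw [norm_neg]
lemma tent_lip (u v : EV n) : |tent u - tent v| ≤ cps n * ‖u - v‖ := by
  unfold tent
  rw [← mul_sub, abs_mul, abs_of_pos cps_pos]
  exact mul_le_mul_of_nonneg_left (tent0_lip u v) cps_pos.le
lemma tent_cont : Continuous (tent (n := n)) := continuous_const.mul tent0_cont
lemma tent_int : Integrable (tent (n := n)) := tent0_int.const_mul _
lemma tent_integral : ∫ u : EV n, tent u = 1 := by
  unfold tent
  rw [integral_const_mul, cps, inv_mul_cancel₀ tent0_pos.ne']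

lemma pk_int : Integrable fun u : EV n => pk n 1 ‖u‖ := by
  have := integrable_one_add_norm (E := EV n) (μ := volume) (r := n + 1) (by simp)
  refine this.congr (ae_of_all _ fun u => ?_)
  simp only [pk]
  rw [Real.rpow_neg (by positivity), one_div]
  norm_cast

lemma loc_int (hn : 1 ≤ n) (R : ℝ) : Integrable fun u : EV n => if ‖u‖ < R then ‖u‖ / ‖u‖ ^ n else 0 := by
  have : Nonempty (Fin n) := ⟨⟨0, hn⟩⟩
  rw [integrable_fun_norm_addHaar volume (f := fun r => if r < R then r / r ^ n else 0)]
  have e : ∀ y ∈ Ioi (0 : ℝ), y ^ (Module.finrank ℝ (EV n) - 1) • (if y < R then y / y ^ n else 0) = (Iio R).indicator (fun _ => (1 : ℝ)) y := by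
    intro y hy
    have hy : 0 < y := hy
    simp only [indicator, mem_Iio, finrank_euclideanSpace, Fintype.card_fin, smul_eq_mul]
    split_ifs with h
    · obtain ⟨m, rfl⟩ : ∃ m, n = m + 1 := ⟨n - 1, by omega⟩
      rw [Nat.add_sub_cancel, pow_succ]; field_simp
    · simp
  rw [integrableOn_congr_fun e measurableSet_Ioi]
  rw [IntegrableOn, integrable_indicator_iff measurableSet_Iio, IntegrableOn, Measure.restrict_restrict measurableSet_Iio]
  refine integrableOn_const ?_
  rw [inter_comm, Ioi_inter_Iio]; simp
end ke

section scale1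
variable {n : ℕ} {γ : EV n → EW n} {ι : EV n →ₗᵢ[ℝ] EW n} {η : ℝ}
  {K : EW n → ℝ} {C δ : ℝ}

def L2 : ℝ := 2 * Real.log 2
lemma L2_pos : 0 < L2 := by unfold L2; have := Real.log_pos one_lt_two; positivity

lemma kt_anti (hK : CZK n K C) (u v : EV n) : kt K γ δ u v = -kt K γ δ v u := by
  unfold kt; rw [← neg_sub, hK.odd, norm_sub_rev, neg_mul]

lemma kt_meas (hK : CZK n K C) (h : Measurable γ) : Measurable fun p : EV n × EV n => kt K γ δ p.2 p.1 := by
  have := hK.meas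
  have := th_meas (δ := δ)
  unfold kt; fun_prop

lemma kt_bd (hK : CZK n K C) (h : NearIso γ ι η) (hδ : 0 < δ) (u v : EV n) :
    |kt K γ δ v u| ≤ C * 2 ^ n * L2 / ‖u - v‖ ^ n := by
  have := hK.one_le
  unfold kt; rw [abs_mul, abs_of_nonneg (th_nonneg hδ _), mul_div_right_comm]
  exact mul_le_mul (K_bd' hK h v u) (th_le hδ _) (th_nonneg hδ _) (by positivity)

lemma kt_bd2 (hK : CZK n K C) (h : NearIso γ ι η) (hδ : 0 < δ) (u v : EV n) :
    |kt K γ δ v u| ≤ C * 2 ^ n * L2 / δ ^ n := by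
  have := hK.one_le
  have := L2_pos
  by_cases hd : ‖u - v‖ ≤ δ
  · unfold kt; rw [th_zero hd, mul_zero, abs_zero]; positivity
  · refine (kt_bd hK h hδ u v).trans ?_
    have := (not_le.1 hd).le
    gcongr

lemma kt_int (hK : CZK n K C) (h : NearIso γ ι η) (hδ : 0 < δ) {a : EV n → ℝ} {b : EV n → ℝ} (ha : Integrable a) (hb : Integrable b) :
    Integrable (fun p : EV n × EV n => a p.1 * b p.2 * kt K γ δ p.2 p.1) (volume.prod volume) := by
  refine (ha.mul_prod hb).mul_bdd (c := C * 2 ^ n * L2 / δ ^ n) ?_ (ae_of_all _ fun p => ?_)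
  · exact (kt_meas hK h.cont.measurable).aestronglyMeasurable
  · exact kt_bd2 hK h hδ _ _

def FA (k : EV n → EV n → ℝ) (q : EV n → ℝ) (p : EV n × EV n) : ℝ :=
  (if 8 ≤ ‖p.1‖ then tent p.2 * k p.2 p.1 else 0) - tent p.2 * (L2 * q p.1)
def FN (k : EV n → EV n → ℝ) (p : EV n × EV n) : ℝ :=
  if ‖p.1‖ < 8 ∧ ‖p.2‖ < 8 then (tent p.2 - tent p.1) / 2 * k p.2 p.1 else 0

lemma FA_meas {k : EV n → EV n → ℝ} {q : EV n → ℝ} (hk : Measurable fun p : EV n × EV n => k p.2 p.1) (hq : Measurable q) :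
    Measurable (FA k q) := by
  have := tent_cont (n := n) |>.measurable
  unfold FA
  refine Measurable.sub (Measurable.ite (measurableSet_le measurable_const (by fun_prop)) (Measurable.mul (by fun_prop) hk) measurable_const) (by fun_prop)

lemma FN_meas {k : EV n → EV n → ℝ} (hk : Measurable fun p : EV n × EV n => k p.2 p.1) :
    Measurable (FN k) := by
  have := tent_cont (n := n) |>.measurable
  unfold FN
  refine Measurable.ite (by measurability) (Measurable.mul (by fun_prop) hk) measurable_const

lemma FA_bd (hK : CZK n K C) (h : NearIso γ ι η) (hδ : 0 < δ) (hδ1 : δ ≤ 1) (p : EV n × EV n) :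
    |FA (kt K γ δ) (fun u => Ke K 1 (γ u - γ 0)) p| ≤ L2 * C * (2 * 9 ^ (n + 1)) * (pk n 1 ‖p.1‖ * tent p.2) := by
  obtain ⟨u, v⟩ := p
  have hC := hK.one_le
  have hL := L2_pos
  have ht := tent_nonneg v
  simp only [FA]
  by_cases hv : 1 ≤ ‖v‖
  · simp [tent_zero hv]
  push Not at hv
  have hp : 0 < (1 + ‖u‖) ^ (n + 1) := by positivity
  split_ifs with hu
  · have h1 : ‖u‖ ≤ 2 * ‖γ u - γ 0‖ := by simpa using h.low u 0
    have h2 : ‖γ v - γ 0‖ ≤ 2 * ‖v‖ := by simpa using h.up v 0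
    rw [Ke_eq one_pos (by linarith), kt, th_eq hδ]
    swap
    · have := norm_sub_norm_le u v; linarith
    have h3 := hK.lip (γ u - γ 0) (γ u - γ v) (by rw [sub_sub_sub_cancel_left]; linarith)
    rw [sub_sub_sub_cancel_left] at h3
    change |tent v * (K (γ u - γ v) * L2) - tent v * (L2 * K (γ u - γ 0))| ≤ _
    rw [show tent v * (K (γ u - γ v) * L2) - tent v * (L2 * K (γ u - γ 0)) = -(L2 * tent v * (K (γ u - γ 0) - K (γ u - γ v))) by ring,
      abs_neg, abs_mul, abs_of_nonneg (by positivity)]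
    have h4 : |K (γ u - γ 0) - K (γ u - γ v)| ≤ C * (2 * 9 ^ (n + 1)) * pk n 1 ‖u‖ := by
      refine h3.trans ?_
      unfold pk
      have h5 : (1 + ‖u‖) / 4 ≤ ‖γ u - γ 0‖ := by linarith
      calc C * ‖γ v - γ 0‖ / ‖γ u - γ 0‖ ^ (n + 1) ≤ C * 2 / ((1 + ‖u‖) / 4) ^ (n + 1) := by
            gcongr; linarith
        _ = C * (2 * 4 ^ (n + 1)) * (1 / (1 + ‖u‖) ^ (n + 1)) := by rw [div_pow]; field_simp
        _ ≤ _ := by gcongr; norm_num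
    calc L2 * tent v * |K (γ u - γ 0) - K (γ u - γ v)| ≤ L2 * tent v * (C * (2 * 9 ^ (n + 1)) * pk n 1 ‖u‖) := by gcongr
      _ = _ := by ring
  · push Not at hu
    rw [zero_sub, abs_neg, abs_mul, abs_mul, abs_of_nonneg ht, abs_of_pos hL]
    have h1 := Ke_bd2 hK one_pos (γ u - γ 0)
    rw [one_pow, div_one] at h1
    have h2 : 1 ≤ 2 * 9 ^ (n + 1) * pk n 1 ‖u‖ := by
      unfold pk
      have : (1 + ‖u‖) ^ (n + 1) ≤ 9 ^ (n + 1) := by gcongr; linarith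
      rw [mul_one_div, le_div_iff₀ hp]
      linarith [pow_pos (show (0 : ℝ) < 9 by norm_num) (n + 1)]
    calc tent v * (L2 * |Ke K 1 (γ u - γ 0)|) ≤ tent v * (L2 * (C * (2 * 9 ^ (n + 1) * pk n 1 ‖u‖))) := by
          gcongr
          exact h1.trans (le_mul_of_one_le_right (by linarith) h2)
      _ = _ := by ring

lemma FN_bd (hK : CZK n K C) (h : NearIso γ ι η) (hδ : 0 < δ) (p : EV n × EV n) :
    |FN (kt K γ δ) p| ≤ cps n * (C * 2 ^ n * L2) * ((if ‖p.2‖ < 8 then 1 else 0) * (if ‖p.1 - p.2‖ < 16 then ‖p.1 - p.2‖ / ‖p.1 - p.2‖ ^ n else 0)) := by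
  obtain ⟨u, v⟩ := p
  have hC := hK.one_le
  have hL := L2_pos
  have hc := cps_pos (n := n)
  simp only [FN]
  by_cases hh : ‖u‖ < 8 ∧ ‖v‖ < 8
  · have h16 : ‖u - v‖ < 16 := (norm_sub_le u v).trans_lt (by linarith)
    rw [if_pos hh, if_pos hh.2, if_pos h16, abs_mul, abs_div, abs_two, one_mul]
    have h1 := tent_lip v u
    rw [norm_sub_rev] at h1
    calc |tent v - tent u| / 2 * |kt K γ δ v u| ≤ cps n * ‖u - v‖ / 1 * (C * 2 ^ n * L2 / ‖u - v‖ ^ n) := by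
          gcongr
          · norm_num
          · exact kt_bd hK h hδ u v
      _ = _ := by ring
  · rw [if_neg hh, abs_zero]
    split_ifs <;> positivity

def Fmaj (n : ℕ) (C : ℝ) (p : EV n × EV n) : ℝ := L2 * C * (2 * 9 ^ (n + 1)) * (pk n 1 ‖p.1‖ * tent p.2) +
  cps n * (C * 2 ^ n * L2) * ((if ‖p.2‖ < 8 then 1 else 0) * (if ‖p.1 - p.2‖ < 16 then ‖p.1 - p.2‖ / ‖p.1 - p.2‖ ^ n else 0))

lemma FAmaj_int : Integrable (fun p : EV n × EV n => pk n 1 ‖p.1‖ * tent p.2) (volume.prod volume) := pk_int.mul_prod tent_int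

lemma FNmaj_int (hn : 1 ≤ n) : Integrable (fun p : EV n × EV n => (if ‖p.2‖ < 8 then (1 : ℝ) else 0) *
    (if ‖p.1 - p.2‖ < 16 then ‖p.1 - p.2‖ / ‖p.1 - p.2‖ ^ n else 0)) (volume.prod volume) := by
  have h1 : Integrable (fun v : EV n => if ‖v‖ < 8 then (1 : ℝ) else 0) := by
    have : (fun v : EV n => if ‖v‖ < 8 then (1 : ℝ) else 0) = (ball 0 8).indicator 1 := by
      funext v; simp [indicator]
    rw [this]
    exact (integrable_indicator_iff measurableSet_ball).2 (integrableOn_const measure_ball_lt_top.ne)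
  exact h1.convolution_integrand (ContinuousLinearMap.mul ℝ ℝ) (loc_int hn 16)

lemma FA_int (hK : CZK n K C) (h : NearIso γ ι η) (hδ : 0 < δ) (hδ1 : δ ≤ 1) :
    Integrable (FA (kt K γ δ) (fun u => Ke K 1 (γ u - γ 0))) (volume.prod volume) :=
  (FAmaj_int.const_mul _).mono' (FA_meas (kt_meas hK h.cont.measurable)
    ((Ke_meas hK).comp (h.cont.measurable.sub_const _))).aestronglyMeasurable (ae_of_all _ (FA_bd hK h hδ hδ1))

lemma FN_int (hK : CZK n K C) (h : NearIso γ ι η) (hδ : 0 < δ) :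
    Integrable (FN (kt K γ δ)) (volume.prod volume) :=
  ((FNmaj_int hK.one_le_n).const_mul _).mono' (FN_meas (kt_meas hK h.cont.measurable)).aestronglyMeasurable
    (ae_of_all _ (FN_bd hK h hδ))

lemma FF_tendsto (hK : CZK n K C) {γj : ℕ → EV n → EW n} (hj : ∀ j, NearIso (γj j) ι η) {δj : ℕ → ℝ} (hδ0 : ∀ j, 0 < δj j)
    (hδ1 : ∀ j, δj j ≤ 1) (hδ : Tendsto δj atTop (𝓝 0)) (h : NearIso γ ι η) (hγ : ∀ u, Tendsto (fun j => γj j u) atTop (𝓝 (γ u)))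
    (hodd : ∀ u, γ (-u) = -γ u) :
    Tendsto (fun j => ∫ p, (FA (kt K (γj j) (δj j)) (fun u => Ke K 1 (γj j u - γj j 0)) p + FN (kt K (γj j) (δj j)) p)
      ∂(volume.prod volume)) atTop (𝓝 0) := by
  set k0 : EV n → EV n → ℝ := fun v u => K (γ u - γ v) * L2
  set q0 : EV n → ℝ := fun u => Ke K 1 (γ u - γ 0)
  have hinj : ∀ u v, u ≠ v → γ u - γ v ≠ 0 := fun u v huv h0 => by
    have := h.low u v
    rw [h0, norm_zero, mul_zero] at this
    exact huv (sub_eq_zero.1 (norm_le_zero_iff.1 this))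
  have hγ0 : γ 0 = 0 := by
    have := hodd 0
    rw [neg_zero, eq_neg_iff_add_eq_zero, ← two_smul ℝ, smul_eq_zero] at this
    exact this.resolve_left two_ne_zero
  have hlim : ∫ p : EV n × EV n, (FA k0 q0 p + FN k0 p) ∂(volume.prod volume) = 0 := by
    haveI : (volume.prod volume : Measure (EV n × EV n)).IsNegInvariant :=
      ⟨((Measure.measurePreserving_neg volume).prod (Measure.measurePreserving_neg volume)).map_eq⟩
    have h1 := integral_neg_eq_self (fun p : EV n × EV n => (FA k0 q0 p + FN k0 p)) (volume.prod volume)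
    have h2 : ∀ p : EV n × EV n, FA k0 q0 (-p) + FN k0 (-p) = -(FA k0 q0 p + FN k0 p) := by
      intro p
      have hk : k0 (-p.2) (-p.1) = -k0 p.2 p.1 := by
        simp only [k0, hodd]; rw [← neg_sub', hK.odd, neg_mul]
      have hq : q0 (-p.1) = -q0 p.1 := by
        simp only [q0, hodd, hγ0, sub_zero, Ke_odd hK]
      simp only [FA, FN, Prod.fst_neg, Prod.snd_neg, norm_neg, tent_neg, hk, hq]
      split_ifs <;> ring
    simp_rw [h2, integral_neg] at h1
    linarith
  rw [← hlim]
  refine tendsto_integral_of_dominated_convergence (Fmaj n C) ?_ ?_ ?_ ?_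
  · intro j
    exact ((FA_meas (kt_meas hK (hj j).cont.measurable) ((Ke_meas hK).comp ((hj j).cont.measurable.sub_const _))).add
      (FN_meas (kt_meas hK (hj j).cont.measurable))).aestronglyMeasurable
  · exact (FAmaj_int.const_mul _).add ((FNmaj_int hK.one_le_n).const_mul _)
  · exact fun j => ae_of_all _ fun p => (norm_add_le _ _).trans
      (add_le_add (FA_bd hK (hj j) (hδ0 j) (hδ1 j) p) (FN_bd hK (hj j) (hδ0 j) p))
  · refine ae_of_all _ fun p => ?_
    have hk : Tendsto (fun j => kt K (γj j) (δj j) p.2 p.1) atTop (𝓝 (k0 p.2 p.1)) := by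
      by_cases hp : p.1 = p.2
      · simp [kt, k0, hp, hK.zero]
      · have h1 : Tendsto (fun j => K (γj j p.1 - γj j p.2)) atTop (𝓝 (K (γ p.1 - γ p.2))) :=
          (hK.cont.continuousAt (isOpen_compl_singleton.mem_nhds (hinj _ _ hp))).tendsto.comp ((hγ _).sub (hγ _))
        refine (h1.mul_const L2).congr' ?_
        have : 0 < ‖p.1 - p.2‖ / 2 := by have := norm_pos_iff.2 (sub_ne_zero.2 hp); positivity
        filter_upwards [hδ.eventually_lt_const this] with j hj'
        unfold kt; rw [th_eq (hδ0 j) (by linarith)]; rfl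
    have hq : Tendsto (fun j => Ke K 1 (γj j p.1 - γj j 0)) atTop (𝓝 (q0 p.1)) := by
      by_cases hp : p.1 = 0
      · simp [q0, hp]
      · exact (Ke_cont hK (hinj _ _ hp)).tendsto.comp ((hγ _).sub (hγ _))
    refine Tendsto.add ?_ ?_
    · simp only [FA]
      refine Tendsto.sub ?_ ((hq.const_mul _).const_mul _)
      split_ifs
      · exact hk.const_mul _
      · exact tendsto_const_nhds
    · simp only [FN]
      split_ifs
      · exact hk.const_mul _
      · exact tendsto_const_nhds
end scale1

section scale1b
variable {n : ℕ} {γ : EV n → EW n} {ι : EV n →ₗᵢ[ℝ] EW n} {η : ℝ}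
  {K : EW n → ℝ} {C δ : ℝ}

lemma Td_meas (hK : CZK n K C) (h : Measurable γ) {g : EV n → ℝ} (hg : Measurable g) : Measurable (Td K γ δ g) := by
  unfold Td
  refine (StronglyMeasurable.integral_prod_right (f := fun (s t : EV n) => kt K γ δ s t * g t) ?_).measurable
  refine Measurable.stronglyMeasurable ?_
  have := hK.meas
  have := th_meas (δ := δ)
  unfold Function.uncurry kt; fun_prop

lemma near_part (hK : CZK n K C) (h : NearIso γ ι η) (hδ : 0 < δ) :
    ∫ p, (if ‖p.1‖ < 8 then tent p.2 * kt K γ δ p.2 p.1 else 0) ∂(volume.prod volume) = ∫ p : EV n × EV n, FN (kt K γ δ) p ∂(volume.prod volume) := by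
  set B : EV n → ℝ := (ball 0 8).indicator 1
  have hB : Integrable B := (integrable_indicator_iff measurableSet_ball).2 (integrableOn_const measure_ball_lt_top.ne)
  have hBe : ∀ u, B u = if ‖u‖ < 8 then 1 else 0 := fun u => by simp [B, indicator]
  have hBt : ∀ u, B u * tent u = tent u := fun u => by
    rw [hBe]; split_ifs with hu
    · rw [one_mul]
    · rw [tent_zero (by linarith), mul_zero]
  have i1 := kt_int (K := K) hK h hδ hB tent_int
  have i2 := kt_int (K := K) hK h hδ tent_int hB
  have e1 : ∀ p : EV n × EV n, (if ‖p.1‖ < 8 then tent p.2 * kt K γ δ p.2 p.1 else 0) = B p.1 * tent p.2 * kt K γ δ p.2 p.1 := by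
    intro p; rw [hBe]; split_ifs <;> ring
  have e2 : ∀ p : EV n × EV n, FN (kt K γ δ) p = 2⁻¹ * (B p.1 * tent p.2 * kt K γ δ p.2 p.1) - 2⁻¹ * (tent p.1 * B p.2 * kt K γ δ p.2 p.1) := by
    intro p
    have t1 : ∀ u : EV n, ¬ ‖u‖ < 8 → tent u = 0 := fun u hu => tent_zero (by linarith)
    simp only [FN]
    rw [hBe, hBe]
    by_cases h1 : ‖p.1‖ < 8 <;> by_cases h2 : ‖p.2‖ < 8
    · rw [if_pos ⟨h1, h2⟩, if_pos h1, if_pos h2]; ring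
    · rw [if_neg (fun h => h2 h.2), if_neg h2, t1 _ h2]; ring
    · rw [if_neg (fun h => h1 h.1), if_neg h1, t1 _ h1]; ring
    · rw [if_neg (fun h => h1 h.1), if_neg h1, t1 _ h1]; ring
  have e3 : ∫ p : EV n × EV n, tent p.1 * B p.2 * kt K γ δ p.2 p.1 ∂(volume.prod volume) = -∫ p : EV n × EV n, B p.1 * tent p.2 * kt K γ δ p.2 p.1 ∂(volume.prod volume) := by
    rw [← integral_prod_swap, ← integral_neg]
    congr 1; funext p
    simp only [Prod.fst_swap, Prod.snd_swap]
    rw [kt_anti hK]; ring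
  simp_rw [e1, e2]
  rw [integral_sub (i1.const_mul _) (i2.const_mul _), integral_const_mul, integral_const_mul, e3]
  ring

theorem scale1 (hK : CZK n K C) : ∃ A : ℝ, 0 ≤ A ∧ ∀ (γ : EV n → EW n) (ι : EV n →ₗᵢ[ℝ] EW n) (η : ℝ)
    (_ : NearIso γ ι η) (δ : ℝ) (_ : 0 < δ) (_ : δ ≤ 1) (R : ℝ) (M : ℝ) (_ : 0 ≤ M)
    (g : EV n → ℝ) (_ : Measurable g) (_ : ∀ s, |g s| ≤ M) (_ : ∀ s ∉ closedBall 0 R, g s = 0) (g0 : ℝ) (_ : |g0| ≤ M),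
    |(∫ v, tent v * Td K γ δ g v) - L2 * (∫ u, Ke K 1 (γ u - γ 0) * g u) - g0 * ∫ p, (FA (kt K γ δ) (fun u => Ke K 1 (γ u - γ 0)) p + FN (kt K γ δ) p)
      ∂(volume.prod volume)| ≤ A * ((∫ u, pk n 1 ‖u‖ * |g u - g0|) + √(M * ∫ u, pk n 1 ‖u‖ * |g u - g0|)) := by
  obtain ⟨A0, hA0, HT⟩ := T_test hK
  have hC := hK.one_le
  have hL := L2_pos
  set V := volume.real (closedBall (0 : EV n) 8)
  set A1 := L2 * C * (2 * 9 ^ (n + 1))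
  set A2 := √(2 * 9 ^ (n + 1) * (cps n ^ 2 * (A0 * V)))
  have hA1 : 0 ≤ A1 := by positivity
  refine ⟨A1 + A2, by positivity, ?_⟩
  intro γ ι η h δ hδ hδ1 R M hM0 g hg hM hs g0 hg0
  set Q := ∫ u, pk n 1 ‖u‖ * |g u - g0|
  have hQ : 0 ≤ Q := integral_nonneg fun u => mul_nonneg (pk_nonneg zero_le_one (norm_nonneg _)) (abs_nonneg _)
  have hgd : ∀ u, |g u - g0| ≤ 2 * M := fun u => (abs_sub _ _).trans (by linarith [hM u])
  have hgi : Integrable g := by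
    have : g = (closedBall 0 R).indicator g := by
      funext u; by_cases hu : u ∈ closedBall (0 : EV n) R
      · rw [indicator_of_mem hu]
      · rw [indicator_of_notMem hu, hs u hu]
    rw [this, integrable_indicator_iff measurableSet_closedBall]
    exact Measure.integrableOn_of_bounded measure_closedBall_lt_top.ne hg.aestronglyMeasurable (ae_of_all _ hM)
  set B : EV n → ℝ := (ball 0 8).indicator 1
  have hB : Integrable B := (integrable_indicator_iff measurableSet_ball).2 (integrableOn_const measure_ball_lt_top.ne)
  have hBm : Measurable B := measurable_one.indicator measurableSet_ball
  have hBe : ∀ u, B u = if ‖u‖ < 8 then 1 else 0 := fun u => by simp [B, indicator]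
  set q : EV n → ℝ := fun u => Ke K 1 (γ u - γ 0)
  have hqm : Measurable q := (Ke_meas hK).comp (h.cont.measurable.sub_const _)
  have hqb : ∀ u, |q u| ≤ C := fun u => by simpa using Ke_bd2 hK one_pos (γ u - γ 0)
  set a : EV n → ℝ := fun u => B u * (g u - g0)
  have ha : Integrable a := hB.mul_bdd (hg.sub_const _).aestronglyMeasurable (ae_of_all _ hgd)
  have iFA := FA_int hK h hδ hδ1
  have iFN := FN_int hK h hδ
  have i1 := kt_int (K := K) hK h hδ hgi tent_int
  have i2 := kt_int (K := K) hK h hδ ha tent_int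
  have i3 : Integrable (fun p : EV n × EV n => FA (kt K γ δ) q p * (g p.1 - g0)) (volume.prod volume) :=
    iFA.mul_bdd ((hg.comp measurable_fst).sub_const _).aestronglyMeasurable (ae_of_all _ fun p => hgd _)
  have i4 : Integrable (fun p : EV n × EV n => (q p.1 * g p.1) * tent p.2) (volume.prod volume) :=
    (Integrable.bdd_mul hgi hqm.aestronglyMeasurable (ae_of_all _ hqb)).mul_prod tent_int
  have i5 := kt_int (K := K) hK h hδ hB tent_int
  have e1 : ∫ v, tent v * Td K γ δ g v = ∫ p : EV n × EV n, g p.1 * tent p.2 * kt K γ δ p.2 p.1 ∂(volume.prod volume) := by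
    rw [integral_prod_symm _ i1]
    congr 1; funext v
    unfold Td
    rw [← integral_const_mul]; congr 1; funext u; ring
  have e2 : ∫ u, q u * g u = ∫ p : EV n × EV n, (q p.1 * g p.1) * tent p.2 ∂(volume.prod volume) := by
    rw [integral_prod_mul (fun u => q u * g u) tent, tent_integral, mul_one]
  have e3 : ∫ p : EV n × EV n, FN (kt K γ δ) p ∂(volume.prod volume) = ∫ p : EV n × EV n, B p.1 * tent p.2 * kt K γ δ p.2 p.1 ∂(volume.prod volume) := by
    rw [← near_part hK h hδ]
    congr 1; funext p; rw [hBe]; split_ifs <;> ring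
  have e4 : (∫ v, tent v * Td K γ δ g v) - L2 * (∫ u, q u * g u) - g0 * ∫ p, (FA (kt K γ δ) q p + FN (kt K γ δ) p) ∂(volume.prod volume)
      = (∫ p : EV n × EV n, FA (kt K γ δ) q p * (g p.1 - g0) ∂(volume.prod volume)) + ∫ p : EV n × EV n, a p.1 * tent p.2 * kt K γ δ p.2 p.1 ∂(volume.prod volume) := by
    rw [integral_add iFA iFN, e3, e1, e2, ← integral_const_mul, mul_add, ← integral_const_mul, ← integral_const_mul, ← integral_add i3 i2,
      ← integral_sub i1 (i4.const_mul _), ← integral_add (iFA.const_mul _) (i5.const_mul _)]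
    refine (integral_sub (i1.sub (i4.const_mul _)) ((iFA.const_mul _).add (i5.const_mul _))).symm.trans ?_
    congr 1; funext p
    simp only [Pi.sub_apply, Pi.add_apply, FA, a, hBe]
    by_cases hu : ‖p.1‖ < 8
    · rw [if_pos hu, if_neg (not_le.2 hu)]; ring
    · rw [if_neg hu, if_pos (not_lt.1 hu)]; ring
  have b1 : |∫ p : EV n × EV n, FA (kt K γ δ) q p * (g p.1 - g0) ∂(volume.prod volume)| ≤ A1 * Q := by
    have : A1 * Q = ∫ p : EV n × EV n, A1 * ((pk n 1 ‖p.1‖ * |g p.1 - g0|) * tent p.2) ∂(volume.prod volume) := by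
      rw [integral_const_mul, integral_prod_mul (fun u => pk n 1 ‖u‖ * |g u - g0|) tent, tent_integral, mul_one]
    rw [this, ← norm_eq_abs]
    refine norm_integral_le_of_norm_le ?_ (ae_of_all _ fun p => ?_)
    · refine Integrable.const_mul (Integrable.mul_prod (f := fun u => pk n 1 ‖u‖ * |g u - g0|) ?_ tent_int) _
      exact pk_int.mul_bdd (hg.sub_const _).abs.aestronglyMeasurable (ae_of_all _ fun u => by
        rw [norm_eq_abs, abs_abs]; exact hgd u)
    · rw [norm_eq_abs, abs_mul]
      calc _ ≤ A1 * (pk n 1 ‖p.1‖ * tent p.2) * |g p.1 - g0| := by gcongr; exact FA_bd hK h hδ hδ1 p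
        _ = _ := by ring
  have b2 : |∫ p : EV n × EV n, a p.1 * tent p.2 * kt K γ δ p.2 p.1 ∂(volume.prod volume)| ≤ A2 * √(M * Q) := by
    rw [integral_prod _ i2, ← Real.sqrt_mul (by positivity)]
    refine Real.le_sqrt_of_sq_le ?_
    have f1 : ∀ u, ∫ v, a u * tent v * kt K γ δ v u = -(cps n * (a u * Td K γ δ tent0 u)) := by
      intro u
      unfold Td
      rw [← integral_const_mul, ← integral_const_mul, ← integral_neg]
      congr 1; funext v
      rw [kt_anti hK]; unfold tent; ring
    simp_rw [f1]
    rw [integral_neg, integral_const_mul, sq_abs, neg_sq, mul_pow]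
    set Y := ∫ u, a u * Td K γ δ tent0 u
    have hY : ofReal (Y ^ 2) ≤ ofReal (2 * M * 9 ^ (n + 1) * Q) * ofReal (A0 * V) := by
      have g1 : ‖Y‖ₑ ≤ ∫⁻ u in closedBall 0 8, ‖a u‖ₑ * ‖Td K γ δ tent0 u‖ₑ := by
        refine (enorm_integral_le_lintegral_enorm _).trans ?_
        rw [← lintegral_indicator measurableSet_closedBall]
        refine lintegral_mono fun u => ?_
        by_cases hu : u ∈ closedBall (0 : EV n) 8
        · rw [indicator_of_mem hu, enorm_mul]
        · have : a u = 0 := by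
            simp only [a, hBe]; rw [if_neg, zero_mul]
            simp at hu; linarith
          simp [this]
      have g2 : ofReal (Y ^ 2) = ‖Y‖ₑ ^ 2 := by
        rw [← ofReal_norm, ← ofReal_pow (norm_nonneg _), norm_eq_abs, sq_abs]
      rw [g2]
      have ham : Measurable a := hBm.mul (hg.sub_const _)
      refine (pow_le_pow_left₀ zero_le g1 2).trans ((lint_cs ham.enorm.aemeasurable
        (Td_meas hK h.cont.measurable tent0_cont.measurable).enorm.aemeasurable).trans (mul_le_mul' ?_ ?_))
      · have : Integrable fun u => 2 * M * 9 ^ (n + 1) * (pk n 1 ‖u‖ * |g u - g0|) := by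
          refine Integrable.const_mul (pk_int.mul_bdd (c := 2 * M) (hg.sub_const _).abs.aestronglyMeasurable (ae_of_all _ fun u => ?_)) _
          rw [norm_eq_abs, abs_abs]; exact hgd u
        rw [← integral_const_mul, ofReal_integral_eq_lintegral_ofReal this (ae_of_all _ fun u => by
          have := pk_nonneg (n := n) zero_le_one (norm_nonneg u)
          simp only [Pi.zero_apply]; positivity)]
        refine (setLIntegral_le_lintegral _ _).trans (lintegral_mono fun u => ?_)
        rw [← ofReal_norm, ← ofReal_pow (norm_nonneg _), norm_eq_abs, sq_abs]
        refine ofReal_le_ofReal ?_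
        have hpk := pk_nonneg (n := n) zero_le_one (norm_nonneg u)
        simp only [a, hBe]
        split_ifs with hu
        · have h2 : 1 ≤ 9 ^ (n + 1) * pk n 1 ‖u‖ := by
            unfold pk
            rw [mul_one_div, le_div_iff₀ (by positivity), one_mul]
            gcongr; linarith
          rw [one_mul, ← sq_abs, sq]
          calc |g u - g0| * |g u - g0| ≤ 2 * M * |g u - g0| := by gcongr; exact hgd u
            _ ≤ 2 * M * |g u - g0| * (9 ^ (n + 1) * pk n 1 ‖u‖) := le_mul_of_one_le_right (by positivity) h2
            _ = _ := by ring
        · rw [zero_mul]; norm_num; positivity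
      · refine HT γ ι η h δ hδ 0 8 (by norm_num) tent0 tent0_cont.measurable (fun s => ?_) (fun s hs => ?_)
        · rw [abs_of_nonneg (tent0_nonneg s)]; exact tent0_le s
        · refine tent0_zero ?_
          simp at hs; linarith
    rw [← ofReal_mul (by positivity), ofReal_le_ofReal_iff (by positivity)] at hY
    calc cps n ^ 2 * Y ^ 2 ≤ cps n ^ 2 * (2 * M * 9 ^ (n + 1) * Q * (A0 * V)) := by gcongr
      _ = _ := by ring
  rw [e4]
  refine (abs_add_le _ _).trans ((add_le_add b1 b2).trans ?_)
  have := Real.sqrt_nonneg (M * Q)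
  have : 0 ≤ A2 := Real.sqrt_nonneg _
  nlinarith [mul_nonneg hA1 (Real.sqrt_nonneg (M * Q)), mul_nonneg this hQ]
end scale1b

lemma weak_lim {X : Type*} [MeasurableSpace X] (μ : Measure X) [IsFiniteMeasure μ] (u : ℝ → X → ℝ)
    (hu : ∀ δ, Measurable (u δ)) (B : ℝ≥0∞) (hB : B ≠ ∞) (hb : ∀ δ > 0, ∫⁻ x, ‖u δ x‖ₑ ^ 2 ∂μ ≤ B) :
    ∃ h : X → ℝ, Integrable h μ ∧ ∀ ψ : X → ℝ, Measurable ψ → (∃ c, ∀ x, |ψ x| ≤ c) → ∀ ρ > 0, ∀ κ > 0,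
      ∃ δ, 0 < δ ∧ δ < ρ ∧ |(∫ x, ψ x * u δ x ∂μ) - ∫ x, ψ x * h x ∂μ| < κ := by
  have e2 : ∀ δ, eLpNorm (u δ) 2 μ = (∫⁻ x, ‖u δ x‖ₑ ^ 2 ∂μ) ^ (1 / 2 : ℝ) := fun δ => by
    rw [eLpNorm_eq_lintegral_rpow_enorm_toReal (by norm_num) (by norm_num)]
    norm_num
  have hbd : ∀ δ > 0, eLpNorm (u δ) 2 μ ≤ B ^ (1 / 2 : ℝ) := fun δ hδ => by
    rw [e2]; exact ENNReal.rpow_le_rpow (hb δ hδ) (by norm_num)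
  have hBt : B ^ (1 / 2 : ℝ) < ∞ := ENNReal.rpow_lt_top_of_nonneg (by norm_num) hB
  have hm : ∀ δ > 0, MemLp (u δ) 2 μ := fun δ hδ => ⟨(hu δ).aestronglyMeasurable, (hbd δ hδ).trans_lt hBt⟩
  classical
  set w : ℝ → WeakDual ℝ (Lp ℝ 2 μ) := fun δ => if hδ : 0 < δ then
    StrongDual.toWeakDual (InnerProductSpace.toDual ℝ (Lp ℝ 2 μ) ((hm δ hδ).toLp (u δ))) else 0
  set U := Ultrafilter.of (𝓝[>] (0 : ℝ))
  have hU : ∀ᶠ δ in (U : Filter ℝ), 0 < δ := (Ultrafilter.of_le _) self_mem_nhdsWithin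
  obtain ⟨L, -, hL⟩ := (WeakDual.isCompact_closedBall (𝕜 := ℝ) (E := Lp ℝ 2 μ) 0 (B ^ (1 / 2 : ℝ)).toReal).ultrafilter_le_nhds
    (U.map w) (by
      rw [le_principal_iff]
      change ∀ᶠ δ in (U : Filter ℝ), _
      filter_upwards [hU] with δ hδ
      simp only [w, dif_pos hδ]
      simp only [Set.mem_preimage, mem_closedBall, dist_zero_right]
      change ‖InnerProductSpace.toDual ℝ (Lp ℝ 2 μ) ((hm δ hδ).toLp (u δ))‖ ≤ _
      rw [LinearIsometryEquiv.norm_map, Lp.norm_toLp]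
      exact ENNReal.toReal_mono hBt.ne (hbd δ hδ))
  set h : Lp ℝ 2 μ := (InnerProductSpace.toDual ℝ (Lp ℝ 2 μ)).symm (WeakDual.toStrongDual L)
  have hev : ∀ v : Lp ℝ 2 μ, Tendsto (fun δ => w δ v) U (𝓝 (L v)) := fun v =>
    ((WeakDual.eval_continuous v).tendsto L).comp (show Tendsto w U (𝓝 L) from hL)
  refine ⟨h, (Lp.memLp h).integrable (by norm_num), ?_⟩
  rintro ψ hψ ⟨c, hc⟩ ρ hρ κ hκ
  have hψm : MemLp ψ 2 μ := MemLp.of_bound hψ.aestronglyMeasurable c (ae_of_all _ hc)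
  have h1 := hev (hψm.toLp ψ)
  rw [Metric.tendsto_nhds] at h1
  have h2 : ∀ᶠ δ in (U : Filter ℝ), δ < ρ := (Ultrafilter.of_le _) (mem_nhdsWithin_of_mem_nhds (Iio_mem_nhds hρ))
  obtain ⟨δ, ⟨d1, d2⟩, d3⟩ := ((h1 κ hκ).and h2 |>.and hU).exists
  refine ⟨δ, d3, d2, ?_⟩
  have f1 : w δ (hψm.toLp ψ) = ∫ x, ψ x * u δ x ∂μ := by
    simp only [w, dif_pos d3]
    change inner ℝ ((hm δ d3).toLp (u δ)) (hψm.toLp ψ) = _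
    rw [L2.inner_def]
    refine integral_congr_ae ?_
    filter_upwards [(hm δ d3).coeFn_toLp, hψm.coeFn_toLp] with x x1 x2
    rw [x1, x2]; rfl
  have f2 : L (hψm.toLp ψ) = ∫ x, ψ x * h x ∂μ := by
    have : L (hψm.toLp ψ) = inner ℝ h (hψm.toLp ψ) := by
      rw [← InnerProductSpace.toDual_apply_apply, LinearIsometryEquiv.apply_symm_apply]; rfl
    rw [this, L2.inner_def]
    refine integral_congr_ae ?_
    filter_upwards [hψm.coeFn_toLp] with x x2
    rw [x2]; rfl
  rw [f1, f2] at d1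
  exact d1

lemma leb_pt {k n : ℕ} (τ : Measure (EV k)) [IsLocallyFiniteMeasure τ] {A : ℝ}
    (hA : ∀ x, ∀ r > 0, τ (closedBall x r) ≤ ofReal (A * r ^ n)) (ρ : Measure (EV k)) (x : EV k)
    (h : Tendsto (fun r => ρ (closedBall x r) / τ (closedBall x r)) (𝓝[>] 0) (𝓝 0)) (hac : ∀ r > 0, τ (closedBall x r) = 0 → ρ (closedBall x r) = 0) :
    Tendsto (fun r => ρ (closedBall x r) / ofReal (r ^ n)) (𝓝[>] 0) (𝓝 0) := by
  have h2 : Tendsto (fun r => ρ (closedBall x r) / τ (closedBall x r) * ofReal A) (𝓝[>] 0) (𝓝 0) := by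
    simpa using ENNReal.Tendsto.mul_const h (Or.inr ofReal_ne_top)
  refine tendsto_of_tendsto_of_tendsto_of_le_of_le' tendsto_const_nhds h2 (Eventually.of_forall fun _ => zero_le) ?_
  filter_upwards [self_mem_nhdsWithin] with r hr
  have hr0 : (0 : ℝ) < r := hr
  by_cases h0 : τ (closedBall x r) = 0
  · rw [hac r hr0 h0, ENNReal.zero_div]; exact zero_le
  have ht : τ (closedBall x r) ≠ ∞ := ((hA x r hr0).trans_lt ofReal_lt_top).ne
  have hrn : ofReal (r ^ n) ≠ 0 := by simp; positivity
  refine ENNReal.div_le_of_le_mul ?_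
  calc ρ (closedBall x r) = ρ (closedBall x r) / τ (closedBall x r) * τ (closedBall x r) := (ENNReal.div_mul_cancel h0 ht).symm
    _ ≤ ρ (closedBall x r) / τ (closedBall x r) * (ofReal A * ofReal (r ^ n)) := by
      gcongr
      rw [← ofReal_mul' (by positivity)]; exact hA x r hr0
    _ = _ := by ring

lemma leb_pt_fun {k n : ℕ} (τ : Measure (EV k)) [IsLocallyFiniteMeasure τ] {A : ℝ}
    (hA : ∀ x, ∀ r > 0, τ (closedBall x r) ≤ ofReal (A * r ^ n)) {g : EV k → ℝ} (hg : LocallyIntegrable g τ) :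
    ∀ᵐ x ∂τ, Tendsto (fun r => (∫⁻ t in closedBall x r, ‖g t - g x‖ₑ ∂τ) / ofReal (r ^ n)) (𝓝[>] 0) (𝓝 0) := by
  filter_upwards [(Besicovitch.vitaliFamily τ).ae_tendsto_lintegral_enorm_sub_div hg] with x hx
  have e : ∀ r, (∫⁻ t in closedBall x r, ‖g t - g x‖ₑ ∂τ) = τ.withDensity (fun t => ‖g t - g x‖ₑ) (closedBall x r) := fun r =>
    (withDensity_apply _ measurableSet_closedBall).symm
  have := leb_pt τ hA (τ.withDensity (fun t => ‖g t - g x‖ₑ)) x (by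
    have := hx.comp (Besicovitch.tendsto_filterAt τ x)
    simp only [Function.comp_def, e] at this
    exact this) (fun r _ hr => withDensity_absolutelyContinuous _ _ hr)
  simp_rw [e]; exact this

section aff
variable {n : ℕ}

def bn (n : ℕ) : ℝ := volume.real (ball (0 : EV n) 1)
lemma vol_ball_eq (x : EV n) {r : ℝ} (hr : 0 < r) : volume (closedBall x r) = ofReal (bn n * r ^ n) := by
  rw [Measure.addHaar_closedBall _ _ hr.le, bn, mul_comm, ofReal_mul (by positivity), measureReal_def, ofReal_toReal measure_ball_lt_top.ne]
  simp

lemma int_aff (F : EV n → ℝ) (s : EV n) {ε : ℝ} (hε : 0 < ε) : ∫ u, F (s + ε • u) = (ε ^ n)⁻¹ * ∫ t, F t := by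
  rw [Measure.integral_comp_smul volume (fun u => F (s + u)), integral_add_left_eq_self]
  simp [abs_of_pos hε]

lemma th_scale {δ ρ ε : ℝ} (hε : 0 < ε) : th (δ / ε) ρ = th δ (ε * ρ) := by
  unfold th
  have : ρ / max (δ / ε) (ρ / 2) = ε * ρ / max δ (ε * ρ / 2) := by
    have : max δ (ε * ρ / 2) = ε * max (δ / ε) (ρ / 2) := by
      rw [mul_max_of_nonneg _ _ hε.le]; congr 1 <;> field_simp
    rw [this, mul_div_mul_left _ _ hε.ne']
  rw [this]; simp only [div_lt_iff₀ hε, mul_comm ρ ε]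
end aff

section pv
variable {n : ℕ} {γ : EV n → EW n} {ι : EV n →ₗᵢ[ℝ] EW n} {η : ℝ}
  {K : EW n → ℝ} {C δ : ℝ}

def gsc (γ : EV n → EW n) (s : EV n) (ε : ℝ) (u : EV n) : EW n := ε⁻¹ • (γ (s + ε • u) - γ s)

lemma gsc_near (h : NearIso γ ι η) (s : EV n) {ε : ℝ} (hε : 0 < ε) : NearIso (gsc γ s ε) ι η := by
  refine ⟨h.le, fun u v => ?_⟩
  have h1 := h.near (s + ε • u) (s + ε • v)
  rw [add_sub_add_left_eq_sub, ← smul_sub, map_smul, norm_smul, norm_of_nonneg hε.le] at h1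
  have : gsc γ s ε u - gsc γ s ε v - ι (u - v) = ε⁻¹ • (γ (s + ε • u) - γ (s + ε • v) - ε • ι (u - v)) := by
    rw [smul_sub, smul_smul, inv_mul_cancel₀ hε.ne', one_smul, gsc, gsc, ← smul_sub, sub_sub_sub_cancel_right]
  rw [this, norm_smul, norm_inv, norm_of_nonneg hε.le, inv_mul_le_iff₀ hε]
  linarith

lemma gsc_lim {s : EV n} (hd : DifferentiableAt ℝ γ s) (u : EV n) :
    Tendsto (fun ε => gsc γ s ε u) (𝓝[>] 0) (𝓝 (fderiv ℝ γ s u)) := by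
  have := hd.hasFDerivAt.lim u (c := fun ε : ℝ => ε⁻¹) (l := 𝓝[>] 0)
    (tendsto_norm_atTop_atTop.comp tendsto_inv_nhdsGT_zero)
  simpa [gsc] using this

lemma fderiv_near (h : NearIso γ ι η) {s : EV n} (hd : DifferentiableAt ℝ γ s) : NearIso (fderiv ℝ γ s) ι η := by
  refine ⟨h.le, fun u v => ?_⟩
  refine le_of_tendsto (((gsc_lim hd u).sub (gsc_lim hd v)).sub_const (ι (u - v))).norm ?_
  filter_upwards [self_mem_nhdsWithin] with ε hε
  exact (gsc_near h s hε).near u v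

lemma gsc_sub (s u v : EV n) {ε : ℝ} (hε : 0 < ε) : γ (s + ε • u) - γ (s + ε • v) = ε • (gsc γ s ε u - gsc γ s ε v) := by
  rw [gsc, gsc, ← smul_sub, smul_smul, mul_inv_cancel₀ hε.ne', one_smul, sub_sub_sub_cancel_right]

lemma gsc_zero (s : EV n) {ε : ℝ} : gsc γ s ε 0 = 0 := by simp [gsc]

lemma kt_scale (hK : CZK n K C) (s u v : EV n) {ε : ℝ} (hε : 0 < ε) :
    kt K (gsc γ s ε) (δ / ε) v u = ε ^ n * kt K γ δ (s + ε • v) (s + ε • u) := by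
  unfold kt
  rw [gsc_sub s u v hε, hK.hom _ _ hε, th_scale hε, add_sub_add_left_eq_sub, ← smul_sub, norm_smul, norm_of_nonneg hε.le]
  field_simp

lemma Td_scale (hK : CZK n K C) (s v : EV n) {ε : ℝ} (hε : 0 < ε) (g : EV n → ℝ) :
    Td K (gsc γ s ε) (δ / ε) (fun u => g (s + ε • u)) v = Td K γ δ g (s + ε • v) := by
  unfold Td
  simp_rw [kt_scale hK s _ v hε, mul_assoc]
  rw [integral_const_mul, int_aff (fun t => kt K γ δ (s + ε • v) t * g t) s hε, mul_inv_cancel_left₀ (by positivity)]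

lemma Ke_int_scale (hK : CZK n K C) (s : EV n) {ε : ℝ} (hε : 0 < ε) (g : EV n → ℝ) :
    ∫ u, Ke K 1 (gsc γ s ε u - gsc γ s ε 0) * g (s + ε • u) = ∫ t, Ke K ε (γ t - γ s) * g t := by
  have e : ∀ u, Ke K 1 (gsc γ s ε u - gsc γ s ε 0) * g (s + ε • u) = ε ^ n * (Ke K ε (γ (s + ε • u) - γ s) * g (s + ε • u)) := by
    intro u
    have := gsc_sub (γ := γ) s u 0 hε
    rw [smul_zero, add_zero] at this
    rw [this, Ke_scale hK hε]; field_simp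
  simp_rw [e]
  rw [integral_const_mul, int_aff (fun t => Ke K ε (γ t - γ s) * g t) s hε, mul_inv_cancel_left₀ (by positivity)]

/-- Lebesgue points -/
def LebP (g : EV n → ℝ) (s : EV n) : Prop :=
  Tendsto (fun r => (∫⁻ t in closedBall s r, ‖g t - g s‖ₑ) / ofReal (r ^ n)) (𝓝[>] 0) (𝓝 0)

lemma ae_LebP {g : EV n → ℝ} (hg : LocallyIntegrable g) : ∀ᵐ s, LebP g s :=
  leb_pt_fun volume (fun x _ hr => (vol_ball_eq x hr).le) hg

lemma pk_int_scale (s : EV n) {ε : ℝ} (hε : 0 < ε) (g : EV n → ℝ) (g0 : ℝ) :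
    ∫ u, pk n 1 ‖u‖ * |g (s + ε • u) - g0| = ∫ t, pk n ε (dist t s) * |g t - g0| := by
  have e : ∀ u, pk n 1 ‖u‖ * |g (s + ε • u) - g0| = ε ^ n * (pk n ε (dist (s + ε • u) s) * |g (s + ε • u) - g0|) := by
    intro u
    rw [dist_eq_norm, add_sub_cancel_left, norm_smul, norm_of_nonneg hε.le, pk_scale hε]; field_simp
  simp_rw [e]
  rw [integral_const_mul, int_aff (fun t => pk n ε (dist t s) * |g t - g0|) s hε, mul_inv_cancel_left₀ (by positivity)]

lemma Q_tendsto {g : EV n → ℝ} (hg : Measurable g) {M : ℝ} (hM : ∀ s, |g s| ≤ M) {s : EV n} (hs : LebP g s) :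
    Tendsto (fun ε => ∫ t, pk n ε (dist t s) * |g t - g s|) (𝓝[>] 0) (𝓝 0) := by
  have hM0 : 0 ≤ M := (abs_nonneg _).trans (hM s)
  set ρ := (volume : Measure (EV n)).withDensity fun t => ‖g t - g s‖ₑ
  have hρ : ∀ r, ρ (closedBall s r) = ∫⁻ t in closedBall s r, ‖g t - g s‖ₑ := fun r => withDensity_apply _ measurableSet_closedBall
  have hm : Measurable fun t => ‖g t - g s‖ₑ := (hg.sub_const _).enorm
  have h1 := tail_lemma ρ s n (2 * M * bn n) (by unfold bn; positivity) (fun r hr => by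
    rw [hρ]
    calc _ ≤ ∫⁻ t in closedBall s r, ofReal (2 * M) := by
          refine lintegral_mono fun t => ?_
          rw [← ofReal_norm]
          exact ofReal_le_ofReal ((abs_sub _ _).trans (by linarith [hM t, hM s]))
      _ = _ := by
          rw [setLIntegral_const, vol_ball_eq s hr, ← ofReal_mul (by positivity), mul_assoc (2 * M)]) (by simp_rw [hρ]; exact hs)
  have h2 := (ENNReal.tendsto_toReal ENNReal.zero_ne_top).comp h1
  refine (tendsto_congr' ?_).2 h2
  filter_upwards [self_mem_nhdsWithin] with ε hε
  have hε0 : (0 : ℝ) < ε := hε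
  have hpm : Measurable fun t => pk n ε (dist t s) := pk_meas.comp (measurable_const.prodMk (measurable_id.dist measurable_const))
  rw [Function.comp_apply, lintegral_withDensity_eq_lintegral_mul _ hm hpm.ennreal_ofReal,
    integral_eq_lintegral_of_nonneg_ae (ae_of_all _ fun t => mul_nonneg (pk_nonneg hε0.le dist_nonneg) (abs_nonneg _))
    (hpm.mul (hg.sub_const _).abs).aestronglyMeasurable]
  congr 1
  refine lintegral_congr fun t => ?_
  simp only [Pi.mul_apply]
  rw [ofReal_mul (pk_nonneg hε0.le dist_nonneg), mul_comm, ← ofReal_norm, norm_eq_abs]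

lemma psi_tendsto {h : EV n → ℝ} (hi : Integrable h) {s : EV n} (hs : LebP h s) :
    Tendsto (fun ε : ℝ => ∫ u, tent u * h (s + ε • u)) (𝓝[>] 0) (𝓝 (h s)) := by
  have hs' := ENNReal.Tendsto.const_mul (a := ofReal (cps n)) hs (Or.inr ofReal_ne_top)
  rw [mul_zero] at hs'
  rw [tendsto_iff_edist_tendsto_0]
  refine tendsto_of_tendsto_of_tendsto_of_le_of_le' tendsto_const_nhds hs' (Eventually.of_forall fun _ => zero_le) ?_
  filter_upwards [self_mem_nhdsWithin] with ε hε
  have hε0 : (0 : ℝ) < ε := hε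
  have hi2 : Integrable fun u => h (s + ε • u) := by
    have := (integrable_comp_smul_iff volume (fun u => h (s + u)) hε0.ne').2 (hi.comp_add_left s)
    exact this
  have e : (∫ u, tent u * h (s + ε • u)) - h s = (ε ^ n)⁻¹ * ∫ t, tent (ε⁻¹ • (t - s)) * (h t - h s) := by
    rw [← int_aff (fun t => tent (ε⁻¹ • (t - s)) * (h t - h s)) s hε0]
    simp_rw [add_sub_cancel_left, smul_smul, inv_mul_cancel₀ hε0.ne', one_smul, mul_sub]
    rw [integral_sub, integral_mul_const, tent_integral, one_mul]
    · exact hi2.bdd_mul tent_cont.aestronglyMeasurable (c := cps n) (ae_of_all _ fun u => by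
        rw [norm_of_nonneg (tent_nonneg _)]; exact tent_le u)
    · exact tent_int.mul_const _
  rw [edist_eq_enorm_sub, e, enorm_mul, ENNReal.div_eq_inv_mul, ← mul_assoc, mul_comm (ofReal (cps n)), mul_assoc]
  have e1 : ‖(ε ^ n)⁻¹‖ₑ = (ofReal (ε ^ n))⁻¹ := by
    rw [← ofReal_norm, norm_of_nonneg (by positivity), ofReal_inv_of_pos (by positivity)]
  rw [e1]
  gcongr
  refine (enorm_integral_le_lintegral_enorm _).trans ?_
  rw [← lintegral_const_mul' _ _ ofReal_ne_top, ← lintegral_indicator measurableSet_closedBall]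
  refine lintegral_mono fun t => ?_
  by_cases ht : t ∈ closedBall s ε
  · rw [indicator_of_mem ht, enorm_mul]
    gcongr
    rw [← ofReal_norm, norm_of_nonneg (tent_nonneg _)]
    exact ofReal_le_ofReal (tent_le _)
  · rw [indicator_of_notMem ht, tent_zero, zero_mul, enorm_zero]
    rw [norm_smul, norm_inv, norm_of_nonneg hε0.le, ← dist_eq_norm, inv_mul_eq_div, one_le_div hε0]
    exact (not_le.1 ht).le

lemma pv_pt (hK : CZK n K C) (h : NearIso γ ι η) {g : EV n → ℝ} (hg : Measurable g) {M : ℝ} (hM : ∀ s, |g s| ≤ M)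
    {R : ℝ} (hR : ∀ s ∉ closedBall 0 R, g s = 0) {H : EV n → ℝ} (hH : Integrable H) {s : EV n}
    (hd : DifferentiableAt ℝ γ s) (l1 : LebP g s) (l2 : LebP H s)
    (hw : ∀ ψ : EV n → ℝ, Measurable ψ → (∃ c, ∀ x, |ψ x| ≤ c) → (∀ x ∉ closedBall s 1, ψ x = 0) → ∀ ρ > 0, ∀ κ > 0,
      ∃ δ, 0 < δ ∧ δ < ρ ∧ |(∫ x, ψ x * Td K γ δ g x) - ∫ x, ψ x * H x| < κ) :
    Tendsto (fun ε => ∫ t, Ke K ε (γ t - γ s) * g t) (𝓝[>] 0) (𝓝 (H s / L2)) := by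
  have hM0 : 0 ≤ M := (abs_nonneg _).trans (hM s)
  obtain ⟨A, hA, HS⟩ := scale1 hK
  refine tendsto_of_seq_tendsto fun e0 he0 => ?_
  have hev : ∀ᶠ j in atTop, 0 < e0 j ∧ e0 j ≤ 1 := by
    have := he0 (Ioc_mem_nhdsGT (zero_lt_one' ℝ))
    exact this
  obtain ⟨J, hJ⟩ := eventually_atTop.1 hev
  rw [← tendsto_add_atTop_iff_nat J]
  have he := (tendsto_add_atTop_iff_nat J).2 he0
  have hp : ∀ j, 0 < e0 (j + J) ∧ e0 (j + J) ≤ 1 := fun j => hJ _ (Nat.le_add_left _ _)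
  set e : ℕ → ℝ := fun j => e0 (j + J) with hedef
  change Tendsto (fun j => ∫ t, Ke K (e j) (γ t - γ s) * g t) atTop _
  change Tendsto e atTop _ at he
  have hp0 : ∀ j, 0 < e j := fun j => (hp j).1
  set ψ : ℕ → EV n → ℝ := fun j t => (e j ^ n)⁻¹ * tent ((e j)⁻¹ • (t - s))
  have hψi : ∀ j (F : EV n → ℝ), ∫ t, ψ j t * F t = ∫ u, tent u * F (s + e j • u) := by
    intro j F
    have := int_aff (fun t => tent ((e j)⁻¹ • (t - s)) * F t) s (hp0 j)
    simp_rw [add_sub_cancel_left, smul_smul, inv_mul_cancel₀ (hp0 j).ne', one_smul] at this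
    rw [this, ← integral_const_mul]
    simp only [ψ, mul_assoc]
  have hch : ∀ j : ℕ, ∃ δ, 0 < δ ∧ δ < e j / (j + 1) ∧ |(∫ x, ψ j x * Td K γ δ g x) - ∫ x, ψ j x * H x| < 1 / ((j : ℝ) + 1) := by
    intro j
    have := hp0 j
    refine hw (ψ j) ?_ ⟨(e j ^ n)⁻¹ * cps n, fun x => ?_⟩ (fun x hx => ?_) _ (by positivity) _ (by positivity)
    · have := tent_cont (n := n)
      exact Continuous.measurable (by simp only [ψ]; fun_prop)
    · simp only [ψ]
      rw [abs_of_nonneg (mul_nonneg (by positivity) (tent_nonneg _))]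
      gcongr; exact tent_le _
    · simp only [ψ]
      rw [tent_zero, mul_zero]
      rw [norm_smul, norm_inv, norm_of_nonneg this.le, ← dist_eq_norm, inv_mul_eq_div, one_le_div this]
      exact (hp j).2.trans (not_le.1 hx).le
  choose δ hδ0 hδ1 hδ2 using hch
  set d : ℕ → ℝ := fun j => δ j / e j
  have hd0 : ∀ j, 0 < d j := fun j => div_pos (hδ0 j) (hp0 j)
  have hd1' : ∀ j, d j < 1 / ((j : ℝ) + 1) := fun j => by
    rw [div_lt_iff₀ (hp0 j)]; refine (hδ1 j).trans_eq ?_; ring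
  have hd1 : ∀ j, d j ≤ 1 := fun j => (hd1' j).le.trans (by
    rw [div_le_one (by positivity)]; linarith [Nat.cast_nonneg (α := ℝ) j])
  have h1j : Tendsto (fun j : ℕ => 1 / ((j : ℝ) + 1)) atTop (𝓝 0) := tendsto_one_div_add_atTop_nhds_zero_nat
  have hdl : Tendsto d atTop (𝓝 0) := squeeze_zero (fun j => (hd0 j).le) (fun j => (hd1' j).le) h1j
  have hFF := FF_tendsto hK (fun j => gsc_near h s (hp0 j)) hd0 hd1 hdl (fderiv_near h hd)
    (fun u => (gsc_lim hd u).comp he) (fun u => map_neg _ _)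
  have hQ := (Q_tendsto hg hM l1).comp he
  have hP := (psi_tendsto hH l2).comp he
  simp only [Function.comp_def] at hQ hP
  set FF : ℕ → ℝ := _
  change Tendsto FF atTop _ at hFF
  set Q : ℕ → ℝ := fun j => ∫ t, pk n (e j) (dist t s) * |g t - g s|
  set P : ℕ → ℝ := fun j => ∫ u, tent u * H (s + e j • u)
  set T : ℕ → ℝ := fun j => ∫ t, Ke K (e j) (γ t - γ s) * g t
  have key : ∀ j, |P j - L2 * T j - g s * FF j| ≤ A * (Q j + √(M * Q j)) + 1 / ((j : ℝ) + 1) := by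
    intro j
    have k1 := HS (gsc γ s (e j)) ι η (gsc_near h s (hp0 j)) (d j) (hd0 j) (hd1 j) ((R + ‖s‖) / e j) M hM0 (fun u => g (s + e j • u))
      (hg.comp (by fun_prop)) (fun u => hM _) (fun u hu => hR _ (by
        simp only [mem_closedBall, dist_zero_right, not_le] at hu ⊢
        rw [div_lt_iff₀ (hp0 j)] at hu
        have := norm_sub_norm_le (e j • u) (-s)
        rw [norm_neg, sub_neg_eq_add, norm_smul, norm_of_nonneg (hp0 j).le, add_comm _ s] at this
        linarith)) (g s) (hM s)
    simp only [d] at k1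
    rw [Ke_int_scale hK s (hp0 j), pk_int_scale s (hp0 j)] at k1
    simp_rw [Td_scale hK s _ (hp0 j)] at k1
    rw [← hψi j (Td K γ (δ j) g)] at k1
    have k2 := hδ2 j
    rw [hψi j H] at k2
    have k3 := abs_sub_comm (∫ x, ψ j x * Td K γ (δ j) g x) (P j)
    have k4 := abs_add_le (P j - ∫ x, ψ j x * Td K γ (δ j) g x) ((∫ x, ψ j x * Td K γ (δ j) g x) - L2 * T j - g s * FF j)
    rw [show (P j - ∫ x, ψ j x * Td K γ (δ j) g x) + ((∫ x, ψ j x * Td K γ (δ j) g x) - L2 * T j - g s * FF j) = P j - L2 * T j - g s * FF j by ring] at k4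
    refine k4.trans ?_
    rw [← k3, add_comm]
    exact add_le_add k1 k2.le
  have hr : Tendsto (fun j : ℕ => A * (Q j + √(M * Q j)) + 1 / ((j : ℝ) + 1)) atTop (𝓝 0) := by
    have := ((hQ.add ((hQ.const_mul M).sqrt)).const_mul A).add h1j
    simpa using this
  have h0 : Tendsto (fun j => P j - L2 * T j - g s * FF j) atTop (𝓝 0) := squeeze_zero_norm key hr
  have h3 := ((hP.sub h0).sub (hFF.const_mul (g s))).div_const L2
  rw [mul_zero, sub_zero, sub_zero] at h3
  refine h3.congr fun j => ?_
  have := L2_pos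
  field_simp; ring

theorem pv_bdd (hK : CZK n K C) (h : NearIso γ ι η) {g : EV n → ℝ} (hg : Measurable g) {M : ℝ} (hM : ∀ s, |g s| ≤ M)
    {R : ℝ} (hR : ∀ s ∉ closedBall 0 R, g s = 0) :
    ∀ᵐ s, ∃ l, Tendsto (fun ε => ∫ t, Ke K ε (γ t - γ s) * g t) (𝓝[>] 0) (𝓝 l) := by
  have hM0 : 0 ≤ M := (abs_nonneg _).trans (hM 0)
  obtain ⟨A, hA, HT⟩ := T_test hK
  have hgl : LocallyIntegrable g := by
    refine fun x => ⟨closedBall x 1, closedBall_mem_nhds x one_pos, ?_⟩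
    exact Measure.integrableOn_of_bounded measure_closedBall_lt_top.ne hg.aestronglyMeasurable (ae_of_all _ hM)
  have main : ∀ m : ℕ, ∀ᵐ s : EV n, ‖s‖ ≤ m → R ≤ m → ∃ l, Tendsto (fun ε => ∫ t, Ke K ε (γ t - γ s) * g t) (𝓝[>] 0) (𝓝 l) := by
    intro m
    by_cases hRm : R ≤ m
    swap
    · exact ae_of_all _ fun s _ h => absurd h hRm
    set B := closedBall (0 : EV n) (m + 1)
    have : IsFiniteMeasure ((volume : Measure (EV n)).restrict B) := ⟨by simpa using measure_closedBall_lt_top⟩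
    obtain ⟨H, hH, Hw⟩ := weak_lim (volume.restrict B) (fun δ => Td K γ δ g) (fun δ => Td_meas hK h.cont.measurable hg)
      (ofReal ((M + 1) ^ 2) * ofReal (A * volume.real B)) (by finiteness) (by
        intro δ hδ
        have := HT γ ι η h δ hδ 0 (m + 1) (by positivity) (fun t => (M + 1)⁻¹ * g t) (hg.const_mul _) (fun s => by
          rw [abs_mul, abs_of_pos (by positivity), inv_mul_le_iff₀ (by positivity)]; linarith [hM s]) (fun s hs => by
          rw [hR s fun hh => hs (closedBall_subset_closedBall (by linarith) hh), mul_zero])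
        have e : ∀ s, Td K γ δ g s = (M + 1) * Td K γ δ (fun t => (M + 1)⁻¹ * g t) s := fun s => by
          unfold Td
          rw [← integral_const_mul]; congr 1; funext t
          field_simp
        simp_rw [e, enorm_mul, mul_pow]
        rw [lintegral_const_mul' _ _ (by finiteness)]
        refine mul_le_mul' ?_ this
        rw [← ofReal_norm, ← ofReal_pow (norm_nonneg _), norm_of_nonneg (by positivity)])
    set H' := B.indicator H
    have hH' : Integrable H' := (integrable_indicator_iff measurableSet_closedBall).2 hH
    filter_upwards [ae_LebP hgl, ae_LebP hH'.locallyIntegrable, h.lip.ae_differentiableAt] with s l1 l2 l3 hs _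
    refine ⟨_, pv_pt hK h hg hM hR hH' l3 l1 l2 fun ψ hψ hψc hψs ρ hρ κ hκ => ?_⟩
    obtain ⟨δ, d1, d2, d3⟩ := Hw ψ hψ hψc ρ hρ κ hκ
    have hz : ∀ x ∉ B, ψ x = 0 := fun x hx => hψs x fun hh => hx (by
      simp only [B, mem_closedBall, dist_zero_right] at hh ⊢
      rw [dist_eq_norm] at hh
      have := norm_le_norm_add_norm_sub' x s
      linarith)
    refine ⟨δ, d1, d2, ?_⟩
    rw [setIntegral_eq_integral_of_forall_compl_eq_zero (fun x hx => by rw [hz x hx, zero_mul])] at d3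
    rw [setIntegral_congr_fun (g := fun x => ψ x * H' x) measurableSet_closedBall (fun x hx => by
      simp only [H']; rw [indicator_of_mem hx]), setIntegral_eq_integral_of_forall_compl_eq_zero (fun x hx => by rw [hz x hx, zero_mul])] at d3
    exact d3
  filter_upwards [ae_all_iff.2 main] with s hs
  obtain ⟨m, hm⟩ := exists_nat_ge (max ‖s‖ R)
  exact hs m ((le_max_left _ _).trans hm) ((le_max_right _ _).trans hm)
end pv

section smear
variable {n : ℕ} {γ : EV n → EW n} {ι : EV n →ₗᵢ[ℝ] EW n} {η : ℝ}
  {K : EW n → ℝ} {C : ℝ}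

def om (m : ℕ) : EV n → ℝ := (closedBall (0 : EV n) m).indicator 1
def To (K : EW n → ℝ) (γ : EV n → EW n) (m : ℕ) (s : EV n) (ε : ℝ) : ℝ := ∫ t, Ke K ε (γ t - γ s) * om m t
def Gd (K : EW n → ℝ) (γ : EV n → EW n) (s : EV n) : Prop :=
  ∀ m, ∃ l, Tendsto (To K γ m s) (𝓝[>] 0) (𝓝 l)

lemma om_int (m : ℕ) : Integrable (om (n := n) m) :=
  (integrable_indicator_iff measurableSet_closedBall).2 (integrableOn_const measure_closedBall_lt_top.ne)
lemma om_nonneg (m : ℕ) (t : EV n) : 0 ≤ om m t := indicator_nonneg (fun _ _ => zero_le_one) _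
lemma om_one {m : ℕ} {t : EV n} (h : ‖t‖ ≤ m) : om m t = 1 := by
  rw [om, indicator_of_mem (by simpa using h), Pi.one_apply]

lemma ae_Gd (hK : CZK n K C) (h : NearIso γ ι η) : ∀ᵐ s, Gd K γ s := by
  refine ae_all_iff.2 fun m => ?_
  refine pv_bdd hK h (measurable_one.indicator measurableSet_closedBall) (M := 1) (fun s => ?_) (R := m) (fun s hs => indicator_of_notMem hs _)
  unfold om indicator; split_ifs <;> simp

lemma Ke_int (hK : CZK n K C) (hγ : Continuous γ) {ε : ℝ} (hε : 0 < ε) (s : EV n) {g : EV n → ℝ} (hg : Integrable g) :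
    Integrable fun t => Ke K ε (γ t - γ s) * g t :=
  hg.bdd_mul ((Ke_meas hK).comp (hγ.measurable.sub_const _)).aestronglyMeasurable (ae_of_all _ fun _ => Ke_bd2 hK hε _)

lemma Gd_bd (hK : CZK n K C) {s : EV n} (hs : Gd K γ s) (m : ℕ) : ∃ S, 0 ≤ S ∧ ∀ ε > 0, |To K γ m s ε| ≤ S := by
  have hC := hK.one_le
  obtain ⟨l, hl⟩ := hs m
  have h1 := (hl.abs.eventually_lt_const (lt_add_one |l|))
  obtain ⟨e, he, h2⟩ := mem_nhdsGT_iff_exists_Ioo_subset.1 h1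
  have he0 : 0 < e := he
  set X := ∫ t : EV n, om m t
  have hX : 0 ≤ X := integral_nonneg (om_nonneg m)
  refine ⟨|l| + 1 + C / e ^ n * X, by positivity, fun ε hε => ?_⟩
  rcases lt_or_ge ε e with h | h
  · have : |To K γ m s ε| < |l| + 1 := h2 ⟨hε, h⟩
    have : 0 ≤ C / e ^ n * X := by positivity
    linarith
  · have : |To K γ m s ε| ≤ C / e ^ n * X := by
      unfold To
      rw [← integral_const_mul, ← norm_eq_abs]
      refine norm_integral_le_of_norm_le ((om_int m).const_mul _) (ae_of_all _ fun t => ?_)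
      rw [norm_eq_abs, abs_mul, abs_of_nonneg (om_nonneg m t)]
      gcongr
      · exact om_nonneg m t
      · exact (Ke_bd2 hK hε _).trans (by gcongr)
    have := abs_nonneg l
    linarith

def cl (n : ℕ) : ℝ := ∫ u : EV n, if ‖u‖ < 1 then ‖u‖ / ‖u‖ ^ n else 0
lemma cl_nonneg : 0 ≤ cl n := integral_nonneg fun u => by simp only [Pi.zero_apply]; split_ifs <;> positivity
lemma loc_int' (hn : 1 ≤ n) (s : EV n) (R : ℝ) : Integrable fun t : EV n => if ‖t - s‖ < R then ‖t - s‖ / ‖t - s‖ ^ n else 0 :=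
  (loc_int hn R).comp_sub_right s
lemma cl_eq (s : EV n) {R : ℝ} (hR : 0 < R) : ∫ t : EV n, (if ‖t - s‖ < R then ‖t - s‖ / ‖t - s‖ ^ n else 0) = R * cl n := by
  have h1 := int_aff (fun t => if ‖t - s‖ < R then ‖t - s‖ / ‖t - s‖ ^ n else 0) s hR
  have e : ∀ u : EV n, (if ‖s + R • u - s‖ < R then ‖s + R • u - s‖ / ‖s + R • u - s‖ ^ n else 0) = R / R ^ n * (if ‖u‖ < 1 then ‖u‖ / ‖u‖ ^ n else 0) := by
    intro u
    rw [add_sub_cancel_left, norm_smul, norm_of_nonneg hR.le]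
    simp only [mul_lt_iff_lt_one_right hR, mul_ite, mul_zero]
    refine if_congr Iff.rfl ?_ rfl
    rw [mul_pow, mul_div_mul_comm]
  simp_rw [e] at h1
  rw [integral_const_mul] at h1
  change R / R ^ n * cl n = _ at h1
  field_simp at h1
  exact h1.symm

lemma dK_bd (hK : CZK n K C) (h : NearIso γ ι η) {s : EV n} {φ : EV n → ℝ} {L ρ ε : ℝ} (hL : 0 ≤ L) (hφ : ∀ t, |φ t - φ s| ≤ L * ‖t - s‖)
    (hε : 0 < ε) (hε2 : ε ≤ ρ) (t : EV n) :
    |(Ke K ε (γ t - γ s) - Ke K ρ (γ t - γ s)) * (φ t - φ s)| ≤ 2 * C * 2 ^ n * L * (if ‖t - s‖ < 5 * ρ then ‖t - s‖ / ‖t - s‖ ^ n else 0) := by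
  have hC := hK.one_le
  split_ifs with ht
  · rw [abs_mul]
    have b1 := (abs_sub (Ke K ε (γ t - γ s)) (Ke K ρ (γ t - γ s))).trans (add_le_add ((Ke_le _).trans (K_bd' hK h s t)) ((Ke_le _).trans (K_bd' hK h s t)))
    calc _ ≤ _ := mul_le_mul b1 (hφ t) (abs_nonneg _) (by positivity)
      _ = _ := by ring
  · have := h.low t s
    rw [Ke_eq hε (by linarith), Ke_eq (hε.trans_le hε2) (by linarith)]
    simp

lemma phi_dec (hK : CZK n K C) (h : NearIso γ ι η) {s : EV n} {φ : EV n → ℝ} {L ρ ε : ℝ} (hL : 0 ≤ L) (hφm : Measurable φ)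
    (hφ : ∀ t, |φ t - φ s| ≤ L * ‖t - s‖) (hφ0 : ∀ t, ρ ≤ 2 * ‖t - s‖ → φ t = 0)
    (hε : 0 < ε) (hε2 : ε ≤ ρ) {m : ℕ} (hm : ‖s‖ + 5 * ρ ≤ m) :
    ∫ t, Ke K ε (γ t - γ s) * φ t = (∫ t, (Ke K ε (γ t - γ s) - Ke K ρ (γ t - γ s)) * (φ t - φ s)) + φ s * (To K γ m s ε - To K γ m s ρ) := by
  have hρ : 0 < ρ := hε.trans_le hε2
  unfold To
  rw [← integral_sub (Ke_int hK h.cont hε s (om_int m)) (Ke_int hK h.cont hρ s (om_int m)), ← integral_const_mul]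
  refine Eq.trans ?_ (integral_add ?_ ?_)
  · congr 1; funext t
    have e1 : Ke K ρ (γ t - γ s) * φ t = 0 := by
      rcases le_or_gt ρ (2 * ‖t - s‖) with h1 | h1
      · rw [hφ0 t h1, mul_zero]
      · rw [Ke_zero hρ, zero_mul]
        linarith [h.up t s]
    have e2 : (Ke K ε (γ t - γ s) - Ke K ρ (γ t - γ s)) * om m t = Ke K ε (γ t - γ s) - Ke K ρ (γ t - γ s) := by
      rcases le_or_gt ‖t - s‖ (5 * ρ) with h1 | h1
      · rw [om_one, mul_one]
        linarith [norm_le_norm_add_norm_sub' t s]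
      · have := h.low t s
        rw [Ke_eq hε (by linarith), Ke_eq hρ (by linarith)]; simp
    rw [← sub_mul, e2]
    linear_combination e1
  · refine Integrable.mono' ((loc_int' hK.one_le_n s (5 * ρ)).const_mul (2 * C * 2 ^ n * L)) ?_ (ae_of_all _ fun t => dK_bd hK h hL hφ hε hε2 t)
    exact ((((Ke_meas hK).comp (h.cont.measurable.sub_const _)).sub ((Ke_meas hK).comp (h.cont.measurable.sub_const _))).mul (hφm.sub_const _)).aestronglyMeasurable
  · exact ((Ke_int hK h.cont hε s (om_int m)).sub (Ke_int hK h.cont hρ s (om_int m))).const_mul _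

lemma phi_bd (hK : CZK n K C) (h : NearIso γ ι η) {s : EV n} {φ : EV n → ℝ} {L ρ ε : ℝ} (hL : 0 ≤ L) (hφm : Measurable φ)
    (hφ : ∀ t, |φ t - φ s| ≤ L * ‖t - s‖) (hφ0 : ∀ t, ρ ≤ 2 * ‖t - s‖ → φ t = 0)
    (hε : 0 < ε) (hε2 : ε ≤ ρ) {m : ℕ} (hm : ‖s‖ + 5 * ρ ≤ m) {S : ℝ} (hS : ∀ ε > 0, |To K γ m s ε| ≤ S) :
    |∫ t, Ke K ε (γ t - γ s) * φ t| ≤ 2 * C * 2 ^ n * L * (5 * ρ * cl n) + |φ s| * (2 * S) := by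
  have hρ : 0 < ρ := hε.trans_le hε2
  rw [phi_dec hK h hL hφm hφ hφ0 hε hε2 hm]
  refine (abs_add_le _ _).trans (add_le_add ?_ ?_)
  · rw [← cl_eq s (by positivity : 0 < 5 * ρ), ← integral_const_mul, ← norm_eq_abs]
    exact norm_integral_le_of_norm_le ((loc_int' hK.one_le_n s (5 * ρ)).const_mul (2 * C * 2 ^ n * L)) (ae_of_all _ fun t => dK_bd hK h hL hφ hε hε2 t)
  · rw [abs_mul]
    gcongr
    exact (abs_sub _ _).trans (by linarith [hS ε hε, hS ρ hρ])

lemma phi_conv (hK : CZK n K C) (h : NearIso γ ι η) {s : EV n} (hs : Gd K γ s) {φ : EV n → ℝ} {L ρ : ℝ} (hL : 0 ≤ L) (hφm : Measurable φ)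
    (hφ : ∀ t, |φ t - φ s| ≤ L * ‖t - s‖) (hφ0 : ∀ t, ρ ≤ 2 * ‖t - s‖ → φ t = 0) (hρ : 0 < ρ) :
    ∃ l, Tendsto (fun ε => ∫ t, Ke K ε (γ t - γ s) * φ t) (𝓝[>] 0) (𝓝 l) := by
  obtain ⟨m, hm⟩ := exists_nat_ge (‖s‖ + 5 * ρ)
  obtain ⟨l, hl⟩ := hs m
  have hev : ∀ᶠ ε in 𝓝[>] (0 : ℝ), 0 < ε ∧ ε ≤ ρ := Ioc_mem_nhdsGT hρ
  have h1 : Tendsto (fun ε => ∫ t, (Ke K ε (γ t - γ s) - Ke K ρ (γ t - γ s)) * (φ t - φ s)) (𝓝[>] 0)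
      (𝓝 (∫ t, (K (γ t - γ s) - Ke K ρ (γ t - γ s)) * (φ t - φ s))) := by
    refine tendsto_integral_filter_of_dominated_convergence _ ?_ ?_ ((loc_int' hK.one_le_n s (5 * ρ)).const_mul (2 * C * 2 ^ n * L)) ?_
    · exact Eventually.of_forall fun ε => ((((Ke_meas hK).comp (h.cont.measurable.sub_const _)).sub
        ((Ke_meas hK).comp (h.cont.measurable.sub_const _))).mul (hφm.sub_const _)).aestronglyMeasurable
    · filter_upwards [hev] with ε hε
      exact ae_of_all _ fun t => dK_bd hK h hL hφ hε.1 hε.2 t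
    · refine ae_of_all _ fun t => ?_
      by_cases hts : t = s
      · subst hts; simp
      · have : γ t - γ s ≠ 0 := fun h0 => by
          have := h.low t s
          rw [h0, norm_zero, mul_zero] at this
          exact hts (sub_eq_zero.1 (norm_le_zero_iff.1 this))
        refine tendsto_const_nhds.congr' ?_
        filter_upwards [Ke_tendsto this] with ε hε
        rw [hε]
  refine ⟨_, (h1.add ((hl.sub_const (To K γ m s ρ)).const_mul (φ s))).congr' ?_⟩
  filter_upwards [hev] with ε hε
  exact (phi_dec hK h hL hφm hφ hφ0 hε.1 hε.2 hm).symm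
end smear

section smear
variable {n : ℕ} {γ : EV n → EW n} {ι : EV n →ₗᵢ[ℝ] EW n} {η : ℝ}
  {K : EW n → ℝ} {C : ℝ}

def bump (D : ℝ) (p t : EV n) : ℝ := (D ^ n)⁻¹ * tent (D⁻¹ • (t - p))
lemma bump_nonneg {D : ℝ} (hD : 0 < D) (p t : EV n) : 0 ≤ bump D p t := mul_nonneg (by positivity) (tent_nonneg _)
lemma bump_le {D : ℝ} (hD : 0 < D) (p t : EV n) : bump D p t ≤ cps n / D ^ n := by
  rw [bump, ← div_eq_inv_mul]; gcongr; exact tent_le _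
lemma bump_zero {D : ℝ} (hD : 0 < D) {p t : EV n} (h : D ≤ ‖t - p‖) : bump D p t = 0 := by
  rw [bump, tent_zero, mul_zero]
  rw [norm_smul, norm_inv, norm_of_nonneg hD.le, inv_mul_eq_div, one_le_div hD]; exact h
lemma bump_lip {D : ℝ} (hD : 0 < D) (p t s : EV n) : |bump D p t - bump D p s| ≤ cps n / D ^ (n + 1) * ‖t - s‖ := by
  rw [bump, bump, ← mul_sub, abs_mul, abs_of_pos (by positivity)]
  refine (mul_le_mul_of_nonneg_left (tent_lip _ _) (by positivity)).trans_eq ?_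
  rw [← smul_sub, sub_sub_sub_cancel_right, norm_smul, norm_inv, norm_of_nonneg hD.le, pow_succ]
  field_simp
lemma bump_cont (D : ℝ) (p : EV n) : Continuous (bump D p) := by
  have := tent_cont (n := n)
  unfold bump; fun_prop
lemma bump_meas : Measurable fun x : ℝ × EV n × EV n => bump x.1 x.2.1 x.2.2 := by
  have := (tent_cont (n := n)).measurable
  unfold bump; fun_prop
lemma bump_integral {D : ℝ} (hD : 0 < D) (p : EV n) : ∫ t, bump D p t = 1 := by
  have := int_aff (fun t => tent (D⁻¹ • (t - p))) p hD
  simp_rw [add_sub_cancel_left, smul_smul, inv_mul_cancel₀ hD.ne', one_smul] at this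
  unfold bump
  rw [integral_const_mul, ← this, tent_integral]
lemma bump_int {D : ℝ} (hD : 0 < D) (p : EV n) : Integrable (bump D p) :=
  Integrable.of_integral_ne_zero (by rw [bump_integral hD]; exact one_ne_zero)

def err (K : EW n → ℝ) (γ : EV n → EW n) (s : EV n) (ε : ℝ) (z : EW n) (p : EV n) (D : ℝ) : ℝ :=
  Ke K ε (z - γ s) - ∫ t, Ke K ε (γ t - γ s) * bump D p t

lemma err_conv (hK : CZK n K C) (h : NearIso γ ι η) {s : EV n} (hs : Gd K γ s) {z : EW n} {D : ℝ} (hD : 0 < D) (p : EV n) (hz : z ≠ γ s) :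
    ∃ l, Tendsto (fun ε => err K γ s ε z p D) (𝓝[>] 0) (𝓝 l) := by
  have := cps_pos (n := n)
  obtain ⟨l, hl⟩ := phi_conv hK h hs (L := cps n / D ^ (n + 1)) (ρ := 2 * (D + ‖p - s‖)) (by positivity)
    (bump_cont D p).measurable (fun t => bump_lip hD p t s)
    (fun t ht => bump_zero hD (by
      have := norm_sub_le_norm_sub_add_norm_sub t p s
      linarith)) (by positivity)
  have h1 : Tendsto (fun ε => Ke K ε (z - γ s)) (𝓝[>] 0) (𝓝 (K (z - γ s))) :=
    tendsto_const_nhds.congr' (by filter_upwards [Ke_tendsto (K := K) (sub_ne_zero.2 hz)] with ε hε using hε.symm)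
  exact ⟨_, h1.sub hl⟩

lemma err_bd (hK : CZK n K C) (h : NearIso γ ι η) {s : EV n} (hs : Gd K γ s) {c1 c2 : ℝ} (hc1 : 0 ≤ c1) (hc2 : 0 ≤ c2) :
    ∃ A, 0 ≤ A ∧ ∀ ε z p D, 0 < ε → 0 < D → D ≤ 1 → ‖z - γ p‖ ≤ c1 * D → D ≤ c2 * ‖z - γ s‖ → |err K γ s ε z p D| ≤ A * pk n D ‖p - s‖ := by
  have hC := hK.one_le
  have hcp := cps_pos (n := n)
  have hcl := cl_nonneg (n := n)
  set Λ := 4 * c1 + 8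
  obtain ⟨m, hm⟩ := exists_nat_ge (‖s‖ + 5 * (2 * (Λ + 1)))
  obtain ⟨S, hS0, hS⟩ := Gd_bd hK hs m
  set A1 := 5 * C * (c1 + 2) * 4 ^ (n + 1)
  set A2 := C * c2 ^ n + C + (2 * C * 2 ^ n * cps n * (5 * (2 * (Λ + 1)) * cl n) + cps n * (2 * S))
  have hΛ : 0 < Λ := by positivity
  have hA1 : 0 ≤ A1 := by positivity
  have hA2 : 0 ≤ A2 := by positivity
  refine ⟨A1 + A2 * (1 + Λ) ^ (n + 1), by positivity, ?_⟩
  intro ε z p D hε hD hD1 hz1 hz2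
  have hpk := pk_nonneg (n := n) hD.le (norm_nonneg (p - s))
  set d := ‖p - s‖
  rcases le_or_gt (Λ * D) d with hd | hd
  · have hd0 : 0 < d := lt_of_lt_of_le (by positivity) hd
    have hlow : d / 2 ≤ ‖γ p - γ s‖ := by linarith [h.low p s]
    have key : ∀ w, ‖γ p - w‖ ≤ (c1 + 2) * D → |Ke K ε (γ p - γ s) - Ke K ε (w - γ s)| ≤ 5 * C * ‖γ p - w‖ / (d / 2) ^ (n + 1) := by
      intro w hw
      have := Ke_lip hK hε (γ p - γ s) (w - γ s) (by
        rw [sub_sub_sub_cancel_right]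
        have : (c1 + 2) * D = Λ * D / 4 := by simp only [Λ]; ring
        linarith)
      rw [sub_sub_sub_cancel_right] at this
      refine this.trans ?_
      gcongr
    have k1 := key z (by rw [norm_sub_rev]; nlinarith)
    have e : (∫ t, Ke K ε (γ t - γ s) * bump D p t) - Ke K ε (γ p - γ s) = ∫ t, (Ke K ε (γ t - γ s) - Ke K ε (γ p - γ s)) * bump D p t := by
      simp_rw [sub_mul]
      rw [integral_sub (Ke_int hK h.cont hε s (bump_int hD p)) ((bump_int hD p).const_mul _), integral_const_mul, bump_integral hD, mul_one]
    have k2 : |(∫ t, Ke K ε (γ t - γ s) * bump D p t) - Ke K ε (γ p - γ s)| ≤ 5 * C * (2 * D) / (d / 2) ^ (n + 1) := by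
      rw [e, ← norm_eq_abs, ← mul_one (5 * C * (2 * D) / (d / 2) ^ (n + 1)), ← bump_integral hD p, ← integral_const_mul]
      refine norm_integral_le_of_norm_le ((bump_int hD p).const_mul _) (ae_of_all _ fun t => ?_)
      rw [norm_eq_abs, abs_mul, abs_of_nonneg (bump_nonneg hD p t)]
      rcases le_or_gt D ‖t - p‖ with ht | ht
      · rw [bump_zero hD ht, mul_zero, mul_zero]
      · have hup := h.up p t
        rw [norm_sub_rev p t] at hup
        refine mul_le_mul_of_nonneg_right ?_ (bump_nonneg hD p t)
        rw [abs_sub_comm]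
        refine (key (γ t) (by nlinarith)).trans ?_
        gcongr; linarith
    have k3 : |err K γ s ε z p D| ≤ 5 * C * ‖γ p - z‖ / (d / 2) ^ (n + 1) + 5 * C * (2 * D) / (d / 2) ^ (n + 1) := by
      have : err K γ s ε z p D = -(Ke K ε (γ p - γ s) - Ke K ε (z - γ s)) - ((∫ t, Ke K ε (γ t - γ s) * bump D p t) - Ke K ε (γ p - γ s)) := by
        unfold err; ring
      rw [this]
      refine (abs_sub _ _).trans ?_
      rw [abs_neg]; exact add_le_add k1 k2
    have k4 : 5 * C * ‖γ p - z‖ / (d / 2) ^ (n + 1) + 5 * C * (2 * D) / (d / 2) ^ (n + 1) ≤ A1 * pk n D d := by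
      have : 5 * C * ‖γ p - z‖ ≤ 5 * C * (c1 * D) := by rw [norm_sub_rev]; gcongr
      have hDd : D ≤ d := by nlinarith
      rw [← add_div]
      have q1 : (D + d) / 4 ≤ d / 2 := by linarith
      have q2 := pow_le_pow_left₀ (by positivity) q1 (n + 1)
      have q3 : 5 * C * ‖γ p - z‖ + 5 * C * (2 * D) ≤ 5 * C * (c1 + 2) * D := by linarith
      calc _ ≤ (5 * C * (c1 + 2) * D) / ((D + d) / 4) ^ (n + 1) := div_le_div₀ (by positivity) q3 (by positivity) q2
        _ = A1 * pk n D d := by unfold pk; rw [div_pow]; simp only [A1]; field_simp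
    refine k3.trans (k4.trans ?_)
    gcongr
    have : 0 ≤ A2 * (1 + Λ) ^ (n + 1) := by positivity
    linarith
  · have g1 : 1 / D ^ n ≤ (1 + Λ) ^ (n + 1) * pk n D d := by
      have : (D + d) ^ (n + 1) ≤ ((1 + Λ) * D) ^ (n + 1) := by gcongr; linarith
      have h0 : 0 ≤ d := norm_nonneg _
      unfold pk
      rw [mul_div_assoc', div_le_div_iff₀ (by positivity) (by positivity), one_mul]
      refine this.trans_eq ?_; rw [mul_pow]; ring
    have g2 : |Ke K ε (z - γ s)| ≤ C * c2 ^ n * (1 / D ^ n) := by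
      have hz0 : 0 < ‖z - γ s‖ := by
        by_contra h0
        have : ‖z - γ s‖ = 0 := le_antisymm (not_lt.1 h0) (norm_nonneg _)
        rw [this, mul_zero] at hz2; linarith
      refine (Ke_bd hK _).trans ?_
      rw [mul_one_div, div_le_div_iff₀ (by positivity) (by positivity), mul_assoc, ← mul_pow]
      gcongr
    have g3 : |∫ t, Ke K ε (γ t - γ s) * bump D p t| ≤ (C + (2 * C * 2 ^ n * cps n * (5 * (2 * (Λ + 1)) * cl n) + cps n * (2 * S))) * (1 / D ^ n) := by
      have hD1' : (0 : ℝ) < 1 / D ^ n := by positivity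
      rcases le_or_gt ε (2 * (Λ + 1) * D) with he | he
      · have := phi_bd hK h (L := cps n / D ^ (n + 1)) (ρ := 2 * (Λ + 1) * D) (by positivity)
          (bump_cont D p).measurable (fun t => bump_lip hD p t s)
          (fun t ht => bump_zero hD (by
            have := norm_sub_le_norm_sub_add_norm_sub t p s
            linarith)) hε he (m := m) (by nlinarith) hS
        refine this.trans ?_
        have b1 : 2 * C * 2 ^ n * (cps n / D ^ (n + 1)) * (5 * (2 * (Λ + 1) * D) * cl n) = 2 * C * 2 ^ n * cps n * (5 * (2 * (Λ + 1)) * cl n) * (1 / D ^ n) := by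
          rw [pow_succ]; field_simp
        have b2 : |bump D p s| * (2 * S) ≤ cps n * (2 * S) * (1 / D ^ n) := by
          rw [abs_of_nonneg (bump_nonneg hD p s)]
          calc _ ≤ cps n / D ^ n * (2 * S) := by gcongr; exact bump_le hD p s
            _ = _ := by ring
        rw [b1]
        nlinarith
      · have : |∫ t, Ke K ε (γ t - γ s) * bump D p t| ≤ C * (1 / D ^ n) := by
          rw [mul_one_div, ← norm_eq_abs, ← mul_one (C / D ^ n), ← bump_integral hD p, ← integral_const_mul]
          refine norm_integral_le_of_norm_le ((bump_int hD p).const_mul _) (ae_of_all _ fun t => ?_)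
          rw [norm_eq_abs, abs_mul, abs_of_nonneg (bump_nonneg hD p t)]
          refine mul_le_mul_of_nonneg_right ?_ (bump_nonneg hD p t)
          refine (Ke_bd2 hK hε _).trans ?_
          gcongr
          nlinarith
        refine this.trans ?_
        gcongr
        have : 0 ≤ 2 * C * 2 ^ n * cps n * (5 * (2 * (Λ + 1)) * cl n) + cps n * (2 * S) := by positivity
        linarith
    unfold err
    refine (abs_sub _ _).trans ?_
    calc _ ≤ A2 * (1 / D ^ n) := by simp only [A2]; linarith
      _ ≤ A2 * ((1 + Λ) ^ (n + 1) * pk n D d) := by gcongr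
      _ ≤ _ := by nlinarith [mul_nonneg hA1 hpk]

variable {Z : Type*} [MeasurableSpace Z]

/-- smeared density -/
def SG (σ : Measure Z) (p : Z → EV n) (D : Z → ℝ) (t : EV n) : ℝ := ∫ z, bump (D z) (p z) t ∂σ

lemma SG_int_aux (σ : Measure Z) [IsFiniteMeasure σ] {p : Z → EV n} {D : Z → ℝ} (hp : Measurable p) (hD : Measurable D) (h0 : ∀ᵐ z ∂σ, 0 < D z) :
    Integrable (fun x : Z × EV n => bump (D x.1) (p x.1) x.2) (σ.prod volume) := by
  have hm : Measurable (fun x : Z × EV n => bump (D x.1) (p x.1) x.2) :=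
    bump_meas.comp ((hD.comp measurable_fst).prodMk ((hp.comp measurable_fst).prodMk measurable_snd))
  rw [integrable_prod_iff hm.aestronglyMeasurable]
  refine ⟨by filter_upwards [h0] with z hz using bump_int hz _, (integrable_const (1 : ℝ)).congr ?_⟩
  filter_upwards [h0] with z hz
  rw [← bump_integral hz (p z)]
  congr 1; funext t
  rw [norm_of_nonneg (bump_nonneg hz _ _)]

lemma SG_int (σ : Measure Z) [IsFiniteMeasure σ] {p : Z → EV n} {D : Z → ℝ} (hp : Measurable p) (hD : Measurable D) (h0 : ∀ᵐ z ∂σ, 0 < D z) :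
    Integrable (SG σ p D) := (SG_int_aux σ hp hD h0).integral_prod_right

lemma SG_nonneg (σ : Measure Z) {p : Z → EV n} {D : Z → ℝ} (h0 : ∀ᵐ z ∂σ, 0 < D z) (t) : 0 ≤ SG σ p D t :=
  integral_nonneg_of_ae (by filter_upwards [h0] with z hz using bump_nonneg hz _ _)

lemma SG_meas (σ : Measure Z) [SFinite σ] {p : Z → EV n} {D : Z → ℝ} (hp : Measurable p) (hD : Measurable D) : Measurable (SG σ p D) := by
  have hm : Measurable (fun x : EV n × Z => bump (D x.2) (p x.2) x.1) :=
    bump_meas.comp ((hD.comp measurable_snd).prodMk ((hp.comp measurable_snd).prodMk measurable_fst))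
  exact (StronglyMeasurable.integral_prod_right (f := fun t z => bump (D z) (p z) t) hm.stronglyMeasurable).measurable

lemma pk_int_pt (p : EV n) {D : ℝ} (hD : 0 < D) : ∫⁻ s, ofReal (pk n D ‖p - s‖) = ofReal (∫ u : EV n, pk n 1 ‖u‖) := by
  have e : ∀ u : EV n, pk n D ‖p - (p + D • u)‖ = pk n 1 ‖u‖ / D ^ n := fun u => by
    rw [sub_add_cancel_left, norm_neg, norm_smul, norm_of_nonneg hD.le, pk_scale hD]
  have h1 := int_aff (fun s => pk n D ‖p - s‖) p hD
  simp_rw [e] at h1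
  rw [integral_div, div_eq_inv_mul] at h1
  have h2 := mul_left_cancel₀ (by positivity) h1
  rw [h2, ofReal_integral_eq_lintegral_ofReal (f := fun s => pk n D ‖p - s‖) _ (ae_of_all _ fun s => pk_nonneg hD.le (norm_nonneg _))]
  have i1 : Integrable fun u : EV n => pk n D ‖D • u‖ := by
    simp_rw [norm_smul, norm_of_nonneg hD.le, pk_scale hD]
    exact pk_int.div_const _
  have i2 := (integrable_comp_smul_iff volume (fun u : EV n => pk n D ‖u‖) hD.ne').1 i1
  exact i2.comp_sub_left p

lemma pk_ae (σ : Measure Z) [IsFiniteMeasure σ] {p : Z → EV n} {D : Z → ℝ} (hp : Measurable p) (hD : Measurable D) (h0 : ∀ᵐ z ∂σ, 0 < D z) :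
    ∀ᵐ s : EV n, ∫⁻ z, ofReal (pk n (D z) ‖p z - s‖) ∂σ < ∞ := by
  have hm : Measurable (fun x : EV n × Z => ofReal (pk n (D x.2) ‖p x.2 - x.1‖)) :=
    (pk_meas.comp ((hD.comp measurable_snd).prodMk ((hp.comp measurable_snd).sub measurable_fst).norm)).ennreal_ofReal
  refine ae_lt_top hm.lintegral_prod_right' ?_
  rw [lintegral_lintegral_swap hm.aemeasurable]
  rw [lintegral_congr_ae (g := fun _ => ofReal (∫ u : EV n, pk n 1 ‖u‖)) (by filter_upwards [h0] with z hz using pk_int_pt _ hz), lintegral_const]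
  finiteness

theorem smear (hK : CZK n K C) (h : NearIso γ ι η) {s : EV n} (hs : Gd K γ s) (σ : Measure Z) [IsFiniteMeasure σ] {w : Z → EW n} {p : Z → EV n}
    {D : Z → ℝ} (hw : Measurable w) (hp : Measurable p) (hD : Measurable D) {c1 c2 : ℝ} (hc1 : 0 ≤ c1) (hc2 : 0 ≤ c2)
    (hz : ∀ᵐ z ∂σ, 0 < D z ∧ D z ≤ 1 ∧ ‖w z - γ (p z)‖ ≤ c1 * D z ∧ D z ≤ c2 * ‖w z - γ s‖)
    (hpk : ∫⁻ z, ofReal (pk n (D z) ‖p z - s‖) ∂σ < ∞)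
    (hG : ∃ l, Tendsto (fun ε => ∫ t, Ke K ε (γ t - γ s) * SG σ p D t) (𝓝[>] 0) (𝓝 l)) :
    ∃ l, Tendsto (fun ε => ∫ z, Ke K ε (w z - γ s) ∂σ) (𝓝[>] 0) (𝓝 l) := by
  obtain ⟨A, hA, HA⟩ := err_bd hK h hs hc1 hc2
  have h0 : ∀ᵐ z ∂σ, 0 < D z := hz.mono fun z hz => hz.1
  have hpkm : Measurable fun z => pk n (D z) ‖p z - s‖ := pk_meas.comp (hD.prodMk (hp.sub_const s).norm)
  have hpki : Integrable (fun z => pk n (D z) ‖p z - s‖) σ := by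
    refine ⟨hpkm.aestronglyMeasurable, ?_⟩
    rw [hasFiniteIntegral_iff_ofReal (by filter_upwards [h0] with z hz using pk_nonneg hz.le (norm_nonneg _))]
    exact hpk
  have i0 : ∀ ε > 0, Integrable (fun x : Z × EV n => Ke K ε (γ x.2 - γ s) * bump (D x.1) (p x.1) x.2) (σ.prod volume) := fun ε hε =>
    (SG_int_aux σ hp hD h0).bdd_mul ((Ke_meas hK).comp ((h.cont.measurable.comp measurable_snd).sub_const _)).aestronglyMeasurable
      (ae_of_all _ fun x => Ke_bd2 hK hε _)
  have i1 : ∀ ε > 0, Integrable (fun z => Ke K ε (w z - γ s)) σ := fun ε hε =>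
    Integrable.of_bound ((Ke_meas hK).comp (hw.sub_const _)).aestronglyMeasurable _ (ae_of_all _ fun x => Ke_bd2 hK hε _)
  have e1 : ∀ ε > 0, ∫ z, err K γ s ε (w z) (p z) (D z) ∂σ = (∫ z, Ke K ε (w z - γ s) ∂σ) - ∫ t, Ke K ε (γ t - γ s) * SG σ p D t := by
    intro ε hε
    unfold err
    rw [integral_sub (i1 ε hε) (i0 ε hε).integral_prod_left, integral_integral_swap (f := fun z t => Ke K ε (γ t - γ s) * bump (D z) (p z) t) (i0 ε hε)]
    simp_rw [integral_const_mul]; rfl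
  have hlim : ∀ᵐ z ∂σ, ∃ l, Tendsto (fun ε => err K γ s ε (w z) (p z) (D z)) (𝓝[>] 0) (𝓝 l) := by
    filter_upwards [hz] with z hz
    refine err_conv hK h hs hz.1 _ fun h0 => ?_
    have := hz.2.2.2
    rw [h0, sub_self, norm_zero, mul_zero] at this
    linarith [hz.1]
  classical
  obtain ⟨l, hl⟩ := hG
  set E0 : Z → ℝ := fun z => if hz : ∃ l, Tendsto (fun ε => err K γ s ε (w z) (p z) (D z)) (𝓝[>] 0) (𝓝 l) then hz.choose else 0
  have h1 : Tendsto (fun ε => ∫ z, err K γ s ε (w z) (p z) (D z) ∂σ) (𝓝[>] 0) (𝓝 (∫ z, E0 z ∂σ)) := by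
    refine tendsto_integral_filter_of_dominated_convergence (fun z => A * pk n (D z) ‖p z - s‖) ?_ ?_ (hpki.const_mul A) ?_
    · filter_upwards [self_mem_nhdsWithin] with ε hε
      exact ((i1 ε hε).sub (i0 ε hε).integral_prod_left).aestronglyMeasurable
    · filter_upwards [self_mem_nhdsWithin] with ε hε
      filter_upwards [hz] with z hz
      exact HA ε _ _ _ hε hz.1 hz.2.1 hz.2.2.1 hz.2.2.2
    · filter_upwards [hlim] with z hz
      simp only [E0, dif_pos hz]
      exact hz.choose_spec
  refine ⟨_, (h1.add hl).congr' ?_⟩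
  filter_upwards [self_mem_nhdsWithin] with ε hε
  rw [e1 ε hε]; ring
end smear

section pvm
variable {n : ℕ} {γ : EV n → EW n} {ι : EV n →ₗᵢ[ℝ] EW n} {η : ℝ}
  {K : EW n → ℝ} {C : ℝ}

lemma ev_const {Z : Type*} [MeasurableSpace Z] (μ : Measure Z) (K : EW n → ℝ) (w : Z → EW n) (x : EW n) (g : Z → ℝ) {c : ℝ} (hc : 0 < c)
    (hz : ∀ᵐ z ∂μ, g z = 0 ∨ c ≤ ‖w z - x‖) : ∃ l, Tendsto (fun ε => ∫ z, Ke K ε (w z - x) * g z ∂μ) (𝓝[>] 0) (𝓝 l) := by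
  refine ⟨∫ z, K (w z - x) * g z ∂μ, tendsto_const_nhds.congr' ?_⟩
  filter_upwards [Ioc_mem_nhdsGT (half_pos hc)] with ε hε
  refine integral_congr_ae ?_
  filter_upwards [hz] with z hz
  rcases hz with hz | hz
  · simp only [hz, mul_zero]
  · simp only [Ke_eq (K := K) hε.1 (show 2 * ε ≤ ‖w z - x‖ by linarith [hε.2])]

lemma ev_const' {Z : Type*} [MeasurableSpace Z] (μ : Measure Z) (K : EW n → ℝ) (w : Z → EW n) (x : EW n) {c : ℝ} (hc : 0 < c)
    (hz : ∀ᵐ z ∂μ, c ≤ ‖w z - x‖) : ∃ l, Tendsto (fun ε => ∫ z, Ke K ε (w z - x) ∂μ) (𝓝[>] 0) (𝓝 l) := by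
  simpa using ev_const μ K w x (fun _ => 1) hc (hz.mono fun z hz => Or.inr hz)

lemma Ke_intm (hK : CZK n K C) {Z : Type*} [MeasurableSpace Z] (μ : Measure Z) [IsFiniteMeasure μ] {w : Z → EW n} (hw : Measurable w) (x : EW n) {ε : ℝ} (hε : 0 < ε) :
    Integrable (fun z => Ke K ε (w z - x)) μ :=
  Integrable.of_bound ((Ke_meas hK).comp (hw.sub_const x)).aestronglyMeasurable (C / ε ^ n) (ae_of_all _ fun _ => Ke_bd2 hK hε _)

lemma pv_add (hK : CZK n K C) {Z : Type*} [MeasurableSpace Z] (μ μ' : Measure Z) [IsFiniteMeasure μ] [IsFiniteMeasure μ'] {w : Z → EW n} (hw : Measurable w) (x : EW n)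
    (h1 : ∃ l, Tendsto (fun ε => ∫ z, Ke K ε (w z - x) ∂μ) (𝓝[>] 0) (𝓝 l))
    (h2 : ∃ l, Tendsto (fun ε => ∫ z, Ke K ε (w z - x) ∂μ') (𝓝[>] 0) (𝓝 l)) :
    ∃ l, Tendsto (fun ε => ∫ z, Ke K ε (w z - x) ∂(μ + μ')) (𝓝[>] 0) (𝓝 l) := by
  obtain ⟨l, hl⟩ := h1
  obtain ⟨l', hl'⟩ := h2
  refine ⟨l + l', (hl.add hl').congr' ?_⟩
  filter_upwards [self_mem_nhdsWithin] with ε hε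
  rw [integral_add_measure (Ke_intm hK μ hw x hε) (Ke_intm hK μ' hw x hε)]

lemma pv_bi (hK : CZK n K C) (h : NearIso γ ι η) {g : EV n → ℝ} (hg : Measurable g) {M : ℝ} (hM : ∀ s, |g s| ≤ M) (hi : Integrable g) :
    ∀ᵐ s, ∃ l, Tendsto (fun ε => ∫ t, Ke K ε (γ t - γ s) * g t) (𝓝[>] 0) (𝓝 l) := by
  have hM0 : 0 ≤ M := (abs_nonneg _).trans (hM 0)
  have hk := fun m : ℕ => pv_bdd hK h (g := (closedBall 0 m).indicator g) (hg.indicator measurableSet_closedBall) (M := M)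
    (fun s => by by_cases hs : s ∈ closedBall (0 : EV n) m <;> simp only [indicator_of_mem, indicator_of_notMem, hs, not_false_iff, hM, abs_zero, hM0])
    (R := m) (fun s hs => indicator_of_notMem hs _)
  filter_upwards [ae_all_iff.2 hk] with s hs
  obtain ⟨m, hm⟩ := exists_nat_ge (‖s‖ + 1)
  obtain ⟨l, hl⟩ := hs m
  obtain ⟨l', hl'⟩ := ev_const volume K γ (γ s) ((closedBall 0 m)ᶜ.indicator g) (c := 1 / 2) (by norm_num) (ae_of_all _ fun t => by
    by_cases ht : t ∈ closedBall (0 : EV n) m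
    · left; simp [ht]
    · right
      have h1 := h.low t s
      rw [mem_closedBall_zero_iff, not_le] at ht
      have := norm_sub_norm_le t s
      linarith)
  refine ⟨l + l', (hl.add hl').congr' ?_⟩
  filter_upwards [self_mem_nhdsWithin] with ε hε
  rw [← integral_add (Ke_int hK h.cont hε s (hi.indicator measurableSet_closedBall)) (Ke_int hK h.cont hε s (hi.indicator measurableSet_closedBall.compl))]
  congr 1; funext t
  rw [← mul_add, indicator_self_add_compl_apply]

lemma pv_dens (hK : CZK n K C) (h : NearIso γ ι η) (σ : Measure (EV n)) [IsFiniteMeasure σ] {c : ℝ≥0} (hc : σ ≤ c • volume) :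
    ∀ᵐ s, ∃ l, Tendsto (fun ε => ∫ t, Ke K ε (γ t - γ s) ∂σ) (𝓝[>] 0) (𝓝 l) := by
  set μ : Measure (EV n) := c • volume
  have hac : σ ≪ μ := Measure.absolutelyContinuous_of_le hc
  have h1 := Measure.rnDeriv_le_one_of_le hc
  set g : EV n → ℝ := fun t => min 1 (σ.rnDeriv μ t).toReal
  have hgm : Measurable g := measurable_const.min (σ.measurable_rnDeriv μ).ennreal_toReal
  have hg0 : ∀ t, 0 ≤ g t := fun t => le_min zero_le_one ENNReal.toReal_nonneg
  have hge : ∀ᵐ t ∂μ, (σ.rnDeriv μ t).toReal = g t := by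
    filter_upwards [h1] with t ht
    exact (min_eq_right (ENNReal.toReal_le_of_le_ofReal zero_le_one (by simpa using ht))).symm
  have key : ∀ F : EV n → ℝ, ∫ t, F t ∂σ = c * ∫ t, F t * g t := fun F => by
    conv_lhs => rw [← Measure.withDensity_rnDeriv_eq σ μ hac]
    rw [integral_withDensity_eq_integral_toReal_smul (σ.measurable_rnDeriv μ) (σ.rnDeriv_lt_top μ)]
    rw [integral_congr_ae (g := fun t => F t * g t) (by filter_upwards [hge] with t ht; rw [ht, smul_eq_mul, mul_comm])]
    simp only [μ]
    rw [integral_smul_nnreal_measure]; rfl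
  have hgi : Integrable g μ := (Measure.integrable_toReal_rnDeriv (μ := σ) (ν := μ)).congr hge
  by_cases hc0 : c = 0
  · refine ae_of_all _ fun s => ⟨0, ?_⟩
    simp_rw [key, hc0]; simp
  have hgi' : Integrable g := (integrable_smul_measure (c := (c : ℝ≥0∞)) (by simpa using hc0) (by simp)).1 hgi
  filter_upwards [pv_bi hK h hgm (M := 1) (fun t => by rw [abs_of_nonneg (hg0 t)]; exact min_le_left _ _) hgi'] with s ⟨l, hl⟩
  exact ⟨c * l, by simp_rw [key]; exact hl.const_mul _⟩

def FM (σ : Measure (EV n)) (M : ℝ) : Set (EV n) := {s | ∀ r > 0, σ (closedBall s r) ≤ ofReal (M * r ^ n)}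

lemma FM_closed (σ : Measure (EV n)) (M : ℝ) : IsClosed (FM σ M) := by
  refine isClosed_of_closure_subset fun s hs r hr => ?_
  have h1 : Tendsto (fun ε : ℝ => ofReal (M * (r + ε) ^ n)) (𝓝[>] 0) (𝓝 (ofReal (M * (r + 0) ^ n))) :=
    ((ENNReal.continuous_ofReal.comp (by fun_prop : Continuous fun ε : ℝ => M * (r + ε) ^ n)).tendsto 0).mono_left nhdsWithin_le_nhds
  rw [add_zero] at h1
  refine ge_of_tendsto h1 ?_
  filter_upwards [self_mem_nhdsWithin] with ε hε
  obtain ⟨s', hs', hd⟩ := Metric.mem_closure_iff.1 hs ε hε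
  exact (measure_mono (closedBall_subset_closedBall' (by linarith))).trans (hs' (r + ε) (add_pos hr hε))

lemma bn_pos : 0 < bn n := by
  have := vol_ball_eq (0 : EV n) one_pos
  by_contra hb
  rw [ofReal_of_nonpos (by simpa using hb)] at this
  exact (measure_closedBall_pos volume (0 : EV n) one_pos).ne' this

lemma FM_ae (σ : Measure (EV n)) [IsFiniteMeasure σ] : ∀ᵐ s, ∃ M : ℕ, s ∈ FM σ M := by
  filter_upwards [Besicovitch.ae_tendsto_rnDeriv σ volume, σ.rnDeriv_lt_top volume] with s hs hlt
  obtain ⟨A, hA1, hA2⟩ := exists_between hlt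
  have hev := hs.eventually (gt_mem_nhds hA1)
  obtain ⟨r0, hr0, hr⟩ := mem_nhdsGT_iff_exists_Ioo_subset.1 hev
  have hr0 : 0 < r0 := hr0
  have hb := bn_pos (n := n)
  obtain ⟨M, hM⟩ := exists_nat_ge (A.toReal * bn n + (σ univ).toReal / r0 ^ n)
  refine ⟨M, fun r hr' => ?_⟩
  have p1 : 0 ≤ A.toReal * bn n := by positivity
  have p2 : 0 ≤ (σ univ).toReal / r0 ^ n := by positivity
  rcases lt_or_ge r r0 with hlt' | hge
  · have := hr ⟨hr', hlt'⟩
    have := (ENNReal.div_le_iff (measure_closedBall_pos volume s hr').ne' measure_closedBall_lt_top.ne).1 (le_of_lt this)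
    refine this.trans ?_
    rw [vol_ball_eq s hr', ← ofReal_toReal hA2.ne, ← ofReal_mul (by positivity), ← mul_assoc]
    gcongr; linarith
  · refine (measure_mono (subset_univ _)).trans ?_
    rw [← ofReal_toReal (measure_ne_top σ univ)]
    refine ofReal_le_ofReal ?_
    calc (σ univ).toReal = (σ univ).toReal / r0 ^ n * r0 ^ n := by field_simp
      _ ≤ M * r ^ n := by gcongr; linarith

lemma FM_dens (σ : Measure (EV n)) [IsFiniteMeasure σ] (M : ℕ) : ∃ c : ℝ≥0, σ.restrict (FM σ M) ≤ c • volume := by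
  have hb := bn_pos (n := n)
  refine ⟨(M / bn n).toNNReal, Measure.le_iff.2 fun A hA => ?_⟩
  rw [Measure.restrict_apply hA]
  refine ((Besicovitch.vitaliFamily σ).measure_le_of_frequently_le (ρ := σ) ((M / bn n).toNNReal • volume) Measure.AbsolutelyContinuous.rfl _ fun x hx => ?_).trans (measure_mono inter_subset_left)
  refine (Besicovitch.tendsto_filterAt σ x).frequently (Eventually.frequently ?_)
  filter_upwards [self_mem_nhdsWithin] with r hr
  refine (hx.2 r hr).trans_eq ?_
  rw [Measure.smul_apply, vol_ball_eq x hr, ENNReal.smul_def, smul_eq_mul, ← ofReal, ← ofReal_mul (by positivity)]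
  congr 1; field_simp

lemma SG_bd (σ : Measure (EV n)) [IsFiniteMeasure σ] (M : ℕ) (hne : (FM σ M).Nonempty) (t : EV n) :
    |SG (σ.restrict (FM σ M)ᶜ) id (fun z => min 1 (infDist z (FM σ M) / 8)) t| ≤ cps n * (27 ^ n * M + (σ univ).toReal) := by
  have hcp := cps_pos (n := n)
  set F := FM σ M with hF
  set δ := infDist t F with hδ
  have hδ0 : 0 ≤ δ := infDist_nonneg
  have hpos : ∀ z ∈ Fᶜ, 0 < infDist z F := fun z hz => ((FM_closed σ M).notMem_iff_infDist_pos hne).1 hz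
  have hd : ∀ z, |infDist z F - δ| ≤ ‖t - z‖ := fun z => by
    have h1 := infDist_le_infDist_add_dist (s := F) (x := z) (y := t)
    have h2 := infDist_le_infDist_add_dist (s := F) (x := t) (y := z)
    rw [dist_comm, dist_eq_norm] at h1
    rw [dist_eq_norm] at h2
    exact abs_le.2 ⟨by linarith, by linarith⟩
  set ρ := min 1 (δ / 9)
  set R := δ / 7
  have hB : |SG (σ.restrict Fᶜ) id (fun z => min 1 (infDist z F / 8)) t| ≤ cps n / ρ ^ n * (σ (closedBall t R)).toReal := by
    unfold SG
    rw [← norm_eq_abs]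
    have hi : Integrable ((closedBall t R).indicator fun _ => cps n / ρ ^ n) (σ.restrict Fᶜ) := (integrable_const _).indicator measurableSet_closedBall
    refine (norm_integral_le_of_norm_le hi ?_).trans ?_
    · rw [ae_restrict_iff' (FM_closed σ M).measurableSet.compl]
      refine ae_of_all _ fun z hz => ?_
      have hz0 := hpos z hz
      set D := min 1 (infDist z F / 8)
      have hD : 0 < D := lt_min one_pos (by positivity)
      have hDle : D ≤ infDist z F / 8 := min_le_right _ _
      rw [norm_eq_abs, abs_of_nonneg (bump_nonneg hD _ _)]
      rcases le_or_gt D ‖t - z‖ with ht | ht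
      · rw [id, bump_zero hD ht]; exact indicator_nonneg (fun _ _ => by positivity) _
      · have h3 := abs_le.1 (hd z)
        have hin : z ∈ closedBall t R := by
          rw [mem_closedBall', dist_eq_norm]; simp only [R]; linarith
        rw [indicator_of_mem hin]
        refine (bump_le hD _ _).trans ?_
        have hρ : 0 < ρ := lt_min one_pos (by linarith)
        gcongr
        refine le_min (min_le_left _ _) ((min_le_right _ _).trans ?_)
        linarith
    · rw [integral_indicator_const _ measurableSet_closedBall, smul_eq_mul, mul_comm]
      gcongr
      simp only [Measure.real]
      exact ENNReal.toReal_mono (measure_ne_top _ _) (Measure.restrict_le_self _)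
  refine hB.trans ?_
  have p1 : 0 ≤ (σ univ).toReal := ENNReal.toReal_nonneg
  have p2 : (0 : ℝ) ≤ 27 ^ n * M := by positivity
  rcases hδ0.eq_or_lt with h0 | h0
  · by_cases hn0 : n = 0
    · subst hn0
      rw [pow_zero, div_one]
      gcongr
      refine (ENNReal.toReal_mono (measure_ne_top _ _) (measure_mono (subset_univ _))).trans (by linarith)
    · have : ρ = 0 := by simp only [ρ]; rw [← h0]; simp
      rw [this, zero_pow hn0, div_zero, zero_mul]; positivity
  rcases le_or_gt 9 δ with h9 | h9
  · have : ρ = 1 := min_eq_left (by linarith)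
    rw [this, one_pow, div_one]
    gcongr
    refine (ENNReal.toReal_mono (measure_ne_top _ _) (measure_mono (subset_univ _))).trans (by linarith)
  · have hρ : ρ = δ / 9 := min_eq_right (by linarith)
    obtain ⟨s, hs, hts⟩ := (infDist_lt_iff (x := t) (r := 2 * δ) hne).1 (by linarith)
    have h1 : σ (closedBall t R) ≤ ofReal (M * (3 * δ) ^ n) :=
      (measure_mono (closedBall_subset_closedBall' (by simp only [R]; linarith))).trans (hs (3 * δ) (by linarith))
    have h2 := ENNReal.toReal_le_of_le_ofReal (by positivity) h1
    calc _ ≤ cps n / ρ ^ n * (M * (3 * δ) ^ n) := by have : 0 < ρ := by rw [hρ]; positivity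
                                                     gcongr
      _ = cps n * (27 ^ n * M) := by
        rw [hρ, div_pow, mul_pow, show (27 : ℝ) = 9 * 3 by norm_num, mul_pow]; field_simp
      _ ≤ _ := by gcongr; linarith

theorem pvV (hK : CZK n K C) (h : NearIso γ ι η) (σ : Measure (EV n)) [IsFiniteMeasure σ] :
    ∀ᵐ s, ∃ l, Tendsto (fun ε => ∫ t, Ke K ε (γ t - γ s) ∂σ) (𝓝[>] 0) (𝓝 l) := by
  have key : ∀ M : ℕ, ∀ᵐ s, s ∈ FM σ M → ∃ l, Tendsto (fun ε => ∫ t, Ke K ε (γ t - γ s) ∂σ) (𝓝[>] 0) (𝓝 l) := fun M => by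
    rcases (FM σ M).eq_empty_or_nonempty with he | hne
    · exact ae_of_all _ fun s hs => by rw [he] at hs; exact hs.elim
    set F := FM σ M with hF
    have hFm : MeasurableSet F := (FM_closed σ M).measurableSet
    obtain ⟨c, hc⟩ := FM_dens σ M
    set D : EV n → ℝ := fun z => min 1 (infDist z F / 8)
    have hDm : Measurable D := measurable_const.min (measurable_infDist.div_const 8)
    have h0 : ∀ᵐ z ∂(σ.restrict Fᶜ), 0 < D z := by
      rw [ae_restrict_iff' hFm.compl]
      refine ae_of_all _ fun z hz => lt_min one_pos ?_
      have := ((FM_closed σ M).notMem_iff_infDist_pos hne).1 hz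
      positivity
    filter_upwards [pv_dens hK h _ hc, ae_Gd hK h, pk_ae (σ.restrict Fᶜ) measurable_id hDm h0,
      pv_bi hK h (SG_meas _ measurable_id hDm) (SG_bd σ M hne) (SG_int _ measurable_id hDm h0)] with s h1 h2 h3 h4 hsF
    have h5 := smear hK h h2 (σ.restrict Fᶜ) h.cont.measurable measurable_id hDm (c1 := 0) (c2 := 1) le_rfl zero_le_one
      (by
        filter_upwards [h0] with z hz
        refine ⟨hz, min_le_left _ _, by simp, (min_le_right _ _).trans ?_⟩
        have e1 : infDist z F ≤ ‖z - s‖ := by rw [← dist_eq_norm]; exact infDist_le_dist_of_mem hsF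
        have := h.low z s
        linarith [norm_nonneg (γ z - γ s)]) h3 h4
    have := pv_add hK _ _ h.cont.measurable (γ s) h1 h5
    rwa [Measure.restrict_add_restrict_compl hFm] at this
  filter_upwards [ae_all_iff.2 key, FM_ae σ] with s hs ⟨M, hM⟩ using hs M hM

lemma exists_q (h : NearIso γ ι η) : ∃ (L : ℝ≥0) (q : EW n → EV n), LipschitzWith L q ∧ ∀ s, q (γ s) = s := by
  have hinj : Function.Injective γ := fun s t hst => by
    have := h.low s t
    rw [hst, sub_self, norm_zero, mul_zero] at this
    exact sub_eq_zero.1 (norm_le_zero_iff.1 this)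
  have hl : LipschitzOnWith 2 (Function.invFun γ) (range γ) := LipschitzOnWith.of_dist_le_mul fun x hx y hy => by
    obtain ⟨s, rfl⟩ := hx
    obtain ⟨t, rfl⟩ := hy
    rw [Function.leftInverse_invFun hinj s, Function.leftInverse_invFun hinj t, dist_eq_norm, dist_eq_norm]
    exact h.low s t
  obtain ⟨q, hq, he⟩ := hl.extend_finite_dimension
  exact ⟨_, q, hq, fun s => (he (mem_range_self s)).symm.trans (Function.leftInverse_invFun hinj s)⟩

theorem pv_meas (hK : CZK n K C) (h : NearIso γ ι η) (σ : Measure (EW n)) [IsFiniteMeasure σ] :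
    ∀ᵐ s, ∃ l, Tendsto (fun ε => ∫ z, Ke K ε (z - γ s) ∂σ) (𝓝[>] 0) (𝓝 l) := by
  obtain ⟨L, q, hq, hqγ⟩ := exists_q h
  set d : EW n → ℝ := fun z => ‖z - γ (q z)‖ with hd
  have hqm := hq.continuous.measurable
  have hdm : Measurable d := (measurable_id.sub (h.cont.measurable.comp hqm)).norm
  have hdle : ∀ z s, d z ≤ (1 + 2 * L) * ‖z - γ s‖ := fun z s => by
    have h1 := h.up s (q z)
    have h2 := hq.dist_le_mul (γ s) z
    rw [hqγ, dist_eq_norm, dist_eq_norm, norm_sub_rev (γ s)] at h2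
    have h3 := norm_sub_le_norm_sub_add_norm_sub z (γ s) (γ (q z))
    simp only [hd]
    linarith
  have hA : MeasurableSet {z | d z ≤ 1} := measurableSet_le hdm measurable_const
  have hA0 : MeasurableSet {z | d z = 0} := measurableSet_eq_fun hdm measurable_const
  set σ' := σ.restrict {z | d z ≤ 1}
  set σ1 := σ'.restrict {z | d z = 0}ᶜ
  have hz1 : ∀ᵐ z ∂σ1, 0 < d z ∧ d z ≤ 1 := by
    have a1 : ∀ᵐ z ∂σ1, d z ≤ 1 := ae_restrict_of_ae (ae_restrict_mem hA)
    have a2 : ∀ᵐ z ∂σ1, z ∈ {z | d z = 0}ᶜ := ae_restrict_mem hA0.compl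
    filter_upwards [a1, a2] with z h1 h2 using ⟨lt_of_le_of_ne (norm_nonneg _) (Ne.symm h2), h1⟩
  have h0 : ∀ᵐ z ∂σ1, 0 < d z := hz1.mono fun z hz => hz.1
  have hSi := SG_int σ1 hqm hdm h0
  have hSm := SG_meas σ1 hqm hdm
  have hfin : IsFiniteMeasure ((volume : Measure (EV n)).withDensity fun t => ofReal (SG σ1 q d t)) :=
    isFiniteMeasure_withDensity_ofReal hSi.2
  filter_upwards [pvV hK h ((σ'.restrict {z | d z = 0}).map q), ae_Gd hK h, pk_ae σ1 hqm hdm h0,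
    pvV hK h ((volume : Measure (EV n)).withDensity fun t => ofReal (SG σ1 q d t))] with s g1 g2 g3 g4
  have k0 : ∃ l, Tendsto (fun ε => ∫ z, Ke K ε (z - γ s) ∂(σ'.restrict {z | d z = 0})) (𝓝[>] 0) (𝓝 l) := by
    obtain ⟨l, hl⟩ := g1
    refine ⟨l, hl.congr fun ε => ?_⟩
    rw [integral_map (f := fun t => Ke K ε (γ t - γ s)) hqm.aemeasurable ((Ke_meas hK).comp (h.cont.measurable.sub_const _)).aestronglyMeasurable]
    refine integral_congr_ae ?_
    filter_upwards [ae_restrict_mem hA0] with z hz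
    rw [← sub_eq_zero.1 (norm_eq_zero.1 hz)]
  have k1 : ∃ l, Tendsto (fun ε => ∫ z, Ke K ε (z - γ s) ∂σ1) (𝓝[>] 0) (𝓝 l) := by
    refine smear hK h g2 σ1 measurable_id hqm hdm (c1 := 1) (c2 := 1 + 2 * L) zero_le_one (by positivity) ?_ g3 ?_
    · filter_upwards [hz1] with z hz using ⟨hz.1, hz.2, by simp [hd], hdle z s⟩
    · obtain ⟨l, hl⟩ := g4
      refine ⟨l, hl.congr fun ε => ?_⟩
      rw [integral_withDensity_eq_integral_toReal_smul hSm.ennreal_ofReal (ae_of_all _ fun _ => ofReal_lt_top)]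
      congr 1; funext t
      rw [ENNReal.toReal_ofReal (SG_nonneg _ h0 t), smul_eq_mul, mul_comm]
  have k2 : ∃ l, Tendsto (fun ε => ∫ z, Ke K ε (z - γ s) ∂(σ.restrict {z | d z ≤ 1}ᶜ)) (𝓝[>] 0) (𝓝 l) := by
    refine ev_const' _ K id (γ s) (c := 1 / (1 + 2 * L)) (by positivity) ?_
    filter_upwards [ae_restrict_mem hA.compl] with z hz
    have : 1 < d z := not_le.1 hz
    rw [div_le_iff₀ (by positivity), mul_comm]
    exact this.le.trans (hdle z s)
  have k3 := pv_add hK _ _ measurable_id (γ s) k0 k1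
  rw [Measure.restrict_add_restrict_compl hA0] at k3
  have k4 := pv_add hK _ _ measurable_id (γ s) k3 k2
  rwa [Measure.restrict_add_restrict_compl hA] at k4

end pvm

section flat
variable {n : ℕ} {ι : EV n →ₗᵢ[ℝ] EW n} {η : ℝ} {K : EW n → ℝ} {C : ℝ}

lemma dK2 (hK : CZK n K C) {x y : EW n} {m B : ℝ} (hm : 0 < m) (hx : m ≤ ‖x‖) (hy : m ≤ ‖y‖) (hB : ‖x - y‖ ≤ B) :
    |K x - K y| ≤ 4 * C * B / m ^ (n + 1) := by
  have hC := hK.one_le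
  have hB0 : 0 ≤ B := (norm_nonneg _).trans hB
  by_cases h : ‖x - y‖ ≤ ‖x‖ / 2
  · refine (hK.lip x y h).trans ?_
    have : C * ‖x - y‖ ≤ 4 * C * B := by nlinarith [mul_le_mul_of_nonneg_left hB (by linarith : 0 ≤ C), mul_nonneg (by linarith : 0 ≤ C) hB0]
    gcongr
  · have h1 : |K x| ≤ C / m ^ n := (hK.bd x).trans (by gcongr)
    have h2 : |K y| ≤ C / m ^ n := (hK.bd y).trans (by gcongr)
    refine (abs_sub _ _).trans ((add_le_add h1 h2).trans ?_)
    rw [pow_succ, ← add_div, div_le_div_iff₀ (by positivity) (by positivity)]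
    have : m ≤ 2 * B := by linarith
    calc (C + C) * (m ^ n * m) ≤ (C + C) * (m ^ n * (2 * B)) := by gcongr
      _ = _ := by ring

lemma shift0 (hn : 1 ≤ n) {f : EV n → ℝ} (hf : Measurable f) {A : ℝ} (hA : ∀ u, |f u| ≤ A / (1 + ‖u‖) ^ n) (v : EV n)
    (hi : Integrable fun u => f (u + v) - f u) : ∫ u, (f (u + v) - f u) = 0 := by
  have hA0 : 0 ≤ A := by have := (abs_nonneg _).trans (hA 0); simpa using this
  have hfb : ∀ u, |f u| ≤ A := fun u => (hA u).trans (div_le_self hA0 (one_le_pow₀ (by linarith [norm_nonneg u])))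
  have hψ : ∀ R : ℝ, 0 < R → Integrable fun u : EV n => tent0 (R⁻¹ • u) := fun R hR => (integrable_comp_smul_iff volume _ (inv_ne_zero hR.ne')).2 tent0_int
  have hψi : ∀ R : ℝ, 0 < R → Integrable fun u : EV n => f u * tent0 (R⁻¹ • u) := fun R hR =>
    (hψ R hR).bdd_mul (c := A) hf.aestronglyMeasurable (ae_of_all _ hfb)
  have hψj : ∀ R : ℝ, 0 < R → Integrable fun u : EV n => f u * tent0 (R⁻¹ • (u - v)) := fun R hR =>
    ((hψ R hR).comp_sub_right v).bdd_mul (c := A) hf.aestronglyMeasurable (ae_of_all _ hfb)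
  have l1 : Tendsto (fun R : ℝ => ∫ u, (f (u + v) - f u) * tent0 (R⁻¹ • u)) atTop (𝓝 (∫ u, (f (u + v) - f u) * 1)) := by
    refine tendsto_integral_filter_of_dominated_convergence (fun u => |f (u + v) - f u|) ?_ ?_ hi.abs ?_
    · refine Eventually.of_forall fun R => hi.aestronglyMeasurable.mul (tent0_cont.comp (continuous_const_smul R⁻¹)).aestronglyMeasurable
    · refine Eventually.of_forall fun R => ae_of_all _ fun u => ?_
      rw [norm_eq_abs, abs_mul, abs_of_nonneg (tent0_nonneg _)]
      exact mul_le_of_le_one_right (abs_nonneg _) (tent0_le _)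
    · refine ae_of_all _ fun u => Tendsto.const_mul _ ?_
      have : Tendsto (fun R : ℝ => tent0 (R⁻¹ • u)) atTop (𝓝 (tent0 ((0 : ℝ) • u))) :=
        (tent0_cont.tendsto _).comp (tendsto_inv_atTop_zero.smul_const u)
      simpa [tent0] using this
  have l2 : Tendsto (fun R : ℝ => ∫ u : EV n, A * ‖v‖ * (if ‖u‖ < 2 then R ^ n / (1 + R * ‖u‖) ^ n / R else 0)) atTop (𝓝 (∫ u : EV n, 0)) := by
    refine tendsto_integral_filter_of_dominated_convergence (fun u => A * ‖v‖ * (if ‖u‖ < 2 then ‖u‖ / ‖u‖ ^ n else 0)) ?_ ?_ ((loc_int hn 2).const_mul _) ?_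
    · exact Eventually.of_forall fun R => (measurable_const.mul (Measurable.ite (measurableSet_lt measurable_norm measurable_const) (by fun_prop) measurable_const)).aestronglyMeasurable
    · filter_upwards [eventually_gt_atTop 0] with R hR
      have : ∀ᵐ u : EV n, u ≠ 0 := by
        have : Nontrivial (EV n) := by have : Nonempty (Fin n) := ⟨⟨0, hn⟩⟩; infer_instance
        exact Measure.ae_ne volume 0
      filter_upwards [this] with u hu
      have hu0 := norm_pos_iff.2 hu
      rw [norm_of_nonneg (mul_nonneg (by positivity) (by split_ifs <;> positivity))]
      refine mul_le_mul_of_nonneg_left ?_ (by positivity)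
      split_ifs with h2
      · rw [div_div, div_le_div_iff₀ (by positivity) (by positivity), ← mul_pow]
        obtain ⟨k, rfl⟩ : ∃ k, n = k + 1 := ⟨n - 1, by omega⟩
        have : (R * ‖u‖) ^ k ≤ (1 + R * ‖u‖) ^ (k + 1) := by
          have h1 : (R * ‖u‖) ^ k ≤ (1 + R * ‖u‖) ^ k := by gcongr; linarith
          exact h1.trans (pow_le_pow_right₀ (by nlinarith) (by omega))
        calc (R * ‖u‖) ^ (k + 1) = (R * ‖u‖) ^ k * (R * ‖u‖) := pow_succ _ _
          _ ≤ (1 + R * ‖u‖) ^ (k + 1) * (R * ‖u‖) := by gcongr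
          _ = _ := by ring
      · exact le_rfl
    · have : ∀ᵐ u : EV n, u ≠ 0 := by
        have : Nontrivial (EV n) := by have : Nonempty (Fin n) := ⟨⟨0, hn⟩⟩; infer_instance
        exact Measure.ae_ne volume 0
      filter_upwards [this] with u hu
      have hu0 := norm_pos_iff.2 hu
      have hb : Tendsto (fun R : ℝ => A * ‖v‖ * ((‖u‖ ^ n)⁻¹ * R⁻¹)) atTop (𝓝 0) := by
        have := (tendsto_inv_atTop_zero (𝕜 := ℝ)).const_mul (A * ‖v‖ * (‖u‖ ^ n)⁻¹)
        rw [mul_zero] at this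
        exact this.congr fun R => by ring
      refine tendsto_of_tendsto_of_tendsto_of_le_of_le' tendsto_const_nhds hb ?_ ?_
      · filter_upwards [eventually_gt_atTop 0] with R hR
        exact mul_nonneg (by positivity) (by split_ifs <;> positivity)
      · filter_upwards [eventually_gt_atTop 0] with R hR
        refine mul_le_mul_of_nonneg_left ?_ (by positivity)
        split_ifs with h2
        · rw [div_eq_mul_inv]
          gcongr
          rw [inv_eq_one_div, div_le_div_iff₀ (by positivity) (by positivity), one_mul, ← mul_pow]
          gcongr; linarith
        · positivity
  rw [integral_zero] at l2
  have l3 : Tendsto (fun R : ℝ => ∫ u, (f (u + v) - f u) * tent0 (R⁻¹ • u)) atTop (𝓝 0) := by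
    refine squeeze_zero_norm' ?_ l2
    filter_upwards [eventually_gt_atTop 0, eventually_gt_atTop ‖v‖] with R hR hRv
    have e1 : ∫ u, (f (u + v) - f u) * tent0 (R⁻¹ • u) = ∫ u, f u * (tent0 (R⁻¹ • (u - v)) - tent0 (R⁻¹ • u)) := by
      have i1 : Integrable fun u => f (u + v) * tent0 (R⁻¹ • u) := by
        have := (hψj R hR).comp_add_right v
        simpa using this
      have e2 := integral_add_right_eq_self (μ := volume) (fun u => f u * tent0 (R⁻¹ • (u - v))) v
      simp only [add_sub_cancel_right] at e2
      simp_rw [sub_mul, mul_sub]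
      rw [integral_sub i1 (hψi R hR), integral_sub (hψj R hR) (hψi R hR), e2]
    have e3 := int_aff (fun u => f u * (tent0 (R⁻¹ • (u - v)) - tent0 (R⁻¹ • u))) 0 hR
    have e4 : ∫ u, (f (u + v) - f u) * tent0 (R⁻¹ • u) = ∫ u, R ^ n * (f (0 + R • u) * (tent0 (R⁻¹ • (0 + R • u - v)) - tent0 (R⁻¹ • (0 + R • u)))) := by
      rw [e1, integral_const_mul, e3]; field_simp
    rw [e4]
    refine norm_integral_le_of_norm_le ?_ (ae_of_all _ fun u => ?_)
    · refine Integrable.const_mul ?_ _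
      refine Integrable.mono' (g := fun u : EV n => if ‖u‖ < 2 then R ^ n / R else 0) ?_ (Measurable.ite (measurableSet_lt measurable_norm measurable_const) (by fun_prop) measurable_const).aestronglyMeasurable (ae_of_all _ fun u => ?_)
      · have : (fun u : EV n => if ‖u‖ < 2 then R ^ n / R else 0) = (ball 0 2).indicator fun _ => R ^ n / R := by
          funext u; simp [indicator]
        rw [this]
        exact (integrable_indicator_iff measurableSet_ball).2 (integrableOn_const measure_ball_lt_top.ne)
      · have : 0 ≤ R * ‖u‖ := by positivity
        split_ifs
        · rw [norm_of_nonneg (by positivity)]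
          gcongr
          exact div_le_self (by positivity) (one_le_pow₀ (by linarith))
        · simp
    · rw [zero_add, smul_sub, smul_smul, inv_mul_cancel₀ hR.ne', one_smul]
      split_ifs with h2
      · have t1 := tent0_lip (u - R⁻¹ • v) u
        rw [sub_sub_cancel_left, norm_neg, norm_smul, norm_inv, norm_of_nonneg hR.le] at t1
        have t2 := hA (R • u)
        rw [norm_smul, norm_of_nonneg hR.le] at t2
        rw [norm_eq_abs, abs_mul, abs_mul, abs_of_pos (by positivity : 0 < R ^ n)]
        calc _ ≤ R ^ n * (A / (1 + R * ‖u‖) ^ n * (R⁻¹ * ‖v‖)) := by gcongr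
          _ = _ := by rw [div_eq_mul_inv _ R]; ring
      · rw [tent0_zero (by linarith : 1 ≤ ‖u‖), tent0_zero]
        · simp
        · have := norm_sub_norm_le u (R⁻¹ • v)
          rw [norm_smul, norm_inv, norm_of_nonneg hR.le] at this
          have : R⁻¹ * ‖v‖ ≤ 1 := by rw [inv_mul_le_one₀ hR]; exact hRv.le
          linarith
  have := tendsto_nhds_unique l1 l3
  simpa using this

def SK (K : EW n → ℝ) (D : EV n →L[ℝ] EW n) (e : EW n) : ℝ := ∫ u, (K (e - D u) + K (e + D u)) / 2

variable {D : EV n →L[ℝ] EW n}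

lemma SK_low (h : NearIso D ι η) {N e : EW n} (hN : ‖N‖ = 1) (hD : ∀ v, ⟪D v, N⟫ = 0) (he : 0 < ⟪e, N⟫) :
    ∃ c > 0, ∀ u, c * (1 + ‖u‖) ≤ ‖e - D u‖ ∧ c * (1 + ‖u‖) ≤ ‖e + D u‖ := by
  set l := ⟪e, N⟫ with hl
  refine ⟨(l⁻¹ + 2 + 2 * ‖e‖ * l⁻¹)⁻¹, by positivity, ?_⟩
  have key : ∀ u, (l⁻¹ + 2 + 2 * ‖e‖ * l⁻¹)⁻¹ * (1 + ‖u‖) ≤ ‖e - D u‖ := fun u => by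
    have h1 : l ≤ ‖e - D u‖ := by
      have := real_inner_le_norm (e - D u) N
      rw [inner_sub_left, hD, sub_zero, hN, mul_one] at this; exact this
    have h2 := h.low u 0
    rw [map_zero, sub_zero, sub_zero] at h2
    have h3 := norm_sub_norm_le (D u) e
    rw [norm_sub_rev] at h3
    have h4 : 1 ≤ l⁻¹ * ‖e - D u‖ := by rw [inv_mul_eq_div, one_le_div he]; exact h1
    rw [inv_mul_le_iff₀ (by positivity)]
    have h5 : ‖e‖ ≤ ‖e‖ * (l⁻¹ * ‖e - D u‖) := le_mul_of_one_le_right (norm_nonneg _) h4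
    nlinarith
  intro u
  refine ⟨key u, ?_⟩
  have := key (-u)
  rwa [map_neg, sub_neg_eq_add, norm_neg] at this

lemma pk_le_int {f : EV n → ℝ} (hf : Measurable f) {A : ℝ} (h : ∀ u, |f u| ≤ A / (1 + ‖u‖) ^ (n + 1)) : Integrable f :=
  (pk_int.const_mul A).mono' hf.aestronglyMeasurable (ae_of_all _ fun u => by
    rw [norm_eq_abs]; refine (h u).trans_eq ?_; unfold pk; rw [mul_one_div])

lemma SK_int (hK : CZK n K C) (h : NearIso D ι η) {N e : EW n} (hN : ‖N‖ = 1) (hD : ∀ v, ⟪D v, N⟫ = 0) (he : 0 < ⟪e, N⟫) :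
    Integrable fun u => (K (e - D u) + K (e + D u)) / 2 := by
  obtain ⟨c, hc, hl⟩ := SK_low h hN hD he
  have hKm := hK.meas
  have hDm := D.continuous.measurable
  refine Integrable.div_const (pk_le_int (A := 4 * C * (2 * ‖e‖) / c ^ (n + 1)) ((hKm.comp (by fun_prop)).add (hKm.comp (by fun_prop))) fun u => ?_) 2
  have e1 : K (e - D u) + K (e + D u) = K (e - D u) - K (-(e + D u)) := by rw [hK.odd]; ring
  simp only [Pi.add_apply, Function.comp_apply]
  rw [e1]
  refine (dK2 hK (m := c * (1 + ‖u‖)) (B := 2 * ‖e‖) (by positivity) (hl u).1 (by rw [norm_neg]; exact (hl u).2) ?_).trans_eq ?_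
  · rw [show e - D u - -(e + D u) = (2 : ℝ) • e by rw [two_smul]; abel, norm_smul]; simp
  · rw [mul_pow, div_div]

lemma SK_smul (hK : CZK n K C) (D : EV n →L[ℝ] EW n) (e : EW n) {t : ℝ} (ht : 0 < t) : SK K D (t • e) = SK K D e := by
  have h1 := int_aff (fun u => (K (t • e - D u) + K (t • e + D u)) / 2) 0 ht
  simp only [zero_add, map_smul, ← smul_sub, ← smul_add, hK.hom _ _ ht] at h1
  have h2 : ∀ u, (K (e - D u) / t ^ n + K (e + D u) / t ^ n) / 2 = (t ^ n)⁻¹ * ((K (e - D u) + K (e + D u)) / 2) := fun u => by ring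
  simp_rw [h2] at h1
  rw [integral_const_mul] at h1
  exact (mul_left_cancel₀ (by positivity) h1).symm

lemma SK_neg (hK : CZK n K C) (D : EV n →L[ℝ] EW n) (e : EW n) : SK K D (-e) = -SK K D e := by
  unfold SK
  rw [← integral_neg]
  congr 1; funext u
  rw [show -e - D u = -(e + D u) by abel, show -e + D u = -(e - D u) by abel, hK.odd, hK.odd]; ring

lemma SK_shift (hK : CZK n K C) (h : NearIso D ι η) {N e : EW n} (hN : ‖N‖ = 1) (hD : ∀ v, ⟪D v, N⟫ = 0) (he : 0 < ⟪e, N⟫) (v : EV n) :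
    SK K D (e + D v) = SK K D e := by
  have hKm := hK.meas
  have hDm := D.continuous.measurable
  have hC := hK.one_le
  have he' : 0 < ⟪e + D v, N⟫ := by rwa [inner_add_left, hD, add_zero]
  obtain ⟨c, hc, hl⟩ := SK_low h hN hD he
  obtain ⟨c', hc', hl'⟩ := SK_low h hN hD he'
  have key : ∀ w : EV n, ∀ D' : EV n →L[ℝ] EW n, (∀ u, c * (1 + ‖u‖) ≤ ‖e + D' u‖) → (∀ u, c' * (1 + ‖u‖) ≤ ‖e + D v + D' u‖) → D' w = D v →
      Integrable (fun u => K (e + D v + D' u) - K (e + D' u)) ∧ ∫ u, (K (e + D v + D' u) - K (e + D' u)) = 0 := by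
    intro w D' g1 g2 hw
    have hD' := D'.continuous.measurable
    have hi : Integrable fun u => K (e + D v + D' u) - K (e + D' u) := by
      refine pk_le_int (A := 4 * C * ‖D v‖ / (min c c') ^ (n + 1)) ((hKm.comp (by fun_prop)).sub (hKm.comp (by fun_prop))) fun u => ?_
      refine (dK2 hK (m := min c c' * (1 + ‖u‖)) (B := ‖D v‖) (by positivity) ?_ ?_ (by rw [show e + D v + D' u - (e + D' u) = D v by abel])).trans_eq (by rw [mul_pow, div_div])
      · exact (mul_le_mul_of_nonneg_right (min_le_right _ _) (by positivity)).trans (g2 u)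
      · exact (mul_le_mul_of_nonneg_right (min_le_left _ _) (by positivity)).trans (g1 u)
    refine ⟨hi, ?_⟩
    have ee : ∀ u, K (e + D v + D' u) = K (e + D' (u + w)) := fun u => by rw [map_add, hw]; congr 1; abel
    simp_rw [ee] at hi ⊢
    refine shift0 hK.one_le_n (f := fun u => K (e + D' u)) (hKm.comp (by fun_prop)) (A := C / c ^ n) (fun u => ?_) w hi
    refine (hK.bd _).trans ?_
    rw [div_div, ← mul_pow]
    have := g1 u
    gcongr
  have k1 := key v D (fun u => (hl u).2) (fun u => (hl' u).2) rfl
  have k2 := key (-v) (-D) (fun u => by simpa [sub_eq_add_neg] using (hl u).1) (fun u => by simpa [sub_eq_add_neg] using (hl' u).1) (by simp)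
  rw [← sub_eq_zero]
  unfold SK
  rw [← integral_sub (SK_int hK h hN hD he') (SK_int hK h hN hD he)]
  have := integral_add (k1.1.div_const 2) (k2.1.div_const 2)
  rw [integral_div, integral_div, k1.2, k2.2, zero_div, add_zero] at this
  rw [← this]
  congr 1; funext u
  simp only [neg_apply, ← sub_eq_add_neg]
  ring

lemma range_perp (h : NearIso D ι η) {N : EW n} (hN : ‖N‖ = 1) (hD : ∀ v, ⟪D v, N⟫ = 0) {y : EW n} (hy : ⟪y, N⟫ = 0) : ∃ v, D v = y := by
  have hinj : Function.Injective D := fun s t hst => by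
    have := h.low s t
    rw [hst, sub_self, norm_zero, mul_zero] at this
    exact sub_eq_zero.1 (norm_le_zero_iff.1 this)
  have hN0 : N ≠ 0 := by rintro rfl; simp at hN
  have hle : LinearMap.range (D : EV n →ₗ[ℝ] EW n) ≤ (ℝ ∙ N)ᗮ := by
    rintro _ ⟨v, rfl⟩
    rw [Submodule.mem_orthogonal_singleton_iff_inner_left]; exact hD v
  have : Fact (Module.finrank ℝ (EW n) = n + 1) := ⟨by simp⟩
  have he := Submodule.eq_of_le_of_finrank_eq hle (by
    rw [Submodule.finrank_orthogonal_span_singleton (n := n) hN0, LinearMap.finrank_range_of_inj hinj]; simp)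
  have : y ∈ LinearMap.range (D : EV n →ₗ[ℝ] EW n) := by
    rw [he, Submodule.mem_orthogonal_singleton_iff_inner_left]; exact hy
  exact this

lemma SK_const (hK : CZK n K C) (h : NearIso D ι η) {N e : EW n} (hN : ‖N‖ = 1) (hD : ∀ v, ⟪D v, N⟫ = 0) (he : 0 < ⟪e, N⟫) :
    SK K D e = SK K D N := by
  have hNN : ⟪N, N⟫ = 1 := by rw [real_inner_self_eq_norm_sq, hN, one_pow]
  obtain ⟨v, hv⟩ := range_perp h hN hD (y := e - ⟪e, N⟫ • N) (by rw [inner_sub_left, real_inner_smul_left, hNN, mul_one, sub_self])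
  have e1 : e = ⟪e, N⟫ • N + D v := by rw [hv]; abel
  rw [e1, SK_shift hK h hN hD (by rw [real_inner_smul_left, hNN, mul_one]; exact he), SK_smul hK D N he]

end flat

section loc
variable {n : ℕ} {γ : EV n → EW n} {ι : EV n →ₗᵢ[ℝ] EW n} {η : ℝ} {K : EW n → ℝ} {C a b : ℝ}

def phi (K : EW n → ℝ) (b : ℝ) (e w : EW n) : ℝ := (if b < ‖e - w‖ then K (e - w) else 0) - Ke K 1 (-w)

def AA (n : ℕ) (C b : ℝ) : ℝ := (C / b ^ n + C) * 5 ^ (n + 1)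

lemma trunc_bd (hK : CZK n K C) (hb : 0 < b) (w : EW n) : |if b < ‖w‖ then K w else 0| ≤ C / b ^ n := by
  have := hK.one_le
  split_ifs with h
  · refine (hK.bd _).trans ?_; gcongr
  · rw [abs_zero]; positivity

lemma phib_bd (hK : CZK n K C) (hb : 0 < b) (hb1 : b < 1) {e : EW n} (he : ‖e‖ = 1) (w : EW n) :
    |phi K b e w| ≤ AA n C b * pk n 1 ‖w‖ := by
  have hC := hK.one_le
  have hw := norm_nonneg w
  unfold AA pk
  rw [mul_one_div, le_div_iff₀ (by positivity)]
  by_cases h4 : 4 ≤ ‖w‖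
  · have h1 : b < ‖e - w‖ := by
      have := norm_sub_norm_le w e
      rw [norm_sub_rev w e] at this; linarith
    unfold phi
    rw [if_pos h1, Ke_eq one_pos (by rw [norm_neg]; linarith), abs_sub_comm]
    have := hK.lip (-w) (e - w) (by rw [show -w - (e - w) = -e by abel, norm_neg, norm_neg, he]; linarith)
    rw [show -w - (e - w) = -e by abel, norm_neg, norm_neg, he, mul_one] at this
    have h2 : (1 + ‖w‖) ^ (n + 1) ≤ (5 * ‖w‖) ^ (n + 1) := by gcongr; linarith
    calc _ ≤ C / ‖w‖ ^ (n + 1) * (5 * ‖w‖) ^ (n + 1) := by gcongr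
      _ = C * 5 ^ (n + 1) := by rw [mul_pow]; field_simp
      _ ≤ _ := by gcongr; exact le_add_of_nonneg_left (by positivity)
  · push Not at h4
    have h1 : |phi K b e w| ≤ C / b ^ n + C := by
      refine (abs_sub _ _).trans (add_le_add (trunc_bd hK hb _) ?_)
      simpa using Ke_bd2 hK one_pos (-w)
    gcongr; linarith

lemma phi_meas (hK : CZK n K C) (e : EW n) : Measurable (phi K b e) := by
  have h1 := hK.meas
  have h2 := Ke_meas hK (ε := 1)
  unfold phi
  refine (Measurable.ite (measurableSet_lt measurable_const (by fun_prop)) (by fun_prop) measurable_const).sub (h2.comp measurable_neg)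

lemma phi_scale (hK : CZK n K C) {r : ℝ} (hr : 0 < r) (e w : EW n) :
    (if b * r < ‖r • (e - w)‖ then K (r • (e - w)) else 0) - Ke K r (r • (-w)) = phi K b e w / r ^ n := by
  unfold phi
  rw [Ke_scale hK hr, norm_smul, norm_of_nonneg hr.le, mul_comm b, sub_div, hK.hom _ _ hr]
  simp only [mul_lt_mul_iff_right₀ hr]
  split_ifs <;> simp

lemma pk_half {u : EV n} {w : EW n} (h : ‖u‖ ≤ 2 * ‖w‖) : pk n 1 ‖w‖ ≤ 2 ^ (n + 1) * pk n 1 ‖u‖ := by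
  unfold pk
  rw [mul_one_div, div_le_div_iff₀ (by positivity) (by positivity), one_mul, ← mul_pow]
  gcongr; linarith

lemma phi_lim (hK : CZK n K C) (h : NearIso γ ι η) {s : EV n} (hd : DifferentiableAt ℝ γ s) (hb : 0 < b) (hba : b < a) (ha : a < 1)
    {N : EW n} (hN : ‖N‖ = 1) (hD : ∀ v, ⟪fderiv ℝ γ s v, N⟫ = 0) {r : ℕ → ℝ} (hr : Tendsto r atTop (𝓝[>] 0)) {e : ℕ → EW n} {e0 : EW n}
    (he : Tendsto e atTop (𝓝 e0)) (he1 : ∀ᶠ j in atTop, ‖e j‖ = 1 ∧ a ≤ ⟪e j, N⟫) :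
    Tendsto (fun j => ∫ u, phi K b (e j) (gsc γ s (r j) u)) atTop (𝓝 (SK K (fderiv ℝ γ s) N)) := by
  have hC := hK.one_le
  set D := fderiv ℝ γ s
  have hDn : NearIso D ι η := fderiv_near h hd
  have e01 : ‖e0‖ = 1 := tendsto_nhds_unique (he.norm) (tendsto_const_nhds.congr' (he1.mono fun j hj => hj.1.symm))
  have e0a : a ≤ ⟪e0, N⟫ := ge_of_tendsto (he.inner tendsto_const_nhds) (he1.mono fun j hj => hj.2)
  have hlow : ∀ u, b < ‖e0 - D u‖ := fun u => by
    have h1 := abs_real_inner_le_norm (e0 - D u) N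
    rw [inner_sub_left, hD, sub_zero, hN, mul_one] at h1
    exact hba.trans_le (e0a.trans ((le_abs_self _).trans h1))
  have hA : 0 ≤ AA n C b := by unfold AA; positivity
  have hpkD : ∀ u, |phi K b e0 (D u)| ≤ AA n C b * 2 ^ (n + 1) / (1 + ‖u‖) ^ (n + 1) := fun u => by
    refine (phib_bd hK hb (hba.trans ha) e01 _).trans ?_
    have h2 := pk_half (n := n) (u := u) (w := D u) (by simpa using hDn.low u 0)
    calc _ ≤ AA n C b * (2 ^ (n + 1) * pk n 1 ‖u‖) := by gcongr
      _ = _ := by unfold pk; ring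
  have hDm := D.continuous.measurable
  have hI : Integrable fun u => phi K b e0 (D u) := pk_le_int ((phi_meas hK e0).comp hDm) hpkD
  have heq : ∫ u, phi K b e0 (D u) = SK K D N := by
    rw [← SK_const hK hDn hN hD (hb.trans hba |>.trans_le e0a)]
    have h1 := integral_neg_eq_self (fun u => phi K b e0 (D u)) volume
    have h2 := integral_add hI hI.comp_neg
    rw [h1] at h2
    unfold SK
    rw [integral_div, eq_div_iff two_ne_zero, mul_two, ← h2]
    congr 1; funext u
    have h3 := hlow u
    have h4 := hlow (-u)
    simp only [phi, map_neg, neg_neg, sub_neg_eq_add, Ke_odd hK] at h4 ⊢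
    rw [if_pos h3, if_pos h4]; ring
  rw [← heq]
  have hr0 : ∀ᶠ j in atTop, 0 < r j := hr.eventually self_mem_nhdsWithin
  have hne : Nonempty (Fin n) := ⟨⟨0, hK.one_le_n⟩⟩
  refine tendsto_integral_filter_of_dominated_convergence (fun u => AA n C b * 2 ^ (n + 1) * pk n 1 ‖u‖) ?_ ?_ (pk_int.const_mul _) ?_
  · filter_upwards [hr0] with j hj
    exact ((phi_meas hK _).comp (gsc_near h s hj).cont.measurable).aestronglyMeasurable
  · filter_upwards [hr0, he1] with j hj hj1
    refine ae_of_all _ fun u => ?_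
    rw [norm_eq_abs]
    refine (phib_bd hK hb (hba.trans ha) hj1.1 _).trans ?_
    rw [mul_assoc]
    gcongr
    exact pk_half (by simpa [gsc_zero] using (gsc_near h s hj).low u 0)
  · filter_upwards [Measure.ae_ne volume 0] with u hu
    have hg := (gsc_lim hd u).comp hr
    have hDu : -(D u) ≠ 0 := fun h0 => by
      have := hDn.low u 0
      rw [map_zero, sub_zero, sub_zero, neg_eq_zero.1 h0, norm_zero, mul_zero] at this
      exact hu (norm_le_zero_iff.1 this)
    have h2 : Tendsto (fun j => e j - gsc γ s (r j) u) atTop (𝓝 (e0 - D u)) := he.sub hg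
    have hne0 : e0 - D u ≠ 0 := norm_pos_iff.1 (hb.trans (hlow u))
    have h3 := (hK.cont.continuousAt (isOpen_compl_singleton.mem_nhds hne0)).tendsto.comp h2
    have h4 := (Ke_cont hK (ε := 1) hDu).tendsto.comp hg.neg
    have h5 : phi K b e0 (D u) = K (e0 - D u) - Ke K 1 (-D u) := by unfold phi; rw [if_pos (hlow u)]
    rw [h5]
    refine (h3.sub h4).congr' ?_
    filter_upwards [h2.norm.eventually (lt_mem_nhds (hlow u))] with j hj
    unfold phi; rw [if_pos hj]; rfl

lemma tau_bd (h : NearIso γ ι η) (x : EW n) {r : ℝ} (hr : 0 < r) :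
    (volume.map γ) (closedBall x r) ≤ ofReal (bn n * 4 ^ n * r ^ n) := by
  rw [Measure.map_apply h.cont.measurable measurableSet_closedBall]
  rcases (γ ⁻¹' closedBall x r).eq_empty_or_nonempty with h0 | ⟨t, ht⟩
  · rw [h0, measure_empty]; exact zero_le
  · have : γ ⁻¹' closedBall x r ⊆ closedBall t (4 * r) := fun u hu => by
      have h1 := h.low u t
      have h2 := dist_triangle_right (γ u) (γ t) x
      rw [mem_closedBall, dist_eq_norm]
      rw [dist_eq_norm (γ u)] at h2
      have h3 : dist (γ u) x ≤ r := hu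
      have h4 : dist (γ t) x ≤ r := ht
      linarith
    refine (measure_mono this).trans ?_
    rw [vol_ball_eq _ (by positivity), mul_pow, mul_assoc]

lemma tau_lf (h : NearIso γ ι η) : IsLocallyFiniteMeasure (volume.map γ) :=
  ⟨fun x => ⟨closedBall x 1, closedBall_mem_nhds x one_pos, (tau_bd h x one_pos).trans_lt ofReal_lt_top⟩⟩

lemma tau_pos (h : NearIso γ ι η) (s : EV n) {r : ℝ} (hr : 0 < r) : (volume.map γ) (closedBall (γ s) r) ≠ 0 := by
  rw [Measure.map_apply h.cont.measurable measurableSet_closedBall]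
  have : closedBall s (r / 2) ⊆ γ ⁻¹' closedBall (γ s) r := fun u hu => by
    have h1 := h.up u s
    rw [mem_closedBall, dist_eq_norm] at hu
    rw [mem_preimage, mem_closedBall, dist_eq_norm]; linarith
  exact ((measure_closedBall_pos _ _ (by positivity)).trans_le (measure_mono this)).ne'

def rhoM (σ τ : Measure (EW n)) (x : EW n) : Measure (EW n) :=
  σ.singularPart τ + τ.withDensity fun z => ‖(σ.rnDeriv τ z).toReal - (σ.rnDeriv τ x).toReal‖ₑ

lemma rho_ok (h : NearIso γ ι η) (σ : Measure (EW n)) [IsFiniteMeasure σ] :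
    ∀ᵐ s, Tendsto (fun r => rhoM σ (volume.map γ) (γ s) (closedBall (γ s) r) / ofReal (r ^ n)) (𝓝[>] 0) (𝓝 0) := by
  have := tau_lf h
  set τ := volume.map γ with hτ
  have hA : ∀ x, ∀ r > 0, τ (closedBall x r) ≤ ofReal (bn n * 4 ^ n * r ^ n) := fun x r hr => tau_bd h x hr
  have h1 : ∀ᵐ x ∂τ, Tendsto (fun r => σ.singularPart τ (closedBall x r) / τ (closedBall x r)) (𝓝[>] 0) (𝓝 0) := by
    filter_upwards [Besicovitch.ae_tendsto_rnDeriv (σ.singularPart τ) τ, Measure.rnDeriv_singularPart σ τ] with x hx h0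
    rwa [h0] at hx
  have h2 := leb_pt_fun τ hA (g := fun z => (σ.rnDeriv τ z).toReal) Measure.integrable_toReal_rnDeriv.locallyIntegrable
  have hm := h.cont.measurable.aemeasurable (μ := volume)
  filter_upwards [ae_of_ae_map hm h1, ae_of_ae_map hm h2] with s hs1 hs2
  have h3 := leb_pt τ hA _ _ hs1 (fun r hr h0 => absurd h0 (tau_pos h s hr))
  have := h3.add hs2
  rw [add_zero] at this
  refine this.congr fun r => ?_
  rw [rhoM, Measure.add_apply, withDensity_apply _ measurableSet_closedBall, ENNReal.add_div]

lemma rho_tail (h : NearIso γ ι η) (σ : Measure (EW n)) [IsFiniteMeasure σ] {s : EV n}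
    (hs : Tendsto (fun r => rhoM σ (volume.map γ) (γ s) (closedBall (γ s) r) / ofReal (r ^ n)) (𝓝[>] 0) (𝓝 0)) :
    Tendsto (fun r => ∫⁻ z, ofReal (pk n r (dist z (γ s))) ∂(rhoM σ (volume.map γ) (γ s))) (𝓝[>] 0) (𝓝 0) := by
  have := tau_lf h
  set τ := volume.map γ with hτ
  set g := (σ.rnDeriv τ (γ s)).toReal with hg
  have hg0 : 0 ≤ g := ENNReal.toReal_nonneg
  have hsf : SFinite (rhoM σ τ (γ s)) := by unfold rhoM; infer_instance
  have hbn : 0 ≤ bn n := measureReal_nonneg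
  have hbd : ∀ r > 0, rhoM σ τ (γ s) (closedBall (γ s) r) ≤ ofReal (2 * σ.real univ + g * (bn n * 4 ^ n * r ^ n)) := fun r hr => by
    have h1 : σ.singularPart τ (closedBall (γ s) r) ≤ ofReal (σ.real univ) := by
      rw [measureReal_def, ofReal_toReal (measure_ne_top _ _)]
      exact (Measure.singularPart_le σ τ _).trans (measure_mono (subset_univ _))
    have h2 : ∫⁻ z in closedBall (γ s) r, ‖(σ.rnDeriv τ z).toReal - g‖ₑ ∂τ ≤ ofReal (σ.real univ) + ofReal (g * (bn n * 4 ^ n * r ^ n)) := by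
      calc _ ≤ ∫⁻ z in closedBall (γ s) r, (σ.rnDeriv τ z + ofReal g) ∂τ := by
            refine lintegral_mono fun z => (enorm_sub_le).trans (add_le_add ?_ ?_)
            · rw [Real.enorm_of_nonneg ENNReal.toReal_nonneg]; exact ofReal_toReal_le
            · rw [Real.enorm_of_nonneg hg0]
        _ = _ := lintegral_add_right _ measurable_const
        _ ≤ _ := by
            rw [setLIntegral_const, measureReal_def, ofReal_toReal (measure_ne_top _ _), ofReal_mul hg0]
            exact add_le_add ((Measure.setLIntegral_rnDeriv_le _).trans (measure_mono (subset_univ _))) (by gcongr; exact tau_bd h _ hr)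
    rw [rhoM, Measure.add_apply, withDensity_apply _ measurableSet_closedBall]
    refine (add_le_add h1 h2).trans_eq ?_
    rw [← ofReal_add (by positivity) (by positivity), ← ofReal_add (by positivity) (by positivity)]
    congr 1; ring
  obtain ⟨r0, hr0, h0⟩ := (mem_nhdsGT_iff_exists_Ioo_subset (α := ℝ)).1 (hs.eventually (gt_mem_nhds one_pos))
  have hr0' : 0 < r0 := hr0
  refine tail_lemma _ _ _ (1 + 2 * σ.real univ / r0 ^ n + g * (bn n * 4 ^ n)) (by positivity) (fun r hr => ?_) hs
  have hr' : 0 < r := hr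
  by_cases hlt : r < r0
  · have h1 : rhoM σ τ (γ s) (closedBall (γ s) r) / ofReal (r ^ n) < 1 := h0 ⟨hr, hlt⟩
    have h2 := (ENNReal.div_le_iff (ofReal_pos.2 (pow_pos hr' n)).ne' ofReal_ne_top).1 h1.le
    rw [one_mul] at h2
    refine h2.trans (ofReal_le_ofReal ?_)
    have : 1 ≤ 1 + 2 * σ.real univ / r0 ^ n + g * (bn n * 4 ^ n) := by
      have : 0 ≤ 2 * σ.real univ / r0 ^ n + g * (bn n * 4 ^ n) := by positivity
      linarith
    exact le_mul_of_one_le_left (by positivity) this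
  · push Not at hlt
    refine (hbd r hr).trans (ofReal_le_ofReal ?_)
    have h1 : 2 * σ.real univ ≤ 2 * σ.real univ / r0 ^ n * r ^ n := by
      rw [div_mul_eq_mul_div, le_div_iff₀ (by positivity)]; gcongr
    have : 0 ≤ r ^ n := by positivity
    nlinarith

lemma rho_diff (h : NearIso γ ι η) (σ : Measure (EW n)) [IsFiniteMeasure σ] (x : EW n) {Φ : EW n → ℝ} (hΦ : Measurable Φ) {M : ℝ} (hM : ∀ z, |Φ z| ≤ M)
    (hi : Integrable Φ (volume.map γ)) :
    ofReal |∫ z, Φ z ∂σ - (σ.rnDeriv (volume.map γ) x).toReal * ∫ z, Φ z ∂(volume.map γ)| ≤ ∫⁻ z, ‖Φ z‖ₑ ∂(rhoM σ (volume.map γ) x) := by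
  have := tau_lf h
  set τ := volume.map γ with hτ
  set g := (σ.rnDeriv τ x).toReal with hg
  have hb : ∀ (μ : Measure (EW n)) [IsFiniteMeasure μ], Integrable Φ μ := fun μ _ => Integrable.of_bound hΦ.aestronglyMeasurable M (ae_of_all _ hM)
  have hGm := (Measure.measurable_rnDeriv σ τ)
  have e1 : ∫ z, Φ z ∂σ = ∫ z, Φ z ∂(σ.singularPart τ) + ∫ z, (σ.rnDeriv τ z).toReal * Φ z ∂τ := by
    conv_lhs => rw [σ.haveLebesgueDecomposition_add τ]
    have : IsFiniteMeasure (τ.withDensity (σ.rnDeriv τ)) := isFiniteMeasure_of_le σ (Measure.withDensity_rnDeriv_le σ τ)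
    rw [integral_add_measure (hb _) (hb _), integral_withDensity_eq_integral_toReal_smul hGm (Measure.rnDeriv_lt_top σ τ)]
    rfl
  have hi2 : Integrable (fun z => (σ.rnDeriv τ z).toReal * Φ z) τ :=
    Measure.integrable_toReal_rnDeriv.mul_bdd (c := M) hΦ.aestronglyMeasurable (ae_of_all _ hM)
  have e2 : ∫ z, Φ z ∂σ - g * ∫ z, Φ z ∂τ = ∫ z, Φ z ∂(σ.singularPart τ) + ∫ z, ((σ.rnDeriv τ z).toReal - g) * Φ z ∂τ := by
    rw [e1, ← integral_const_mul, add_sub_assoc]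
    congr 1
    refine (integral_sub hi2 (hi.const_mul g)).symm.trans ?_
    congr 1; funext z; ring
  rw [e2, ← Real.enorm_eq_ofReal_abs, rhoM, lintegral_add_measure, lintegral_withDensity_eq_lintegral_mul _ (by fun_prop) (by fun_prop)]
  refine (enorm_add_le _ _).trans (add_le_add (enorm_integral_le_lintegral_enorm _) ((enorm_integral_le_lintegral_enorm _).trans_eq ?_))
  congr 1; funext z; exact enorm_mul _ _

def Phi (K : EW n → ℝ) (b : ℝ) (x y z : EW n) : ℝ := (if b * dist x y < dist y z then K (y - z) else 0) - Ke K (dist x y) (x - z)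

lemma Phi_eq (hK : CZK n K C) {x y : EW n} (hxy : 0 < dist x y) (z : EW n) :
    Phi K b x y z = phi K b ((dist x y)⁻¹ • (y - x)) ((dist x y)⁻¹ • (z - x)) / dist x y ^ n := by
  rw [← phi_scale hK hxy, Phi, ← smul_neg, ← smul_sub, smul_smul, smul_smul, mul_inv_cancel₀ hxy.ne', one_smul, one_smul,
    sub_sub_sub_cancel_right, neg_sub, dist_eq_norm y z]

lemma Phi_bd (hK : CZK n K C) (hb : 0 < b) (hb1 : b < 1) {x y : EW n} (hxy : 0 < dist x y) (z : EW n) :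
    |Phi K b x y z| ≤ AA n C b * pk n (dist x y) (dist z x) := by
  have he : ‖(dist x y)⁻¹ • (y - x)‖ = 1 := by
    rw [norm_smul, ← dist_eq_norm, dist_comm y x, norm_inv, norm_of_nonneg hxy.le, inv_mul_cancel₀ hxy.ne']
  have h1 := phib_bd hK hb hb1 he ((dist x y)⁻¹ • (z - x))
  have h2 : dist z x = dist x y * ‖(dist x y)⁻¹ • (z - x)‖ := by
    rw [norm_smul, ← dist_eq_norm, norm_inv, norm_of_nonneg hxy.le, mul_inv_cancel_left₀ hxy.ne']
  rw [Phi_eq hK hxy, abs_div, abs_of_pos (pow_pos hxy n), h2, pk_scale hxy, ← mul_div_assoc]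
  gcongr

lemma local_main (hK : CZK n K C) (h : NearIso γ ι η) (σ : Measure (EW n)) [IsFiniteMeasure σ] (hb : 0 < b) (hba : b < a) (ha : a < 1) :
    ∀ᵐ s, ∃ P : ℝ, ∀ N : EW n, ‖N‖ = 1 → (∀ v, ⟪fderiv ℝ γ s v, N⟫ = 0) →
      Tendsto (fun y => ∫ z, (if b * dist (γ s) y < dist y z then K (y - z) else 0) ∂σ) (𝓝[{y | a * ‖y - γ s‖ < ⟪y - γ s, N⟫}] (γ s))
        (𝓝 (P + (σ.rnDeriv (volume.map γ) (γ s)).toReal * SK K (fderiv ℝ γ s) N)) := by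
  have hC := hK.one_le
  have := tau_lf h
  filter_upwards [pv_meas hK h σ, rho_ok h σ, h.lip.ae_differentiableAt] with s ⟨l, hl⟩ hs hd
  refine ⟨-l, fun N hN hD => ?_⟩
  have htail := rho_tail h σ hs
  set x := γ s with hx
  set τ := volume.map γ with hτ
  set F := 𝓝[{y | a * ‖y - x‖ < ⟪y - x, N⟫}] x with hF
  have hpos : ∀ y ∈ {y | a * ‖y - x‖ < ⟪y - x, N⟫}, 0 < dist x y := fun y hy => by
    refine dist_pos.2 ?_
    rintro rfl
    simp at hy
  have hpos' : ∀ᶠ y in F, 0 < dist x y := by filter_upwards [self_mem_nhdsWithin] with y hy using hpos y hy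
  have hr : Tendsto (fun y => dist x y) F (𝓝[>] 0) := by
    refine tendsto_nhdsWithin_iff.2 ⟨?_, hpos'⟩
    have : Tendsto (fun y => dist x y) (𝓝 x) (𝓝 (dist x x)) := (continuous_const.dist continuous_id).tendsto x
    rw [dist_self] at this
    exact this.mono_left nhdsWithin_le_nhds
  have hA : 0 ≤ AA n C b := by unfold AA; positivity
  have hPm : ∀ y, Measurable (Phi K b x y) := fun y => by
    have h1 := hK.meas
    have h2 := Ke_meas hK (ε := dist x y)
    unfold Phi
    exact (Measurable.ite (measurableSet_lt measurable_const (by fun_prop)) (by fun_prop) measurable_const).sub (by fun_prop)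
  have hsc : ∀ y, 0 < dist x y → ∀ u, Phi K b x y (γ (s + dist x y • u)) = (dist x y ^ n)⁻¹ * phi K b ((dist x y)⁻¹ • (y - x)) (gsc γ s (dist x y) u) := fun y hy u => by
    rw [Phi_eq hK hy, gsc, hx]; ring
  have hτi : ∀ y, 0 < dist x y → ∫ z, Phi K b x y z ∂τ = ∫ u, phi K b ((dist x y)⁻¹ • (y - x)) (gsc γ s (dist x y) u) := fun y hy => by
    rw [hτ, integral_map (f := Phi K b x y) h.cont.measurable.aemeasurable (hPm y).aestronglyMeasurable]
    have h1 := int_aff (fun t => Phi K b x y (γ t)) s hy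
    simp_rw [hsc y hy] at h1
    rw [integral_const_mul] at h1
    exact (mul_left_cancel₀ (inv_ne_zero (pow_pos hy n).ne') h1).symm
  -- limit of tau integrals
  have hT : Tendsto (fun y => ∫ z, Phi K b x y z ∂τ) F (𝓝 (SK K (fderiv ℝ γ s) N)) := by
    refine tendsto_of_seq_tendsto fun y hy => tendsto_of_subseq_tendsto fun ns hns => ?_
    have hy' := hy.comp hns
    have hb1 : ∀ j, (dist x (y (ns j)))⁻¹ • (y (ns j) - x) ∈ closedBall (0 : EW n) 1 := fun j => by
      rw [mem_closedBall_zero_iff, norm_smul, ← dist_eq_norm, dist_comm _ x, norm_inv, norm_of_nonneg dist_nonneg]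
      exact inv_mul_le_one
    obtain ⟨e0, -, ms, hms, hlim⟩ := (isCompact_closedBall (0 : EW n) 1).tendsto_subseq hb1
    refine ⟨ms, ?_⟩
    have hy2 := hy'.comp hms.tendsto_atTop
    have hm : ∀ᶠ j in atTop, y (ns (ms j)) ∈ {y | a * ‖y - x‖ < ⟪y - x, N⟫} := hy2.eventually self_mem_nhdsWithin
    have := phi_lim hK h hd hb hba ha hN hD (hr.comp hy2) hlim (by
      filter_upwards [hm] with j hj
      have hp := hpos _ hj
      constructor
      · simp only [Function.comp]
        rw [norm_smul, ← dist_eq_norm, dist_comm _ x, norm_inv, norm_of_nonneg dist_nonneg, inv_mul_cancel₀ hp.ne']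
      · simp only [Function.comp]
        rw [real_inner_smul_left, ← div_eq_inv_mul, le_div_iff₀ hp, dist_comm, dist_eq_norm]
        exact le_of_lt hj)
    refine this.congr' ?_
    filter_upwards [hm] with j hj
    exact (hτi _ (hpos _ hj)).symm
  have hbd : ∀ y, 0 < dist x y → ∀ z, |Phi K b x y z| ≤ C / (b * dist x y) ^ n + C / dist x y ^ n := fun y hy z => by
    refine (abs_sub _ _).trans (add_le_add ?_ (Ke_bd2 hK hy _))
    rw [dist_eq_norm y z]
    exact trunc_bd hK (mul_pos hb hy) _
  have hdiff : Tendsto (fun y => ∫ z, Phi K b x y z ∂σ - (σ.rnDeriv τ x).toReal * ∫ z, Phi K b x y z ∂τ) F (𝓝 0) := by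
    have h1 : Tendsto (fun y => ofReal (AA n C b) * ∫⁻ z, ofReal (pk n (dist x y) (dist z x)) ∂(rhoM σ τ x)) F (𝓝 0) := by
      have := ENNReal.Tendsto.const_mul (htail.comp hr) (a := ofReal (AA n C b)) (Or.inr ofReal_ne_top)
      rwa [mul_zero] at this
    have h2 : Tendsto (fun y => ofReal |∫ z, Phi K b x y z ∂σ - (σ.rnDeriv τ x).toReal * ∫ z, Phi K b x y z ∂τ|) F (𝓝 0) := by
      refine tendsto_of_tendsto_of_tendsto_of_le_of_le' tendsto_const_nhds h1 (Eventually.of_forall fun _ => zero_le) ?_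
      filter_upwards [hpos'] with y hy
      have hi : Integrable (Phi K b x y) τ := by
        rw [hτ, integrable_map_measure (hPm y).aestronglyMeasurable h.cont.measurable.aemeasurable]
        have h3 : Integrable fun u => Phi K b x y (γ (s + dist x y • u)) := by
          simp_rw [hsc y hy]
          refine Integrable.const_mul (pk_le_int (A := AA n C b * 2 ^ (n + 1)) ((phi_meas hK _).comp (gsc_near h s hy).cont.measurable) fun u => ?_) _
          refine (phib_bd hK hb (hba.trans ha) (by
            rw [norm_smul, ← dist_eq_norm, dist_comm y x, norm_inv, norm_of_nonneg hy.le, inv_mul_cancel₀ hy.ne']) _).trans ?_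
          have h2 := pk_half (n := n) (u := u) (w := gsc γ s (dist x y) u) (by simpa [gsc_zero] using (gsc_near h s hy).low u 0)
          calc _ ≤ AA n C b * (2 ^ (n + 1) * pk n 1 ‖u‖) := by gcongr
            _ = _ := by unfold pk; ring
        have h4 := (integrable_comp_smul_iff volume (fun u => Phi K b x y (γ (s + u))) hy.ne').1 h3
        have h5 := h4.comp_add_left (-s)
        simp only [add_neg_cancel_left] at h5
        exact h5
      refine (rho_diff h σ x (hPm y) (hbd y hy) hi).trans ?_
      rw [← lintegral_const_mul _ (by unfold pk; fun_prop)]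
      refine lintegral_mono fun z => ?_
      rw [← ofReal_mul hA, Real.enorm_eq_ofReal_abs]
      exact ofReal_le_ofReal (Phi_bd hK hb (hba.trans ha) hy z)
    have h3 := (ENNReal.tendsto_toReal ENNReal.zero_ne_top).comp h2
    refine (tendsto_zero_iff_abs_tendsto_zero _).2 (h3.congr fun y => ?_)
    simp
  have hKe : Tendsto (fun y => ∫ z, Ke K (dist x y) (x - z) ∂σ) F (𝓝 (-l)) := by
    refine ((hl.comp hr).neg).congr fun y => ?_
    simp only [Function.comp]
    rw [← integral_neg]
    congr 1; funext z
    rw [← Ke_odd hK, neg_sub]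
  have hfin := (hdiff.add (hT.const_mul (σ.rnDeriv τ x).toReal)).add hKe
  rw [show 0 + (σ.rnDeriv τ x).toReal * SK K (fderiv ℝ γ s) N + -l = -l + (σ.rnDeriv τ x).toReal * SK K (fderiv ℝ γ s) N by ring] at hfin
  refine hfin.congr' ?_
  filter_upwards [hpos'] with y hy
  rw [sub_add_cancel]
  have hi1 : Integrable (Phi K b x y) σ := Integrable.of_bound (hPm y).aestronglyMeasurable _ (ae_of_all _ (hbd y hy))
  have hi2 : Integrable (fun z => Ke K (dist x y) (x - z)) σ :=
    Integrable.of_bound ((Ke_meas hK).comp (measurable_const.sub measurable_id)).aestronglyMeasurable _ (ae_of_all _ fun z => Ke_bd2 hK hy _)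
  refine (integral_add hi1 hi2).symm.trans ?_
  congr 1; funext z
  unfold Phi; ring
end loc

section ckrel
variable {n : ℕ} {γ : EV n → EW n} {ι : EV n →ₗᵢ[ℝ] EW n} {η : ℝ} {K : EW n → ℝ} {C : ℝ}

lemma NearIso.up2 (h : NearIso γ ι η) (s t : EV n) : ‖γ s - γ t‖ ≤ (1 + η) * ‖s - t‖ := by
  have h1 := h.near s t
  have h2 := norm_sub_norm_le (γ s - γ t) (ι (s - t))
  rw [ι.norm_map] at h2; linarith

lemma NearIso.low2 (h : NearIso γ ι η) (s t : EV n) : (1 - η) * ‖s - t‖ ≤ ‖γ s - γ t‖ := by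
  have h1 := h.near s t
  have h2 := norm_sub_norm_le (ι (s - t)) (γ s - γ t)
  rw [ι.norm_map, norm_sub_rev (ι _)] at h2; linarith

lemma NearIso.eta0 (hn : 1 ≤ n) (h : NearIso γ ι η) : 0 ≤ η := by
  have : Nonempty (Fin n) := ⟨⟨0, hn⟩⟩
  obtain ⟨v, hv⟩ := exists_ne (0 : EV n)
  have := (norm_nonneg _).trans (h.near v 0)
  rw [sub_zero] at this
  exact nonneg_of_mul_nonneg_left this (norm_pos_iff.2 hv)

def cH (n : ℕ) : ℝ≥0 := Measure.addHaarScalarFactor (μH[n] : Measure (EV n)) volume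

instance haar_mH : Measure.IsAddHaarMeasure (μH[n] : Measure (EV n)) := by
  simpa using MeasureTheory.isAddHaarMeasure_hausdorffMeasure (E := EV n)

lemma mH_eq : (μH[n] : Measure (EV n)) = cH n • volume := Measure.isAddLeftInvariant_eq_smul _ _

lemma cH_pos : 0 < cH n := Measure.addHaarScalarFactor_pos_of_isAddHaarMeasure _ _

lemma det_bd {M : EV n →ₗ[ℝ] EV n} (h0 : 0 ≤ η) (h1 : η < 1) (hu : ∀ v, ‖M v‖ ≤ (1 + η) * ‖v‖) (hl : ∀ v, (1 - η) * ‖v‖ ≤ ‖M v‖) :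
    (1 - η) ^ n ≤ |LinearMap.det M| ∧ |LinearMap.det M| ≤ (1 + η) ^ n := by
  have hinj : Function.Injective M := (injective_iff_map_eq_zero M).2 fun v hv => by
    have := hl v
    rw [hv, norm_zero] at this
    exact norm_le_zero_iff.1 (nonpos_of_mul_nonpos_right this (by linarith))
  have hsur := LinearMap.surjective_of_injective hinj
  have key := Measure.addHaar_image_linearMap (volume : Measure (EV n)) M (closedBall 0 1)
  have hb : bn n * 1 ^ n = bn n := by simp
  have hbn : 0 < bn n := bn_pos
  rw [vol_ball_eq _ one_pos, hb, ← ofReal_mul (abs_nonneg _)] at key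
  constructor
  · have : closedBall 0 (1 - η) ⊆ M '' closedBall 0 1 := fun w hw => by
      obtain ⟨v, rfl⟩ := hsur w
      refine ⟨v, ?_, rfl⟩
      rw [mem_closedBall_zero_iff] at hw ⊢
      have := hl v
      exact le_of_mul_le_mul_left (by linarith) (sub_pos.2 h1)
    have := measure_mono (μ := volume) this
    rw [key, vol_ball_eq _ (by linarith), ofReal_le_ofReal_iff (by positivity), mul_comm] at this
    exact le_of_mul_le_mul_right this hbn
  · have : M '' closedBall 0 1 ⊆ closedBall 0 (1 + η) := by
      rintro _ ⟨v, hv, rfl⟩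
      rw [mem_closedBall_zero_iff] at hv ⊢
      have := hu v
      nlinarith
    have := measure_mono (μ := volume) this
    rw [key, vol_ball_eq _ (by linarith), ofReal_le_ofReal_iff (by positivity), mul_comm (bn n)] at this
    exact le_of_mul_le_mul_right this hbn

lemma CK_rel (hK : CZK n K C) {Ω : EW n → ℝ} (hf : ∀ x, x ≠ 0 → K x = Ω x / ‖x‖ ^ n) {D : EV n →L[ℝ] EW n} (h : NearIso D ι η)
    {N : EW n} (hN : ‖N‖ = 1) (hD : ∀ v, ⟪D v, N⟫ = 0) :
    ∃ c : ℝ, (1 - η) ^ n ≤ c ∧ c ≤ (1 + η) ^ n ∧ CK n Ω N = cH n * c * SK K D N := by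
  have hη0 := h.eta0 hK.one_le_n
  have hη1 : η < 1 := h.le.trans_lt (by norm_num)
  have hN0 : N ≠ 0 := by rintro rfl; simp at hN
  have : Fact (Module.finrank ℝ (EW n) = n + 1) := ⟨by simp⟩
  let B := OrthonormalBasis.fromOrthogonalSpanSingleton (𝕜 := ℝ) n hN0
  let J : EV n →ₗᵢ[ℝ] EW n := (ℝ ∙ N)ᗮ.subtypeₗᵢ.comp B.repr.symm.toLinearIsometry
  let M : EV n →ₗ[ℝ] EV n := B.repr.toLinearMap ∘ₗ ((D : EV n →ₗ[ℝ] EW n).codRestrict (ℝ ∙ N)ᗮ fun v => by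
    rw [Submodule.mem_orthogonal_singleton_iff_inner_left]; exact hD v)
  have hJM : ∀ v, J (M v) = D v := fun v => by simp [J, M]
  have hJr : range J = {y | ⟪y, N⟫ = 0} := by
    ext y
    constructor
    · rintro ⟨v, rfl⟩
      exact (Submodule.mem_orthogonal_singleton_iff_inner_left).1 (B.repr.symm v).2
    · intro hy
      exact ⟨B.repr ⟨y, (Submodule.mem_orthogonal_singleton_iff_inner_left).2 hy⟩, by simp [J]⟩
  have hnM : ∀ v, ‖M v‖ = ‖D v‖ := fun v => by rw [← hJM v, J.norm_map]
  obtain ⟨d1, d2⟩ := det_bd (M := M) hη0 hη1 (fun v => by simpa [hnM] using h.up2 v 0) (fun v => by simpa [hnM] using h.low2 v 0)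
  refine ⟨_, d1, d2, ?_⟩
  have hdet : LinearMap.det M ≠ 0 := abs_pos.1 ((pow_pos (by linarith) n).trans_le d1)
  set G : EW n → ℝ := fun y => (K (N - y) + K (N + y)) / 2 with hG
  have hKm := hK.meas
  have hGm : Measurable G := by fun_prop
  have hSK : SK K D N = |LinearMap.det M|⁻¹ * ∫ v, G (J v) := by
    have h1 : SK K D N = ∫ u, G (J (M u)) := by simp_rw [hJM]; rfl
    have h2 := integral_map (μ := volume) (f := fun v => G (J v)) (LinearMap.continuous_of_finiteDimensional M).measurable.aemeasurable
      (hGm.comp J.continuous.measurable).aestronglyMeasurable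
    rw [h1, ← h2, Measure.map_linearMap_addHaar_eq_smul_addHaar _ hdet, integral_smul_measure, abs_inv, ENNReal.toReal_ofReal (by positivity), smul_eq_mul]
  have hCK : CK n Ω N = cH n * ∫ v, G (J v) := by
    have h1 : CK n Ω N = ∫ y in {y | ⟪y, N⟫ = 0}, G y ∂μH[n] := by
      refine setIntegral_congr_fun (measurableSet_eq_fun (by fun_prop) measurable_const) fun y hy => ?_
      have hy0 : ⟪y, N⟫ = 0 := hy
      have n1 : ‖y + N‖ ^ 2 = ‖y‖ ^ 2 + 1 := by rw [norm_add_sq_real, hy0, hN]; ring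
      have n2 : ‖y - N‖ ^ 2 = ‖y‖ ^ 2 + 1 := by rw [norm_sub_sq_real, hy0, hN]; ring
      have n3 : ∀ w : EW n, ‖w‖ ^ 2 = ‖y‖ ^ 2 + 1 → w ≠ 0 ∧ (‖y‖ ^ 2 + 1) ^ ((n : ℝ) / 2) = ‖w‖ ^ n := fun w hw => by
        constructor
        · rintro rfl; simp at hw; nlinarith [sq_nonneg ‖y‖]
        · rw [← hw, ← Real.rpow_natCast ‖w‖ 2, ← Real.rpow_mul (norm_nonneg w), ← Real.rpow_natCast]; congr 1; push_cast; ring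
      simp only [hG]
      rw [show N - y = -(y - N) by abel, hK.odd, add_comm N y, hf _ (n3 _ n1).1, hf _ (n3 _ n2).1, ← (n3 _ n1).2, ← (n3 _ n2).2]
      rw [← neg_div, ← add_div, div_div, mul_comm _ (2 : ℝ)]
      congr 1; ring
    rw [h1, ← hJr, ← J.isometry.map_hausdorffMeasure (Or.inl (Nat.cast_nonneg n)), integral_map J.continuous.measurable.aemeasurable hGm.aestronglyMeasurable,
      mH_eq, integral_smul_nnreal_measure]
    rfl
  rw [hCK, hSK]
  have := abs_pos.2 hdet
  field_simp
end ckrel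

section rect
variable {n : ℕ} {η : ℝ} {f : EV n → EW n}

lemma exists_iso (A : EV n →L[ℝ] EW n) (hA : Function.Injective A) :
    ∃ (ι : EV n →ₗᵢ[ℝ] EW n) (M : EV n ≃L[ℝ] EV n), ∀ v, ι (M v) = A v := by
  let A' : EV n →ₗ[ℝ] EW n := A
  have hA' : Function.Injective A' := hA
  have hfr : Module.finrank ℝ (LinearMap.range A') = n := by rw [LinearMap.finrank_range_of_inj hA']; simp
  let B := (stdOrthonormalBasis ℝ (LinearMap.range A')).reindex (finCongr hfr)
  let M : EV n →ₗ[ℝ] EV n := B.repr.toLinearMap ∘ₗ A'.rangeRestrict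
  have hM : Function.Injective M := B.repr.injective.comp fun x y hxy => hA' (congrArg Subtype.val hxy)
  refine ⟨(LinearMap.range A').subtypeₗᵢ.comp B.repr.symm.toLinearIsometry, (LinearEquiv.ofInjectiveEndo M hM).toContinuousLinearEquiv, fun v => ?_⟩
  simp [M, A']

lemma good_piece (hη : 0 < η) (hη1 : η ≤ 1 / 16) (A : EV n →L[ℝ] EW n) (hA : Function.Injective A) :
    ∃ r : ℝ≥0, r ≠ 0 ∧ ∀ s, ApproximatesLinearOn f A s r → ∃ γ ι, NearIso γ ι η ∧ f '' s ⊆ range γ := by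
  obtain ⟨ι, M, hM⟩ := exists_iso A hA
  set c := lipschitzExtensionConstant (EW n)
  have hc : 0 < c := lipschitzExtensionConstant_pos _
  set m : ℝ≥0 := ‖(M.symm : EV n →L[ℝ] EV n)‖₊
  set e : ℝ≥0 := ⟨η, hη.le⟩
  have he : 0 < e := hη
  refine ⟨e / (c * (m + 1)), by positivity, fun s hs => ?_⟩
  have hl : LipschitzOnWith (e / c) (fun u => f (M.symm u) - ι u) (M '' s) := by
    refine LipschitzOnWith.of_dist_le_mul ?_
    rintro _ ⟨x, hx, rfl⟩ _ ⟨y, hy, rfl⟩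
    have h1 := hs x hx y hy
    have h2 : ‖x - y‖ ≤ m * ‖M x - M y‖ := by
      have := (M.symm : EV n →L[ℝ] EV n).le_opNorm (M x - M y)
      rwa [ContinuousLinearEquiv.coe_coe, map_sub, M.symm_apply_apply, M.symm_apply_apply] at this
    rw [dist_eq_norm, dist_eq_norm]
    simp only [M.symm_apply_apply, hM]
    rw [show f x - A x - (f y - A y) = f x - f y - A (x - y) by rw [map_sub]; abel]
    refine h1.trans ?_
    calc ((e / (c * (m + 1)) : ℝ≥0) : ℝ) * ‖x - y‖ ≤ (e / (c * (m + 1)) : ℝ≥0) * ((m + 1) * ‖M x - M y‖) := by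
          gcongr; refine h2.trans ?_; gcongr; simp
      _ = _ := by push_cast; field_simp
  obtain ⟨g, hg, hge⟩ := hl.extend_finite_dimension
  rw [mul_div_cancel₀ _ hc.ne'] at hg
  refine ⟨fun u => ι u + g u, ι, ⟨hη1, fun u v => ?_⟩, ?_⟩
  · have := hg.dist_le_mul u v
    rw [dist_eq_norm, dist_eq_norm] at this
    rw [show ι u + g u - (ι v + g v) - ι (u - v) = g u - g v by rw [map_sub]; abel]
    exact this
  · rintro _ ⟨x, hx, rfl⟩
    refine ⟨M x, ?_⟩
    have := hge (mem_image_of_mem M hx)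
    simp only [M.symm_apply_apply] at this
    simp only [← this]; abel

lemma bad_piece (A : EV n →L[ℝ] EW n) (hA : ¬Function.Injective A) {ε : ℝ} (hε : 0 < ε) :
    ∃ r : ℝ≥0, r ≠ 0 ∧ ∀ s, ApproximatesLinearOn f A s r → μH[n] (f '' s) ≤ ofReal ε * μH[n] s := by
  obtain ⟨v, hv, hv1⟩ : ∃ v, A v = 0 ∧ ‖v‖ = 1 := by
    rw [injective_iff_map_eq_zero] at hA
    push Not at hA
    obtain ⟨w, hw, hw0⟩ := hA
    exact ⟨‖w‖⁻¹ • w, by rw [map_smul, hw, smul_zero], by rw [norm_smul, norm_inv, norm_norm, inv_mul_cancel₀ (norm_ne_zero_iff.2 hw0)]⟩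
  have hvv : ⟪v, v⟫ = 1 := by rw [real_inner_self_eq_norm_sq, hv1, one_pow]
  let P : EV n →L[ℝ] EV n := (innerSL ℝ v).smulRight v
  let H : ℝ → (EV n →L[ℝ] EV n) := fun ρ => ContinuousLinearMap.id ℝ (EV n) - (1 - ρ) • P
  have hdet0 : (H 0).det = 0 := by
    by_contra h0
    have h1 : H 0 v = 0 := by simp [H, P, hv1]
    have h2 := (LinearMap.equivOfDetNeZero (H 0 : EV n →ₗ[ℝ] EV n) h0).injective (a₁ := v) (a₂ := 0) (by simpa using h1)
    rw [h2, norm_zero] at hv1; exact zero_ne_one hv1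
  set c : ℝ≥0 := ‖A‖₊ + 2
  have hcont : Tendsto (fun ρ => (c : ℝ) ^ n * |(H ρ).det|) (𝓝[>] 0) (𝓝 0) := by
    have : Continuous fun ρ => (c : ℝ) ^ n * |(H ρ).det| := by
      refine continuous_const.mul (ContinuousLinearMap.continuous_det.comp ?_).abs
      fun_prop
    have h1 := this.tendsto 0
    simp only [hdet0, abs_zero, mul_zero] at h1
    exact h1.mono_left nhdsWithin_le_nhds
  obtain ⟨ρ, hρ, hρ0, hρ1⟩ := ((hcont.eventually (gt_mem_nhds hε)).and (Ioo_mem_nhdsGT one_pos)).exists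
  refine ⟨⟨ρ, hρ0.le⟩, fun h => hρ0.ne' (congrArg NNReal.toReal h), fun s hs => ?_⟩
  have hH : ∀ w, ‖A w‖ + ρ * ‖w‖ ≤ c * ‖H ρ w‖ := fun w => by
    set w' := w - ⟪v, w⟫ • v with hw'
    have e1 : H ρ w = w' + ρ • ⟪v, w⟫ • v := by
      simp only [H, P, hw', sub_apply, smul_apply, ContinuousLinearMap.smulRight_apply, innerSL_apply_apply, ContinuousLinearMap.id_apply, sub_smul, one_smul]; abel
    have e2 : A w = A w' := by rw [hw', map_sub, map_smul, hv, smul_zero, sub_zero]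
    have e3 : ⟪w', v⟫ = 0 := by rw [hw', inner_sub_left, real_inner_smul_left, hvv, mul_one, real_inner_comm, sub_self]
    have e4 : ‖H ρ w‖ ^ 2 = ‖w'‖ ^ 2 + (ρ * ‖⟪v, w⟫ • v‖) ^ 2 := by
      rw [e1, norm_add_sq_real, real_inner_smul_right, real_inner_smul_right, e3, norm_smul ρ, norm_of_nonneg hρ0.le]; ring
    have e5 : ‖w'‖ ≤ ‖H ρ w‖ := abs_le_of_sq_le_sq' (by nlinarith [sq_nonneg (ρ * ‖⟪v, w⟫ • v‖)]) (norm_nonneg _) |>.2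
    have e6 : ρ * ‖⟪v, w⟫ • v‖ ≤ ‖H ρ w‖ := abs_le_of_sq_le_sq' (by nlinarith [sq_nonneg ‖w'‖]) (norm_nonneg _) |>.2
    have e7 : ‖w‖ ≤ ‖w'‖ + ‖⟪v, w⟫ • v‖ := by
      have := norm_add_le w' (⟪v, w⟫ • v)
      rwa [hw', sub_add_cancel] at this
    have e8 := A.le_opNorm w'
    have e9 : (c : ℝ) = ‖A‖ + 2 := rfl
    rw [e2, e9]
    have := norm_nonneg w'
    have := mul_le_mul_of_nonneg_left e5 (norm_nonneg A)
    nlinarith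
  have hinj : Function.Injective (H ρ) := (injective_iff_map_eq_zero (H ρ)).2 fun w hw => by
    have := hH w
    rw [hw, norm_zero, mul_zero] at this
    have h2 : ρ * ‖w‖ ≤ 0 := by linarith [norm_nonneg (A w)]
    exact norm_le_zero_iff.1 (nonpos_of_mul_nonpos_right h2 hρ0)
  have hL : LipschitzOnWith c (f ∘ Function.invFun (H ρ)) (H ρ '' s) := by
    refine LipschitzOnWith.of_dist_le_mul ?_
    rintro _ ⟨x, hx, rfl⟩ _ ⟨y, hy, rfl⟩
    simp only [Function.comp, Function.leftInverse_invFun hinj _]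
    rw [dist_eq_norm, dist_eq_norm, ← map_sub]
    refine le_trans ?_ (hH (x - y))
    have h1 : _ ≤ ρ * ‖x - y‖ := hs x hx y hy
    have := norm_add_le (f x - f y - A (x - y)) (A (x - y))
    rw [sub_add_cancel] at this; linarith
  have h1 := hL.hausdorffMeasure_image_le (d := n) (Nat.cast_nonneg n)
  have h2 : (f ∘ Function.invFun (H ρ)) '' (H ρ '' s) = f '' s := by
    rw [image_image]; simp only [Function.comp, Function.leftInverse_invFun hinj _]
  have h3 := Measure.addHaar_image_continuousLinearMap (μH[n] : Measure (EV n)) (H ρ) s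
  rw [h2, h3, ← mul_assoc] at h1
  refine h1.trans ?_
  gcongr
  rw [ENNReal.rpow_natCast, ← ofReal_coe_nnreal, ← ofReal_pow (by positivity), ← ofReal_mul (by positivity)]
  exact ofReal_le_ofReal hρ.le

lemma bad_null {L : ℝ≥0} (hL : LipschitzWith L f) : μH[n] (f '' {x | DifferentiableAt ℝ f x → ¬Function.Injective (fderiv ℝ f x)}) = 0 := by
  have hnd : μH[n] (f '' {x | ¬DifferentiableAt ℝ f x}) = 0 := by
    have h1 := (hL.lipschitzOnWith (s := {x | ¬DifferentiableAt ℝ f x})).hausdorffMeasure_image_le (d := n) (Nat.cast_nonneg n)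
    have h2 : μH[n] {x | ¬DifferentiableAt ℝ f x} = 0 := by
      rw [mH_eq, Measure.smul_apply, show volume {x | ¬DifferentiableAt ℝ f x} = 0 from hL.ae_differentiableAt, smul_zero]
    rw [h2, mul_zero] at h1
    exact le_antisymm h1 zero_le
  have hdg : ∀ R : ℕ, μH[n] (f '' ({x | DifferentiableAt ℝ f x ∧ ¬Function.Injective (fderiv ℝ f x)} ∩ closedBall 0 R)) = 0 := fun R => by
    set S := {x | DifferentiableAt ℝ f x ∧ ¬Function.Injective (fderiv ℝ f x)} ∩ closedBall 0 R with hS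
    have hfin : μH[n] S < ∞ := (measure_mono inter_subset_right).trans_lt measure_closedBall_lt_top
    have key : ∀ ε > 0, μH[n] (f '' S) ≤ ofReal ε * μH[n] S := fun ε hε => by
      have hr : ∀ A : EV n →L[ℝ] EW n, ∃ r : ℝ≥0, r ≠ 0 ∧ (¬Function.Injective A → ∀ s, ApproximatesLinearOn f A s r → μH[n] (f '' s) ≤ ofReal ε * μH[n] s) := fun A => by
        by_cases hA : Function.Injective A
        · exact ⟨1, one_ne_zero, fun h => absurd hA h⟩
        · obtain ⟨r, h1, h2⟩ := bad_piece (f := f) A hA hε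
          exact ⟨r, h1, fun _ => h2⟩
      choose r hr0 hr using hr
      rcases S.eq_empty_or_nonempty with h0 | hne
      · rw [h0, image_empty, measure_empty]; exact zero_le
      obtain ⟨t, A, htd, htm, hcov, happ, hA⟩ := exists_partition_approximatesLinearOn_of_hasFDerivWithinAt f S (fderiv ℝ f)
        (fun x hx => hx.1.1.hasFDerivAt.hasFDerivWithinAt) r hr0
      have hAi : ∀ k, ¬Function.Injective (A k) := fun k => by
        obtain ⟨y, hy, e⟩ := hA hne k
        rw [e]; exact hy.1.2
      calc μH[n] (f '' S) ≤ μH[n] (⋃ k, f '' (S ∩ t k)) := by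
            refine measure_mono ?_
            rw [← image_iUnion, ← inter_iUnion, inter_eq_left.2 hcov]
        _ ≤ ∑' k, μH[n] (f '' (S ∩ t k)) := measure_iUnion_le _
        _ ≤ ∑' k, ofReal ε * (μH[n].restrict S) (t k) := by
            refine ENNReal.tsum_le_tsum fun k => ?_
            rw [Measure.restrict_apply (htm k), inter_comm]
            exact hr _ (hAi k) _ (by rw [inter_comm]; exact happ k)
        _ = ofReal ε * (μH[n].restrict S) (⋃ k, t k) := by rw [ENNReal.tsum_mul_left, measure_iUnion htd htm]
        _ ≤ _ := mul_le_mul' le_rfl ((measure_mono (subset_univ _)).trans_eq (Measure.restrict_apply_univ _))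
    have h1 : Tendsto (fun ε : ℝ => ofReal ε * μH[n] S) (𝓝[>] 0) (𝓝 0) := by
      have := ENNReal.Tendsto.mul_const (ENNReal.tendsto_ofReal (tendsto_id (α := ℝ) (x := 𝓝 0))) (b := μH[n] S) (Or.inr hfin.ne)
      simp only [ofReal_zero, zero_mul, id] at this
      exact this.mono_left nhdsWithin_le_nhds
    exact le_antisymm (ge_of_tendsto h1 (by filter_upwards [self_mem_nhdsWithin] with ε hε using key ε hε)) zero_le
  refine measure_mono_null (t := f '' {x | ¬DifferentiableAt ℝ f x} ∪ ⋃ R : ℕ, f '' ({x | DifferentiableAt ℝ f x ∧ ¬Function.Injective (fderiv ℝ f x)} ∩ closedBall 0 R)) ?_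
    (measure_union_null hnd (measure_iUnion_null hdg))
  rintro _ ⟨x, hx, rfl⟩
  by_cases hd : DifferentiableAt ℝ f x
  · right
    obtain ⟨R, hR⟩ := exists_nat_ge ‖x‖
    exact mem_iUnion.2 ⟨R, x, ⟨⟨hd, hx hd⟩, mem_closedBall_zero_iff.2 hR⟩, rfl⟩
  · exact Or.inl ⟨x, hd, rfl⟩

lemma rect_one {L : ℝ≥0} (hL : LipschitzWith L f) (hη : 0 < η) (hη1 : η ≤ 1 / 16) :
    ∃ G : Set (EV n → EW n), G.Countable ∧ (∀ γ ∈ G, ∃ ι, NearIso γ ι η) ∧ μH[n] (range f \ ⋃ γ ∈ G, range γ) = 0 := by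
  set S := {x | DifferentiableAt ℝ f x ∧ Function.Injective (fderiv ℝ f x)} with hS
  obtain ⟨G, hG, hGn, hGc⟩ : ∃ G : Set (EV n → EW n), G.Countable ∧ (∀ γ ∈ G, ∃ ι, NearIso γ ι η) ∧ f '' S ⊆ ⋃ γ ∈ G, range γ := by
    rcases S.eq_empty_or_nonempty with h0 | hne
    · exact ⟨∅, countable_empty, by simp, by simp [h0]⟩
    have hr : ∀ A : EV n →L[ℝ] EW n, ∃ r : ℝ≥0, r ≠ 0 ∧ (Function.Injective A → ∀ s, ApproximatesLinearOn f A s r → ∃ γ ι, NearIso γ ι η ∧ f '' s ⊆ range γ) := fun A => by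
      by_cases hA : Function.Injective A
      · obtain ⟨r, h1, h2⟩ := good_piece (f := f) hη hη1 A hA
        exact ⟨r, h1, fun _ => h2⟩
      · exact ⟨1, one_ne_zero, fun h => absurd h hA⟩
    choose r hr0 hr using hr
    obtain ⟨t, A, htd, htm, hcov, happ, hA⟩ := exists_partition_approximatesLinearOn_of_hasFDerivWithinAt f S (fderiv ℝ f)
      (fun x hx => hx.1.hasFDerivAt.hasFDerivWithinAt) r hr0
    have := fun k => hr (A k) (by obtain ⟨y, hy, e⟩ := hA hne k; rw [e]; exact hy.2) _ (happ k)
    choose g ι h1 h2 using this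
    refine ⟨range g, countable_range g, by rintro _ ⟨k, rfl⟩; exact ⟨ι k, h1 k⟩, ?_⟩
    rw [biUnion_range, ← inter_eq_left.2 hcov, inter_iUnion, image_iUnion]
    exact iUnion_mono h2
  refine ⟨G, hG, hGn, measure_mono_null ?_ (bad_null hL)⟩
  rintro _ ⟨⟨x, rfl⟩, hx⟩
  exact ⟨x, fun hd hi => hx (hGc ⟨x, ⟨hd, hi⟩, rfl⟩), rfl⟩

lemma rect_cover {E : Set (EW n)} (hE : Rectifiable n E) (hη : 0 < η) (hη1 : η ≤ 1 / 16) :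
    ∃ G : Set (EV n → EW n), G.Countable ∧ (∀ γ ∈ G, ∃ ι, NearIso γ ι η) ∧ μH[n] (E \ ⋃ γ ∈ G, range γ) = 0 := by
  obtain ⟨f, hf, h0⟩ := hE
  have := fun k => rect_one (hf k).choose_spec hη hη1
  choose G h1 h2 h3 using this
  refine ⟨⋃ k, G k, countable_iUnion h1, fun γ hγ => ?_, measure_mono_null ?_ (measure_union_null h0 (measure_iUnion_null h3))⟩
  · obtain ⟨k, hk⟩ := mem_iUnion.1 hγ
    exact h2 k γ hk
  · rintro x ⟨hx, hxG⟩
    by_cases hr : x ∈ ⋃ k, range (f k)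
    · obtain ⟨k, hk⟩ := mem_iUnion.1 hr
      refine Or.inr (mem_iUnion.2 ⟨k, hk, fun h => hxG ?_⟩)
      simp only [mem_iUnion] at h ⊢
      obtain ⟨γ, hγ, hx⟩ := h
      exact ⟨γ, ⟨k, hγ⟩, hx⟩
    · exact Or.inl ⟨hx, hr⟩
end rect

section assembly
variable {n : ℕ} {γ : EV n → EW n} {ι : EV n →ₗᵢ[ℝ] EW n} {η : ℝ} {K : EW n → ℝ} {C a b : ℝ}

lemma NearIso.anti (h : NearIso γ ι η) : AntilipschitzWith (Real.toNNReal (1 - η)⁻¹) γ :=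
  AntilipschitzWith.of_le_mul_dist fun s t => by
    have h1 : 0 < 1 - η := by linarith [h.le]
    have := h.low2 s t
    rw [dist_eq_norm, dist_eq_norm, Real.coe_toNNReal _ (inv_nonneg.2 h1.le), inv_mul_eq_div, le_div_iff₀ h1]; linarith

lemma NearIso.emb (h : NearIso γ ι η) : Topology.IsClosedEmbedding γ :=
  h.anti.isClosedEmbedding h.lip.uniformContinuous

lemma BL (hn : 1 ≤ n) (h : NearIso γ ι η) {A : Set (EW n)} (hA : MeasurableSet A) :
    ofReal (cH n * (1 - η) ^ n) * (volume.map γ) A ≤ μH[n] (A ∩ range γ) ∧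
    μH[n] (A ∩ range γ) ≤ ofReal (cH n * (1 + η) ^ n) * (volume.map γ) A := by
  have h1 : 0 < 1 - η := by linarith [h.le]
  have h0 := h.eta0 hn
  rw [Measure.map_apply h.cont.measurable hA, ← image_preimage_eq_inter_range]
  set S := γ ⁻¹' A
  have hS : μH[n] S = ofReal (cH n) * volume S := by
    rw [mH_eq, Measure.smul_apply, ofReal_coe_nnreal]; rfl
  constructor
  · have := h.anti.le_hausdorffMeasure_image (d := n) (by positivity) S
    rw [hS, ENNReal.rpow_natCast] at this
    change _ ≤ ofReal (1 - η)⁻¹ ^ n * _ at this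
    calc _ = ofReal ((1 - η) ^ n) * (ofReal (cH n) * volume S) := by
          rw [ofReal_mul (by positivity)]; ring
      _ ≤ ofReal ((1 - η) ^ n) * (ofReal (1 - η)⁻¹ ^ n * μH[n] (γ '' S)) := by gcongr
      _ = _ := by
        rw [← mul_assoc, ← ofReal_pow (inv_nonneg.2 h1.le), ← ofReal_mul (by positivity), ← mul_pow, mul_inv_cancel₀ h1.ne']
        simp
  · have hl : LipschitzWith (Real.toNNReal (1 + η)) γ := LipschitzWith.of_dist_le_mul fun s t => by
      rw [dist_eq_norm, dist_eq_norm, Real.coe_toNNReal _ (by linarith)]; exact h.up2 s t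
    have := hl.hausdorffMeasure_image_le (d := n) (by positivity) S
    rw [hS, ENNReal.rpow_natCast] at this
    change _ ≤ ofReal (1 + η) ^ n * _ at this
    rw [← mul_assoc, ← ofReal_pow (by linarith), ← ofReal_mul (by positivity), mul_comm _ (cH n : ℝ)] at this
    exact this

/-- density bounds -/
lemma psi_bd (hn : 1 ≤ n) (h : NearIso γ ι η) {T : Set (EW n)} (hT : MeasurableSet T) [IsLocallyFiniteMeasure ((hM n).restrict T)] :
    ((hM n).restrict T).restrict (range γ) ≪ (volume.map γ).restrict T ∧
    ∀ᵐ x ∂(volume.map γ).restrict T,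
      ofReal (cH n * (1 - η) ^ n) ≤ (((hM n).restrict T).restrict (range γ)).rnDeriv (volume.map γ) x ∧
      (((hM n).restrict T).restrict (range γ)).rnDeriv (volume.map γ) x ≤ ofReal (cH n * (1 + η) ^ n) := by
  have := tau_lf h
  set m := (hM n).restrict T with hm
  set τ := volume.map γ with hτ
  have hR : MeasurableSet (range γ) := h.emb.isClosed_range.measurableSet
  have key : ∀ A, MeasurableSet A → m.restrict (range γ) A = μH[n] ((A ∩ T) ∩ range γ) := fun A hA => by
    rw [Measure.restrict_apply hA, hm, Measure.restrict_apply (hA.inter hR)]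
    congr 1; ext; simp; tauto
  have hac : m.restrict (range γ) ≪ τ.restrict T := Measure.AbsolutelyContinuous.mk fun A hA h0 => by
    rw [Measure.restrict_apply hA] at h0
    have := (BL hn h (hA.inter hT)).2
    rw [← hτ, h0, mul_zero] at this
    rw [key A hA]; exact le_antisymm this zero_le
  have hac2 : m.restrict (range γ) ≪ τ := hac.trans (Measure.absolutelyContinuous_of_le Measure.restrict_le_self)
  refine ⟨hac, ?_⟩
  have hi : ∀ s, MeasurableSet s → ∫⁻ x in s, (m.restrict (range γ)).rnDeriv τ x ∂τ = μH[n] ((s ∩ T) ∩ range γ) := fun s hs => by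
    rw [Measure.setLIntegral_rnDeriv hac2 s, key s hs]
  have l1 : (fun _ => ofReal (cH n * (1 - η) ^ n)) ≤ᵐ[τ.restrict T] (m.restrict (range γ)).rnDeriv τ := by
    refine ae_le_of_forall_setLIntegral_le_of_sigmaFinite measurable_const fun s hs _ => ?_
    rw [setLIntegral_const, Measure.restrict_restrict hs, Measure.restrict_apply hs, hi _ (hs.inter hT), inter_assoc s, inter_self]
    exact (BL hn h (hs.inter hT)).1
  have l2 : (m.restrict (range γ)).rnDeriv τ ≤ᵐ[τ.restrict T] (fun _ => ofReal (cH n * (1 + η) ^ n)) := by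
    refine ae_le_of_forall_setLIntegral_le_of_sigmaFinite (Measure.measurable_rnDeriv _ _) fun s hs _ => ?_
    rw [setLIntegral_const, Measure.restrict_restrict hs, Measure.restrict_apply hs, hi _ (hs.inter hT), inter_assoc s, inter_self]
    exact (BL hn h (hs.inter hT)).2
  filter_upwards [l1, l2] with x a1 a2 using ⟨a1, a2⟩

lemma rn_chain (h : NearIso γ ι η) (m : Measure (EW n)) [IsLocallyFiniteMeasure m] (hac : m.restrict (range γ) ≪ volume.map γ)
    (σ : Measure (EW n)) [IsFiniteMeasure σ] :
    ∀ᵐ x ∂m.restrict (range γ), σ.rnDeriv (volume.map γ) x = σ.rnDeriv m x * (m.restrict (range γ)).rnDeriv (volume.map γ) x := by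
  have := tau_lf h
  have hR : MeasurableSet (range γ) := h.emb.isClosed_range.measurableSet
  have hm : m.restrict (range γ) ≪ m := Measure.absolutelyContinuous_of_le Measure.restrict_le_self
  have l1 := Measure.rnDeriv_mul_rnDeriv' (μ := σ) hac
  have l2 := Measure.rnDeriv_mul_rnDeriv' (μ := σ) hm
  have l3 := hm (Measure.rnDeriv_restrict_self m hR)
  filter_upwards [l1, l2, l3, ae_restrict_mem hR] with x a1 a2 a3 a4
  rw [← a1, ← a2]
  simp [a3, a4]
end assembly

section assembly2
variable {n : ℕ} {γ : EV n → EW n} {ι : EV n →ₗᵢ[ℝ] EW n} {η : ℝ} {K : EW n → ℝ} {C a b : ℝ}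

lemma cone_meas (a : ℝ) (x u : EW n) : MeasurableSet (cone a x u) := by
  have : IsOpen (cone a x u) := isOpen_lt (by fun_prop) (by fun_prop)
  exact this.measurableSet

lemma tang_le (h : NearIso γ ι η) {s : EV n} (hd : DifferentiableAt ℝ γ s) {N : EW n}
    (H : ∀ a ∈ Ioo (0 : ℝ) 1, Tendsto (fun r => (volume.map γ) (cone a (γ s) N ∩ ball (γ s) r) / ofReal (r ^ n)) (𝓝[>] 0) (𝓝 0))
    (v : EV n) : ⟪fderiv ℝ γ s v, N⟫ ≤ 0 := by
  by_contra! hp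
  set w := fderiv ℝ γ s v with hw
  set p := ⟪w, N⟫ with hpd
  set a := min (1 / 2) (p / (2 * (‖w‖ + 1))) with ha
  have hw0 := norm_nonneg w
  have ha0 : 0 < a := lt_min (by norm_num) (by positivity)
  have ha1 : a < 1 := (min_le_left _ _).trans_lt (by norm_num)
  have haw : a * ‖w‖ < ⟪w, N⟫ := by
    have : a ≤ p / (2 * (‖w‖ + 1)) := min_le_right _ _
    rw [le_div_iff₀ (by positivity)] at this
    nlinarith
  have ho : IsOpen {z : EW n | a * ‖z‖ < ⟪z, N⟫} := isOpen_lt (by fun_prop) (by fun_prop)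
  obtain ⟨ε, hε, hsub⟩ := Metric.isOpen_iff.1 ho w haw
  set M := 2 * (‖v‖ + ε / 4) + 1 with hM
  have hM0 : 0 < M := by positivity
  have hMt : Tendsto (fun r : ℝ => M * r) (𝓝[>] 0) (𝓝[>] 0) := by
    refine tendsto_nhdsWithin_iff.2 ⟨?_, ?_⟩
    · have : Tendsto (fun r : ℝ => M * r) (𝓝 0) (𝓝 (M * 0)) := tendsto_id.const_mul M
      rw [mul_zero] at this; exact this.mono_left nhdsWithin_le_nhds
    · filter_upwards [self_mem_nhdsWithin] with r hr using mul_pos hM0 hr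
  have H1 := (H a ⟨ha0, ha1⟩).comp hMt
  have hg := Metric.tendsto_nhds.1 (gsc_lim hd v) (ε / 4) (by positivity)
  have hbn : 0 < bn n := bn_pos
  have hc : ofReal (bn n * (ε / 4) ^ n / M ^ n) ≤ 0 := by
    refine ge_of_tendsto H1 ?_
    filter_upwards [hg, self_mem_nhdsWithin] with r hr hr0
    have hr0 : 0 < r := hr0
    have hin : closedBall (s + r • v) (r * (ε / 4)) ⊆ γ ⁻¹' (cone a (γ s) N ∩ ball (γ s) (M * r)) := fun t ht => by
      set u := r⁻¹ • (t - s) with hu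
      have htu : t = s + r • u := by rw [hu, smul_smul, mul_inv_cancel₀ hr0.ne', one_smul]; abel
      have huv : ‖u - v‖ ≤ ε / 4 := by
        rw [mem_closedBall, dist_eq_norm, htu, add_sub_add_left_eq_sub, ← smul_sub, norm_smul, norm_of_nonneg hr0.le] at ht
        exact le_of_mul_le_mul_left ht hr0
      have h1 := (gsc_near h s hr0).up u v
      have h2 := (gsc_near h s hr0).up u 0
      rw [gsc_zero, sub_zero, sub_zero] at h2
      have h3 : ‖u‖ ≤ ‖v‖ + ε / 4 := by
        have := norm_sub_norm_le u v; linarith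
      have hz : gsc γ s r u ∈ {z : EW n | a * ‖z‖ < ⟪z, N⟫} := hsub (by
        rw [mem_ball]
        refine (dist_triangle _ (gsc γ s r v) _).trans_lt ?_
        rw [dist_eq_norm]; linarith)
      have hz' : a * ‖gsc γ s r u‖ < ⟪gsc γ s r u, N⟫ := hz
      have e : γ t - γ s = r • gsc γ s r u := by rw [gsc, smul_smul, mul_inv_cancel₀ hr0.ne', one_smul, ← htu]
      refine ⟨?_, ?_⟩
      · change a * ‖γ t - γ s‖ < ⟪γ t - γ s, N⟫
        rw [e, norm_smul, norm_of_nonneg hr0.le, real_inner_smul_left]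
        nlinarith
      · rw [mem_ball, dist_eq_norm, e, norm_smul, norm_of_nonneg hr0.le]
        nlinarith
    have hτ : ofReal (bn n * (r * (ε / 4)) ^ n) ≤ (volume.map γ) (cone a (γ s) N ∩ ball (γ s) (M * r)) := by
      rw [Measure.map_apply h.cont.measurable ((cone_meas _ _ _).inter measurableSet_ball), ← vol_ball_eq (s + r • v) (by positivity)]
      exact measure_mono hin
    rw [Function.comp, ENNReal.le_div_iff_mul_le (Or.inl (by simp; positivity)) (Or.inl ofReal_ne_top), ← ofReal_mul (by positivity)]
    convert hτ using 2
    field_simp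
    simp only [div_pow, mul_pow]; ring
  have : ofReal (bn n * (ε / 4) ^ n / M ^ n) ≠ 0 := by simp; positivity
  exact this (le_antisymm hc zero_le)

lemma tang_eq (h : NearIso γ ι η) {s : EV n} (hd : DifferentiableAt ℝ γ s) {N : EW n}
    (H : ∀ a ∈ Ioo (0 : ℝ) 1, Tendsto (fun r => (volume.map γ) (cone a (γ s) N ∩ ball (γ s) r) / ofReal (r ^ n)) (𝓝[>] 0) (𝓝 0))
    (v : EV n) : ⟪fderiv ℝ γ s v, N⟫ = 0 := by
  have h1 := tang_le h hd H v
  have h2 := tang_le h hd H (-v)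
  rw [map_neg, inner_neg_left] at h2
  linarith

lemma dens (h : NearIso γ ι η) {T : Set (EW n)} (hT : MeasurableSet T) :
    ∀ᵐ x ∂(volume.map γ).restrict T, Tendsto (fun r => (volume.map γ) (Tᶜ ∩ closedBall x r) / ofReal (r ^ n)) (𝓝[>] 0) (𝓝 0) := by
  have := tau_lf h
  filter_upwards [ae_restrict_of_ae (Besicovitch.ae_tendsto_measure_inter_div_of_measurableSet (volume.map γ) hT.compl), ae_restrict_mem hT] with x hx hxT
  have e : ∀ r, ((volume.map γ).restrict Tᶜ) (closedBall x r) = (volume.map γ) (Tᶜ ∩ closedBall x r) := fun r => by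
    rw [Measure.restrict_apply measurableSet_closedBall, inter_comm]
  have := leb_pt (volume.map γ) (fun x r hr => tau_bd h x hr) ((volume.map γ).restrict Tᶜ) x (by
    simp_rw [e]
    simpa [hxT] using hx) (fun r _ h0 => Measure.absolutelyContinuous_of_le Measure.restrict_le_self h0)
  simp_rw [e] at this
  exact this

lemma tang_H (hn : 1 ≤ n) (h : NearIso γ ι η) {E T : Set (EW n)} (hT : MeasurableSet T)
    (hET : (hM n).restrict T = (hM n).restrict E) {x N : EW n}
    (hx : Tendsto (fun r => (volume.map γ) (Tᶜ ∩ closedBall x r) / ofReal (r ^ n)) (𝓝[>] 0) (𝓝 0)) (hN : HasApproxTangentNormal n E x N) :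
    ∀ a ∈ Ioo (0 : ℝ) 1, Tendsto (fun r => (volume.map γ) (cone a x N ∩ ball x r) / ofReal (r ^ n)) (𝓝[>] 0) (𝓝 0) := by
  intro a ha
  have h1 : 0 < 1 - η := by linarith [h.le]
  have hc : 0 < (cH n : ℝ) := cH_pos
  set c := ofReal (cH n * (1 - η) ^ n) with hcd
  have hc0 : c ≠ 0 := (ofReal_pos.2 (by positivity)).ne'
  have hct : c ≠ ∞ := ofReal_ne_top
  have H := (ENNReal.Tendsto.const_mul (a := c⁻¹) (hN.2 a ha) (Or.inr (ENNReal.inv_ne_top.2 hc0))).add hx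
  rw [mul_zero, add_zero] at H
  refine tendsto_of_tendsto_of_tendsto_of_le_of_le tendsto_const_nhds H (fun _ => zero_le) fun r => ?_
  have hX := (cone_meas a x N).inter (measurableSet_ball (x := x) (ε := r))
  simp only []
  rw [← mul_div_assoc, ← ENNReal.add_div]
  gcongr
  have k1 : c * (volume.map γ) ((cone a x N ∩ ball x r) ∩ T) ≤ μH[n] (E ∩ (cone a x N ∪ cone a x (-N)) ∩ ball x r) := by
    refine (BL hn h (hX.inter hT)).1.trans ((measure_mono inter_subset_left).trans ?_)
    rw [← Measure.restrict_apply hX, hET, Measure.restrict_apply hX]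
    refine measure_mono fun z hz => ⟨⟨hz.2, Or.inl hz.1.1⟩, hz.1.2⟩
  calc _ ≤ (volume.map γ) ((cone a x N ∩ ball x r) ∩ T) + (volume.map γ) (Tᶜ ∩ closedBall x r) := by
        refine (measure_mono fun z hz => ?_).trans (measure_union_le _ _)
        by_cases hzT : z ∈ T
        · exact Or.inl ⟨hz, hzT⟩
        · exact Or.inr ⟨hzT, ball_subset_closedBall hz.2⟩
    _ ≤ _ := by
        gcongr
        calc _ = c⁻¹ * (c * (volume.map γ) ((cone a x N ∩ ball x r) ∩ T)) := by
              rw [← mul_assoc, ENNReal.inv_mul_cancel hc0 hct, one_mul]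
          _ ≤ _ := by gcongr

lemma cone_nebot (ha : a < 1) {x N : EW n} (hN : ‖N‖ = 1) : (𝓝[cone a x N] x).NeBot := by
  rw [← mem_closure_iff_nhdsWithin_neBot]
  have : Tendsto (fun t : ℝ => x + t • N) (𝓝[>] 0) (𝓝 x) := by
    have : Tendsto (fun t : ℝ => x + t • N) (𝓝 0) (𝓝 (x + (0 : ℝ) • N)) := Continuous.tendsto (by fun_prop) 0
    rw [zero_smul, add_zero] at this
    exact this.mono_left nhdsWithin_le_nhds
  refine mem_closure_of_tendsto this ?_
  filter_upwards [self_mem_nhdsWithin] with t ht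
  have ht : 0 < t := ht
  change a * ‖x + t • N - x‖ < ⟪x + t • N - x, N⟫
  rw [add_sub_cancel_left, norm_smul, real_inner_smul_left, real_inner_self_eq_norm_sq, hN, norm_of_nonneg ht.le]
  nlinarith
end assembly2

section assembly3
variable {n : ℕ} {γ : EV n → EW n} {ι : EV n →ₗᵢ[ℝ] EW n} {η : ℝ} {K : EW n → ℝ} {C a b : ℝ}

def JumpAt (n : ℕ) (K Ω : EW n → ℝ) (a b : ℝ) (σ : Measure (EW n)) (x N : EW n) (l Tp Tm κ : ℝ) : Prop :=
  Tendsto (fun y => ∫ z, (if b * dist x y < dist y z then K (y - z) else 0) ∂σ) (𝓝[cone a x N] x) (𝓝 Tp) ∧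
  Tendsto (fun y => ∫ z, (if b * dist x y < dist y z then K (y - z) else 0) ∂σ) (𝓝[cone a x (-N)] x) (𝓝 Tm) ∧
  (Tp - Tm) / 2 = κ * (CK n Ω N * l)

lemma per_gamma (hK : CZK n K C) {Ω : EW n → ℝ} (hf : ∀ x, x ≠ 0 → K x = Ω x / ‖x‖ ^ n) (h : NearIso γ ι η)
    (hb : 0 < b) (hba : b < a) (ha : a < 1) {E T : Set (EW n)} (hT : MeasurableSet T)
    (hET : (hM n).restrict T = (hM n).restrict E)
    [IsLocallyFiniteMeasure ((hM n).restrict T)] {N : EW n → EW n}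
    (hN : ∀ᵐ x ∂(hM n).restrict T, HasApproxTangentNormal n E x (N x)) (σ : Measure (EW n)) [IsFiniteMeasure σ] :
    ∀ᵐ x ∂((hM n).restrict T).restrict (range γ), ∃ Tp Tm κ : ℝ,
      ((1 - η) / (1 + η)) ^ n ≤ κ ∧ κ ≤ ((1 + η) / (1 - η)) ^ n ∧
      JumpAt n K Ω a b σ x (N x) (σ.rnDeriv ((hM n).restrict T) x).toReal Tp Tm κ := by
  have hn := hK.one_le_n
  have h0 := h.eta0 hn
  have h1 : 0 < 1 - η := by linarith [h.le]
  have hcH : 0 < (cH n : ℝ) := cH_pos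
  obtain ⟨hac, hψ⟩ := psi_bd hn h hT
  set m := (hM n).restrict T with hm
  set τ := volume.map γ with hτ
  have hτT : τ.restrict T ≪ τ := Measure.absolutelyContinuous_of_le Measure.restrict_le_self
  have hac2 := hac.trans hτT
  have hl : ∀ᵐ s, DifferentiableAt ℝ γ s ∧ ∃ P : ℝ, ∀ N : EW n, ‖N‖ = 1 → (∀ v, ⟪fderiv ℝ γ s v, N⟫ = 0) →
      Tendsto (fun y => ∫ z, (if b * dist (γ s) y < dist y z then K (y - z) else 0) ∂σ) (𝓝[cone a (γ s) N] (γ s))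
        (𝓝 (P + (σ.rnDeriv τ (γ s)).toReal * SK K (fderiv ℝ γ s) N)) := by
    filter_upwards [h.lip.ae_differentiableAt, local_main hK h σ hb hba ha] with s a1 a2 using ⟨a1, a2⟩
  have hl2 : ∀ᵐ x ∂τ, ∃ s, γ s = x ∧ DifferentiableAt ℝ γ s ∧ ∃ P : ℝ, ∀ N : EW n, ‖N‖ = 1 → (∀ v, ⟪fderiv ℝ γ s v, N⟫ = 0) →
      Tendsto (fun y => ∫ z, (if b * dist (γ s) y < dist y z then K (y - z) else 0) ∂σ) (𝓝[cone a (γ s) N] (γ s))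
        (𝓝 (P + (σ.rnDeriv τ (γ s)).toReal * SK K (fderiv ℝ γ s) N)) := by
    rw [hτ, h.emb.measurableEmbedding.ae_map_iff]
    filter_upwards [hl] with s hs using ⟨s, rfl, hs⟩
  filter_upwards [hac2.ae_le hl2, hac.ae_le hψ, hac.ae_le (dens h hT), rn_chain h m hac2 σ, ae_restrict_of_ae hN] with x hx1 hx2 hx3 hx4 hx5
  obtain ⟨s, rfl, hd, P, hP⟩ := hx1
  have hD := tang_eq h hd (tang_H hn h hT hET hx3 hx5)
  have hN1 := hx5.1
  obtain ⟨c, hc1, hc2, hCK⟩ := CK_rel hK hf (fderiv_near h hd) hN1 hD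
  set ψ := (m.restrict (range γ)).rnDeriv τ (γ s)
  have hψt : ψ ≠ ∞ := ne_top_of_le_ne_top ofReal_ne_top hx2.2
  have p1 : cH n * (1 - η) ^ n ≤ ψ.toReal := (ofReal_le_iff_le_toReal hψt).1 hx2.1
  have p2 : ψ.toReal ≤ cH n * (1 + η) ^ n := ENNReal.toReal_le_of_le_ofReal (by positivity) hx2.2
  have hc0 : 0 < c := (pow_pos h1 n).trans_le hc1
  refine ⟨_, _, ψ.toReal / (cH n * c), ?_, ?_, hP _ hN1 hD, hP (-N (γ s)) (by rw [norm_neg, hN1]) (fun v => by rw [inner_neg_right, hD, neg_zero]), ?_⟩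
  · rw [div_pow]
    calc _ = cH n * (1 - η) ^ n / (cH n * (1 + η) ^ n) := by field_simp
      _ ≤ _ := by gcongr
  · rw [div_pow]
    calc _ ≤ cH n * (1 + η) ^ n / (cH n * (1 - η) ^ n) := by gcongr
      _ = _ := by field_simp
  · rw [SK_neg hK, hCK, hx4, ENNReal.toReal_mul]
    field_simp
    ring

lemma all_gamma (hK : CZK n K C) {Ω : EW n → ℝ} (hf : ∀ x, x ≠ 0 → K x = Ω x / ‖x‖ ^ n) (hη : 0 < η) (hη1 : η ≤ 1 / 16)
    (hb : 0 < b) (hba : b < a) (ha : a < 1) {E T : Set (EW n)} (hT : MeasurableSet T) (hE : Rectifiable n E)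
    (hET : (hM n).restrict T = (hM n).restrict E)
    [IsLocallyFiniteMeasure ((hM n).restrict T)] {N : EW n → EW n}
    (hN : ∀ᵐ x ∂(hM n).restrict T, HasApproxTangentNormal n E x (N x)) (σ : Measure (EW n)) [IsFiniteMeasure σ] :
    ∀ᵐ x ∂(hM n).restrict T, ∃ Tp Tm κ : ℝ,
      ((1 - η) / (1 + η)) ^ n ≤ κ ∧ κ ≤ ((1 + η) / (1 - η)) ^ n ∧
      JumpAt n K Ω a b σ x (N x) (σ.rnDeriv ((hM n).restrict T) x).toReal Tp Tm κ := by
  obtain ⟨G, hG, hGi, hG0⟩ := rect_cover hE hη hη1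
  have h1 : ∀ᵐ x ∂((hM n).restrict T).restrict (⋃ γ ∈ G, range γ), ∃ Tp Tm κ : ℝ,
      ((1 - η) / (1 + η)) ^ n ≤ κ ∧ κ ≤ ((1 + η) / (1 - η)) ^ n ∧
      JumpAt n K Ω a b σ x (N x) (σ.rnDeriv ((hM n).restrict T) x).toReal Tp Tm κ := by
    rw [ae_restrict_biUnion_iff _ hG]
    intro γ hγ
    obtain ⟨ι, hι⟩ := hGi γ hγ
    exact per_gamma hK hf hι hb hba ha hT hET hN σ
  have hU : MeasurableSet (⋃ γ ∈ G, range γ) := MeasurableSet.biUnion hG fun γ hγ => by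
    obtain ⟨ι, hι⟩ := hGi γ hγ
    exact hι.emb.isClosed_range.measurableSet
  have hs : ((hM n).restrict T).restrict (⋃ γ ∈ G, range γ) = (hM n).restrict T := by
    refine Measure.restrict_eq_self_of_ae_mem ?_
    rw [hET]
    refine (measure_eq_zero_iff_ae_notMem.1 (?_ : ((hM n).restrict E) (⋃ γ ∈ G, range γ)ᶜ = 0)).mono fun x hx => not_not.1 hx
    rw [Measure.restrict_apply hU.compl, inter_comm]
    exact hG0
  rw [hs] at h1
  exact h1

lemma jump_pos (hK : CZK n K C) {Ω : EW n → ℝ} (hf : ∀ x, x ≠ 0 → K x = Ω x / ‖x‖ ^ n)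
    (hb : 0 < b) (hba : b < a) (ha : a < 1) {E T : Set (EW n)} (hT : MeasurableSet T) (hE : Rectifiable n E)
    (hET : (hM n).restrict T = (hM n).restrict E)
    [IsLocallyFiniteMeasure ((hM n).restrict T)] {N : EW n → EW n}
    (hN : ∀ᵐ x ∂(hM n).restrict T, HasApproxTangentNormal n E x (N x)) (σ : Measure (EW n)) [IsFiniteMeasure σ] :
    ∀ᵐ x ∂(hM n).restrict T, ∃ Tp Tm : ℝ,
      JumpAt n K Ω a b σ x (N x) (σ.rnDeriv ((hM n).restrict T) x).toReal Tp Tm 1 := by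
  have h1 := fun k : ℕ => all_gamma hK hf (η := 1 / ((k : ℝ) + 16)) (by positivity) (by gcongr; linarith [(Nat.cast_nonneg k : (0 : ℝ) ≤ k)]) hb hba ha hT hE hET hN σ
  filter_upwards [ae_all_iff.2 h1, hN] with x hx hxN
  choose Tp Tm κ hκ1 hκ2 hJ using hx
  have n1 := cone_nebot (x := x) ha hxN.1
  have n2 := cone_nebot (x := x) (N := -N x) ha (by rw [norm_neg, hxN.1])
  have e1 : ∀ k, Tp k = Tp 0 := fun k => tendsto_nhds_unique (hJ k).1 (hJ 0).1
  have e2 : ∀ k, Tm k = Tm 0 := fun k => tendsto_nhds_unique (hJ k).2.1 (hJ 0).2.1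
  refine ⟨Tp 0, Tm 0, (hJ 0).1, (hJ 0).2.1, ?_⟩
  have hη : Tendsto (fun k : ℕ => 1 / ((k : ℝ) + 16)) atTop (𝓝 0) := by
    simp_rw [one_div]
    exact tendsto_inv_atTop_zero.comp (tendsto_atTop_add_const_right _ _ tendsto_natCast_atTop_atTop)
  have hκ : Tendsto κ atTop (𝓝 1) := by
    have t1 : Tendsto (fun k : ℕ => ((1 - 1 / ((k : ℝ) + 16)) / (1 + 1 / ((k : ℝ) + 16))) ^ n) atTop (𝓝 (((1 - 0) / (1 + 0)) ^ n)) :=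
      ((hη.const_sub 1).div (hη.const_add 1) (by norm_num)).pow n
    have t2 : Tendsto (fun k : ℕ => ((1 + 1 / ((k : ℝ) + 16)) / (1 - 1 / ((k : ℝ) + 16))) ^ n) atTop (𝓝 (((1 + 0) / (1 - 0)) ^ n)) :=
      ((hη.const_add 1).div (hη.const_sub 1) (by norm_num)).pow n
    simp only [sub_zero, add_zero, div_one, one_pow] at t1 t2
    exact tendsto_of_tendsto_of_tendsto_of_le_of_le t1 t2 hκ1 hκ2
  refine tendsto_nhds_unique ?_ (hκ.mul_const _)
  refine tendsto_const_nhds.congr fun k => ?_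
  rw [← (hJ k).2.2, e1 k, e2 k]

lemma jump_main (hK : CZK n K C) {Ω : EW n → ℝ} (hf : ∀ x, x ≠ 0 → K x = Ω x / ‖x‖ ^ n)
    (hb : 0 < b) (hba : b < a) (ha : a < 1) {E : Set (EW n)} (hE : Rectifiable n E)
    (hEloc : ∀ x : EW n, ∃ r > 0, μH[n] (E ∩ ball x r) < ∞) {N : EW n → EW n} (ν : SignedMeasure (EW n))
    (hN : ∀ᵐ x ∂(hM n).restrict E, HasApproxTangentNormal n E x (N x)) :
    ∀ᵐ x ∂(hM n).restrict E, ∃ Tp Tm : ℝ,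
      Tendsto (fun y => Teps K ν (b * dist x y) y) (𝓝[cone a x (N x)] x) (𝓝 Tp) ∧
      Tendsto (fun y => Teps K ν (b * dist x y) y) (𝓝[cone a x (-N x)] x) (𝓝 Tm) ∧
      (Tp - Tm) / 2 = CK n Ω (N x) * ν.rnDeriv ((hM n).restrict E) x := by
  have hlf : IsLocallyFiniteMeasure ((hM n).restrict E) := ⟨fun x => by
    obtain ⟨r, hr, hx⟩ := hEloc x
    refine ⟨ball x r, ball_mem_nhds x hr, ?_⟩
    rw [Measure.restrict_apply measurableSet_ball, inter_comm]; exact hx⟩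
  set m := (hM n).restrict E with hm
  have hET : (hM n).restrict (toMeasurable μH[n] E) = m := by
    refine Measure.restrict_toMeasurable_of_cover (v := spanningSets m) (by rw [iUnion_spanningSets]; exact subset_univ _) fun k => ?_
    have h2 : m (spanningSets m k) = μH[n] (spanningSets m k ∩ E) := Measure.restrict_apply (measurableSet_spanningSets _ _)
    rw [inter_comm, ← h2]
    exact (measure_spanningSets_lt_top m k).ne
  set T := toMeasurable (hM n) E
  have hT : MeasurableSet T := measurableSet_toMeasurable _ _
  have hlf' : IsLocallyFiniteMeasure ((hM n).restrict T) := by rw [hET]; exact hlf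
  have hN' : ∀ᵐ x ∂(hM n).restrict T, HasApproxTangentNormal n E x (N x) := by rw [hET]; exact hN
  have k1 := jump_pos hK hf hb hba ha hT hE (hET.trans hm) hN' ν.toJordanDecomposition.posPart
  have k2 := jump_pos hK hf hb hba ha hT hE (hET.trans hm) hN' ν.toJordanDecomposition.negPart
  rw [hET] at k1 k2
  filter_upwards [k1, k2] with x ⟨P1, M1, a1, b1, c1⟩ ⟨P2, M2, a2, b2, c2⟩
  refine ⟨P1 - P2, M1 - M2, a1.sub a2, b1.sub b2, ?_⟩
  have e : ν.rnDeriv m x = (ν.toJordanDecomposition.posPart.rnDeriv m x).toReal - (ν.toJordanDecomposition.negPart.rnDeriv m x).toReal := rfl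
  rw [e]; linarith
end assembly3
end my

theorem jump_formula_difference
    (n : ℕ) (hn : 1 ≤ n)
    (K Ω : EuclideanSpace ℝ (Fin (n + 1)) → ℝ) (C : ℝ)
    (hΩhom : ∀ x : EuclideanSpace ℝ (Fin (n + 1)), x ≠ 0 → ∀ t : ℝ, 0 < t → Ω (t • x) = Ω x)
    (hKform : ∀ x : EuclideanSpace ℝ (Fin (n + 1)), x ≠ 0 → K x = Ω x / ‖x‖ ^ n)
    (hKodd : ∀ x : EuclideanSpace ℝ (Fin (n + 1)), K (-x) = -K x)
    (hKsmooth : ContDiffOn ℝ 2 K {(0 : EuclideanSpace ℝ (Fin (n + 1)))}ᶜ)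
    (hKbound : ∀ j ≤ 2, ∀ x : EuclideanSpace ℝ (Fin (n + 1)), x ≠ 0 →
      ‖iteratedFDerivWithin ℝ j K {(0 : EuclideanSpace ℝ (Fin (n + 1)))}ᶜ x‖ ≤ C / ‖x‖ ^ (n + j))
    (E : Set (EuclideanSpace ℝ (Fin (n + 1)))) (hE : Rectifiable n E)
    (hEloc : ∀ x : EuclideanSpace ℝ (Fin (n + 1)), ∃ r > 0, μH[n] (E ∩ ball x r) < ∞)
    (ν : MeasureTheory.SignedMeasure (EuclideanSpace ℝ (Fin (n + 1))))
    (a b : ℝ) (ha : a ∈ Set.Ioo (0 : ℝ) 1) (hb : b ∈ Set.Ioo 0 a)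
    (N : EuclideanSpace ℝ (Fin (n + 1)) → EuclideanSpace ℝ (Fin (n + 1)))
    (hNmeas : Measurable N)
    (hN : ∀ᵐ x ∂(μH[n].restrict E), HasApproxTangentNormal n E x (N x))
    (f : EuclideanSpace ℝ (Fin (n + 1)) → ℝ)
    (hf : f = ν.rnDeriv (μH[n].restrict E)) :
    ∀ᵐ x ∂(μH[n].restrict E), ∃ Tp Tm : ℝ,
      Tendsto (fun y => Teps K ν (b * dist x y) y) (𝓝[cone a x (N x)] x) (𝓝 Tp) ∧
      Tendsto (fun y => Teps K ν (b * dist x y) y) (𝓝[cone a x (-N x)] x) (𝓝 Tm) ∧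
      (Tp - Tm) / 2 = CK n Ω (N x) * f x := by
  subst hf
  exact jump_main (CZK.mk' n hn K Ω C hΩhom hKform hKodd hKsmooth hKbound) hKform hb.1 hb.2 ha.2 hE hEloc ν hN
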